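/- Let G be a group in the class 𝒰 with spectrum π, and let ω be a set of primes. Let A be a ℤG-module whose underlying additive group is a Černikov ω-group and all of whose proper ℤG-submodules are finite. Let φ : G → Aut(A) be the homomorphism arising from the action of G on A. If there exists g ∈ G such that no nonzero polynomial with integer coefficients annihilates φ(g) in the endomorphism ring of A, then the group cohomology H^n(G,A) is a Černikov ω-group for all n ≥ 0. -/

import Mathlib

/-!
Statement 5: transcendental action forces Černikov cohomology.
-/

open CategoryTheory

noncomputable section




/-- The rational circle `ℚ/ℤ`. -/
abbrev RatCircle : Type := ℚ ⧸ AddSubgroup.zmultiples (1 : ℚ)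

/-- The quasicyclic (Prüfer) `p`-group, realized as the `p`-primary part of `ℚ/ℤ`. -/
def pruferSubgroup (p : ℕ) : AddSubgroup RatCircle where
  carrier := {x | ∃ n : ℕ, (p ^ n : ℕ) • x = 0}
  zero_mem' := ⟨0, smul_zero _⟩
  add_mem' := by
    rintro a b ⟨m, hm⟩ ⟨n, hn⟩
    refine ⟨m + n, ?_⟩
    have ha : (p ^ m * p ^ n) • a = 0 := by rw [mul_comm, mul_smul, hm, smul_zero]
    have hb : (p ^ m * p ^ n) • b = 0 := by rw [mul_smul, hn, smul_zero]
    rw [smul_add, pow_add, ha, hb, add_zero]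
  neg_mem' := by
    rintro a ⟨m, hm⟩
    exact ⟨m, by rw [smul_neg, hm, neg_zero]⟩

/-- A group has a quasicyclic `p`-section if some quotient of a subgroup is
isomorphic to the Prüfer `p`-group. -/
def HasQuasicyclicSection (G : Type*) [Group G] (p : ℕ) : Prop :=
  ∃ (H : Subgroup G) (K : Subgroup H) (_ : K.Normal),
    Nonempty ((H ⧸ K) ≃* Multiplicative (pruferSubgroup p))

/-- The spectrum of a group: the set of primes `p` such that the group has a
section isomorphic to the quasicyclic `p`-group. -/
def groupSpectrum (G : Type*) [Group G] : Set ℕ :=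
  {p | p.Prime ∧ HasQuasicyclicSection G p}

/-- The spectrum of an (additive) abelian group, via `Multiplicative`. -/
abbrev addSpectrum (A : Type*) [AddGroup A] : Set ℕ :=
  groupSpectrum (Multiplicative A)

/-- An abelian group has finite rank if its torsion-free rank and all of its
`p`-ranks are finite. -/
def FiniteRankAbelian (A : Type*) [AddCommGroup A] : Prop :=
  (∃ n : ℕ, ∀ k : ℕ, (∃ f : (Fin k →₀ ℤ) →+ A, Function.Injective f) → k ≤ n) ∧
  ∀ p : ℕ, p.Prime → {a : A | (p : ℕ) • a = 0}.Finite

/-- A group has finite rank (in the sense appropriate for abelian groups: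
finite torsion-free rank and finite `p`-ranks). -/
def FiniteRankGroup (G : Type*) [Group G] : Prop :=
  (∃ n : ℕ, ∀ k : ℕ,
    (∃ f : Multiplicative (Fin k →₀ ℤ) →* G, Function.Injective f) → k ≤ n) ∧
  ∀ p : ℕ, p.Prime → {g : G | g ^ p = 1}.Finite

/-- A solvable group of finite rank: a solvable group all of whose abelian
sections have finite rank. -/
def SolvableOfFiniteRank (G : Type*) [Group G] : Prop :=
  IsSolvable G ∧
    ∀ (H : Subgroup G) (K : Subgroup H) (_ : K.Normal),
      (∀ x y : H ⧸ K, x * y = y * x) → FiniteRankGroup (H ⧸ K)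

/-- A group is virtually abelian. -/
def VirtuallyAbelian (G : Type*) [Group G] : Prop :=
  ∃ H : Subgroup G, H.index ≠ 0 ∧ ∀ x y : H, x * y = y * x

/-- A `ℤG`-module (given as an object of `Rep ℤ G`) whose underlying abelian group
is torsion-free, of finite rank, and `π`-spectral. -/
def NiceRep {G : Type} [Group G] (π : Set ℕ) (M : Rep.{0} ℤ G) : Prop :=
  (∀ m : M, m ≠ 0 → ¬IsOfFinAddOrder m) ∧ FiniteRankAbelian M ∧ addSpectrum M ⊆ π

/-- The class `𝒰` of solvable groups of finite rank. -/
def MemClassU (G : Type) [Group G] : Prop :=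
  SolvableOfFiniteRank G ∧
  ∃ (N : Subgroup G) (_ : N.Normal),
    Group.IsNilpotent N ∧
    Group.FG (G ⧸ N) ∧ VirtuallyAbelian (G ⧸ N) ∧
    ∃ (r : ℕ) (T : Fin (r + 1) → Subgroup G),
      Monotone T ∧ T 0 = ⊥ ∧
      ((T (Fin.last r) : Set G) = {g : G | g ∈ N ∧ IsOfFinOrder g}) ∧
      (∀ (i : Fin (r + 1)) (g t : G), t ∈ T i → g * t * g⁻¹ ∈ T i) ∧
      (∀ (i : Fin r) (n t : G), n ∈ N → t ∈ T i.succ →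
        n * t * n⁻¹ * t⁻¹ ∈ T i.castSucc) ∧
      (∀ i : Fin r, (T i.castSucc).relIndex (T i.succ) = 0 →
        ∃ M : Rep.{0} ℤ (G ⧸ N), NiceRep (groupSpectrum G) M ∧
          ∃ φ : M → G,
            (∀ m : M, φ m ∈ T i.succ) ∧
            (∀ m m' : M, (φ (m + m'))⁻¹ * (φ m * φ m') ∈ T i.castSucc) ∧
            (∀ t : G, t ∈ T i.succ → ∃ m : M, (φ m)⁻¹ * t ∈ T i.castSucc) ∧
            (∀ (g : G) (m : M),
              (φ (M.ρ (QuotientGroup.mk g) m))⁻¹ * (g * φ m * g⁻¹) ∈ T i.castSucc))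

/-- A Černikov abelian group: it has a subgroup of finite index that is a direct
sum of finitely many quasicyclic groups. -/
def IsCernikov (A : Type*) [AddCommGroup A] : Prop :=
  ∃ (S : AddSubgroup A) (r : ℕ) (p : Fin r → ℕ),
    S.index ≠ 0 ∧ (∀ i, (p i).Prime) ∧
    Nonempty (S ≃+ ((i : Fin r) → pruferSubgroup (p i)))

/-- A torsion `ω`-group: every element has finite order divisible only by primes
in `ω`. -/
def IsOmegaTorsion (ω : Set ℕ) (A : Type*) [AddGroup A] : Prop :=
  ∀ a : A, IsOfFinAddOrder a ∧
    ∀ p : ℕ, p.Prime → (p : ℤ) ∣ (addOrderOf a : ℤ) → p ∈ ω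

/-- A Černikov `ω`-group. -/
def IsCernikovOmega (ω : Set ℕ) (A : Type*) [AddCommGroup A] : Prop :=
  IsCernikov A ∧ IsOmegaTorsion ω A

/-- The subgroup `S` of (the underlying abelian group of) the representation `A`
is a `ℤG`-module quotient of some `ℤG`-module whose underlying abelian group is
torsion-free, of finite rank and `π`-spectral. -/
def IsQuotientOfNiceRep {G : Type} [Group G] (π : Set ℕ) (A : Rep ℤ G)
    (S : AddSubgroup A) : Prop :=
  ∃ M : Rep ℤ G, NiceRep π M ∧
    ∃ ψ : (M : Type) →+ (A : Type),
      (∀ m : M, ψ m ∈ S) ∧ (∀ a ∈ S, ∃ m : M, ψ m = a) ∧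
      ∀ (g : G) (m : M), ψ (M.ρ g m) = A.ρ g (ψ m)

set_option linter.all false

noncomputable section
namespace CC

section basic
variable {k : Type} [CommRing k] {G : Type} [Group G] {M : Type} [AddCommGroup M] [Module k M]

/-- inhomogeneous differential -/
def cd (ρ : Representation k G M) (n : ℕ) :
    ((Fin n → G) → M) →ₗ[k] ((Fin (n+1) → G) → M) where
  toFun f g := ρ (g 0) (f fun i => g i.succ) +
    ∑ j : Fin (n+1), (-1:k)^((j:ℕ)+1) • f (Fin.contractNth j (· * ·) g)
  map_add' x y := by
    funext g
    simp [Finset.sum_add_distrib, add_add_add_comm]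
  map_smul' r x := by
    funext g
    simp [Finset.smul_sum, smul_comm r]

lemma cd_apply (ρ : Representation k G M) (n : ℕ) (f : (Fin n → G) → M) (g : Fin (n+1) → G) :
    cd ρ n f g = ρ (g 0) (f fun i => g i.succ) +
    ∑ j : Fin (n+1), (-1:k)^((j:ℕ)+1) • f (Fin.contractNth j (· * ·) g) := rfl

lemma cd_eq (ρ : Representation k G M) (n : ℕ) (f : (Fin n → G) → M) :
    cd ρ n f = (inhomogeneousCochains.d (Rep.of ρ) n).hom f := by
  funext g
  rw [inhomogeneousCochains.d_hom_apply]
  rfl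

lemma cd_cd (ρ : Representation k G M) (n : ℕ) (f : (Fin n → G) → M) :
    cd ρ (n+1) (cd ρ n f) = 0 := by
  rw [cd_eq, cd_eq]
  have := groupCohomology.inhomogeneousCochains.d_comp_d (A := Rep.of ρ) (n := n)
  have h2 := congrArg (fun t => t.hom f) this
  simpa using h2

/-- coboundaries -/
def Bd (ρ : Representation k G M) : ∀ n, Submodule k ((Fin n → G) → M)
  | 0 => ⊥
  | n+1 => LinearMap.range (cd ρ n)

/-- cohomology -/
def H (ρ : Representation k G M) (n : ℕ) : Type :=
  (LinearMap.ker (cd ρ n)) ⧸ (Bd ρ n).comap (LinearMap.ker (cd ρ n)).subtype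

instance (ρ : Representation k G M) (n : ℕ) : AddCommGroup (H ρ n) :=
  inferInstanceAs (AddCommGroup ((LinearMap.ker (cd ρ n)) ⧸ (Bd ρ n).comap (LinearMap.ker (cd ρ n)).subtype))
instance (ρ : Representation k G M) (n : ℕ) : Module k (H ρ n) :=
  inferInstanceAs (Module k ((LinearMap.ker (cd ρ n)) ⧸ (Bd ρ n).comap (LinearMap.ker (cd ρ n)).subtype))

def Hq (ρ : Representation k G M) (n : ℕ) : LinearMap.ker (cd ρ n) →ₗ[k] H ρ n :=
  ((Bd ρ n).comap (LinearMap.ker (cd ρ n)).subtype).mkQ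

def Hmk (ρ : Representation k G M) (n : ℕ) (c : (Fin n → G) → M) (hc : cd ρ n c = 0) : H ρ n :=
  Hq ρ n ⟨c, hc⟩

lemma Hq_surj (ρ : Representation k G M) (n : ℕ) : Function.Surjective (Hq ρ n) :=
  Submodule.mkQ_surjective _

lemma Hmk_surj {ρ : Representation k G M} {n : ℕ} (x : H ρ n) : ∃ c hc, Hmk ρ n c hc = x := by
  obtain ⟨⟨c, hc⟩, rfl⟩ := Hq_surj ρ n x
  exact ⟨c, hc, rfl⟩

lemma Hmk_eq_zero {ρ : Representation k G M} {n : ℕ} {c} {hc : cd ρ n c = 0} :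
    Hmk ρ n c hc = 0 ↔ c ∈ Bd ρ n := by
  unfold Hmk Hq
  erw [Submodule.Quotient.mk_eq_zero]
  rfl

lemma Hmk_eq {ρ : Representation k G M} {n : ℕ} {c c'} {hc : cd ρ n c = 0} {hc' : cd ρ n c' = 0} :
    Hmk ρ n c hc = Hmk ρ n c' hc' ↔ c - c' ∈ Bd ρ n := by
  unfold Hmk Hq
  erw [Submodule.Quotient.eq]
  rfl

lemma Hmk_add {ρ : Representation k G M} {n : ℕ} {c c'} (hc : cd ρ n c = 0) (hc' : cd ρ n c' = 0) :
    Hmk ρ n c hc + Hmk ρ n c' hc' = Hmk ρ n (c + c') (by rw [map_add, hc, hc', add_zero]) := rfl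

lemma Hmk_smul {ρ : Representation k G M} {n : ℕ} {c} (r : k) (hc : cd ρ n c = 0) :
    r • Hmk ρ n c hc = Hmk ρ n (r • c) (by rw [map_smul, hc, smul_zero]) := rfl

lemma Hmk_sub {ρ : Representation k G M} {n : ℕ} {c c'} (hc : cd ρ n c = 0) (hc' : cd ρ n c' = 0) :
    Hmk ρ n c hc - Hmk ρ n c' hc' = Hmk ρ n (c - c') (by rw [map_sub, hc, hc', sub_zero]) := rfl

lemma Hmk_congr {ρ : Representation k G M} {n : ℕ} {c c'} (hc : cd ρ n c = 0) (h : c = c') :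
    Hmk ρ n c hc = Hmk ρ n c' (h ▸ hc) := by subst h; rfl

lemma Bd_succ {ρ : Representation k G M} {n : ℕ} {c} : c ∈ Bd ρ (n+1) ↔ ∃ b, cd ρ n b = c := Iff.rfl
lemma Bd_zero {ρ : Representation k G M} {c} : c ∈ Bd ρ 0 ↔ c = 0 := Iff.rfl

lemma cd_zero_apply (ρ : Representation k G M) (c : (Fin 0 → G) → M) (g : Fin 1 → G) :
    cd ρ 0 c g = ρ (g 0) (c default) - c default := by
  rw [cd_apply]
  simp [Subsingleton.elim _ (default : Fin 0 → G), sub_eq_add_neg]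

/-- H^0 as invariants -/
def Hconst (ρ : Representation k G M) (m : M) (hm : ∀ g, ρ g m = m) : H ρ 0 :=
  Hmk ρ 0 (fun _ => m) (by funext g; rw [cd_zero_apply, hm, sub_self]; rfl)

lemma Hconst_surj {ρ : Representation k G M} (x : H ρ 0) : ∃ m hm, Hconst ρ m hm = x := by
  obtain ⟨c, hc, rfl⟩ := Hmk_surj x
  refine ⟨c default, fun g => ?_, Hmk_congr _ (by funext t; rw [Subsingleton.elim t default])⟩
  have := congrFun hc (fun _ => g)
  rw [cd_zero_apply] at this
  exact sub_eq_zero.1 this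

lemma Hconst_inj {ρ : Representation k G M} {m m'} {hm hm'} (h : Hconst ρ m hm = Hconst ρ m' hm') :
    m = m' := by
  have := Bd_zero.1 (Hmk_eq.1 h)
  exact sub_eq_zero.1 (congrFun this default)

lemma Hconst_eq_zero {ρ : Representation k G M} {m} {hm} (h : Hconst ρ m hm = 0) :
    m = 0 := by
  have := Bd_zero.1 (Hmk_eq_zero.1 h)
  exact (congrFun this default)

end basic

/-- morphisms of pairs -/
structure PHom {k : Type} [CommRing k] {G₁ M₁ G₂ M₂ : Type} [Group G₁] [Group G₂]
  [AddCommGroup M₁] [Module k M₁] [AddCommGroup M₂] [Module k M₂]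
  (ρ₁ : Representation k G₁ M₁) (ρ₂ : Representation k G₂ M₂) where
  grp : G₂ →* G₁
  lin : M₁ →ₗ[k] M₂
  compat : ∀ g m, lin (ρ₁ (grp g) m) = ρ₂ g (lin m)

section maps
variable {k : Type} [CommRing k] {G₁ M₁ G₂ M₂ G₃ M₃ : Type} [Group G₁] [Group G₂] [Group G₃]
  [AddCommGroup M₁] [Module k M₁] [AddCommGroup M₂] [Module k M₂] [AddCommGroup M₃] [Module k M₃]
  {ρ₁ : Representation k G₁ M₁} {ρ₂ : Representation k G₂ M₂} {ρ₃ : Representation k G₃ M₃}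

def PHom.id (ρ₁ : Representation k G₁ M₁) : PHom ρ₁ ρ₁ := ⟨MonoidHom.id _, LinearMap.id, fun _ _ => rfl⟩

def PHom.comp (ψ : PHom ρ₂ ρ₃) (φ : PHom ρ₁ ρ₂) : PHom ρ₁ ρ₃ :=
  ⟨φ.grp.comp ψ.grp, ψ.lin.comp φ.lin, fun g m => by simp [φ.compat, ψ.compat]⟩

lemma PHom.ext' {φ ψ : PHom ρ₁ ρ₂} (h1 : ∀ g, φ.grp g = ψ.grp g) (h2 : ∀ m, φ.lin m = ψ.lin m) : φ = ψ := by
  obtain ⟨a, b, c⟩ := φ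
  obtain ⟨a', b', c'⟩ := ψ
  have e1 : a = a' := MonoidHom.ext h1
  have e2 : b = b' := LinearMap.ext h2
  subst e1 e2; rfl

def cmap (φ : PHom ρ₁ ρ₂) (n : ℕ) : ((Fin n → G₁) → M₁) →ₗ[k] ((Fin n → G₂) → M₂) where
  toFun c g := φ.lin (c (fun i => φ.grp (g i)))
  map_add' _ _ := by funext g; simp
  map_smul' _ _ := by funext g; simp

lemma cmap_apply (φ : PHom ρ₁ ρ₂) (n : ℕ) (c : (Fin n → G₁) → M₁) (g) :
  cmap φ n c g = φ.lin (c (fun i => φ.grp (g i))) := rfl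

lemma contract_map (α : G₂ →* G₁) {n : ℕ} (j : Fin (n+1)) (g : Fin (n+1) → G₂) :
    (fun i => α (Fin.contractNth j (· * ·) g i)) = Fin.contractNth j (· * ·) (fun i => α (g i)) := by
  funext i
  unfold Fin.contractNth
  split_ifs <;> simp

lemma cd_cmap (φ : PHom ρ₁ ρ₂) (n : ℕ) (c : (Fin n → G₁) → M₁) :
    cd ρ₂ n (cmap φ n c) = cmap φ (n+1) (cd ρ₁ n c) := by
  funext g
  simp only [cd_apply, cmap_apply, map_add, map_sum, map_smul, φ.compat, contract_map]

lemma cmap_Bd (φ : PHom ρ₁ ρ₂) {n : ℕ} {c : (Fin n → G₁) → M₁} (hc : c ∈ Bd ρ₁ n) :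
    cmap φ n c ∈ Bd ρ₂ n := by
  cases n with
  | zero => rw [Bd_zero] at *; subst hc; simp
  | succ n => obtain ⟨b, rfl⟩ := hc; exact ⟨cmap φ n b, cd_cmap φ n b⟩

lemma cmap_cocycle (φ : PHom ρ₁ ρ₂) {n : ℕ} {c : (Fin n → G₁) → M₁} (hc : cd ρ₁ n c = 0) :
    cd ρ₂ n (cmap φ n c) = 0 := by rw [cd_cmap, hc, map_zero]

def Hmap (φ : PHom ρ₁ ρ₂) (n : ℕ) : H ρ₁ n →ₗ[k] H ρ₂ n :=
  Submodule.liftQ _ ((Hq ρ₂ n).comp ((cmap φ n).restrict (p := LinearMap.ker (cd ρ₁ n)) (q := LinearMap.ker (cd ρ₂ n))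
    (fun _ hc => cmap_cocycle φ hc))) (by
      rintro ⟨c, hc⟩ h
      exact Hmk_eq_zero.2 (cmap_Bd φ h))

lemma Hmap_mk (φ : PHom ρ₁ ρ₂) (n : ℕ) (c) (hc : cd ρ₁ n c = 0) :
    Hmap φ n (Hmk ρ₁ n c hc) = Hmk ρ₂ n (cmap φ n c) (cmap_cocycle φ hc) := rfl

lemma Hmap_const (φ : PHom ρ₁ ρ₂) (m hm hm') :
    Hmap φ 0 (Hconst ρ₁ m hm) = Hconst ρ₂ (φ.lin m) hm' := rfl

lemma Hmap_const' (φ : PHom ρ₁ ρ₂) (m hm) :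
    ∃ hm', Hmap φ 0 (Hconst ρ₁ m hm) = Hconst ρ₂ (φ.lin m) hm' :=
  ⟨fun g => by rw [← φ.compat, hm], rfl⟩

lemma Hmap_id (n : ℕ) (x) : Hmap (PHom.id ρ₁) n x = x := by
  obtain ⟨c, hc, rfl⟩ := Hmk_surj x
  rfl

lemma Hmap_comp (ψ : PHom ρ₂ ρ₃) (φ : PHom ρ₁ ρ₂) (n : ℕ) (x) :
    Hmap (ψ.comp φ) n x = Hmap ψ n (Hmap φ n x) := by
  obtain ⟨c, hc, rfl⟩ := Hmk_surj x
  rfl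

lemma Hmap_zero (φ : PHom ρ₁ ρ₂) (h : φ.lin = 0) (n : ℕ) (x) : Hmap φ n x = 0 := by
  obtain ⟨c, hc, rfl⟩ := Hmk_surj x
  rw [Hmap_mk, Hmk_eq_zero]
  convert Submodule.zero_mem _
  funext g
  simp [cmap_apply, h]

/-- isomorphism of pairs gives bijection -/
lemma Hmap_bij (φ : PHom ρ₁ ρ₂) (ψ : PHom ρ₂ ρ₁) (h1 : ψ.comp φ = PHom.id _) (h2 : φ.comp ψ = PHom.id _) (n : ℕ) :
    Function.Bijective (Hmap φ n) := by
  refine ⟨Function.LeftInverse.injective (g := Hmap ψ n) fun x => ?_,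
    Function.RightInverse.surjective (g := Hmap ψ n) fun x => ?_⟩
  · rw [← Hmap_comp, h1, Hmap_id]
  · rw [← Hmap_comp, h2, Hmap_id]

/-- bijective linear with bijective group hom -/
lemma Hmap_bij' (φ : PHom ρ₁ ρ₂) (h1 : Function.Bijective φ.grp) (h2 : Function.Bijective φ.lin) (n : ℕ) :
    Function.Bijective (Hmap φ n) := by
  let e := MulEquiv.ofBijective φ.grp h1
  let l := LinearEquiv.ofBijective φ.lin h2
  refine Hmap_bij φ ⟨e.symm.toMonoidHom, l.symm.toLinearMap, fun g m => ?_⟩ (PHom.ext' ?_ ?_) (PHom.ext' ?_ ?_) n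
  · apply l.injective
    have := φ.compat (e.symm g) (l.symm m)
    have e1 : φ.grp (e.symm g) = g := e.apply_symm_apply g
    have e2 : φ.lin (l.symm m) = m := l.apply_symm_apply m
    rw [e1, e2] at this
    change l (l.symm _) = φ.lin (ρ₁ g (l.symm m))
    rw [this]; exact l.apply_symm_apply _
  · intro g; exact e.apply_symm_apply g
  · intro g; exact l.symm_apply_apply g
  · intro g; exact e.symm_apply_apply g
  · intro g; exact l.apply_symm_apply g

end maps

section les
variable {k : Type} [CommRing k] {G A B C : Type} [Group G]
  [AddCommGroup A] [Module k A] [AddCommGroup B] [Module k B] [AddCommGroup C] [Module k C]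

structure SES (ρA : Representation k G A) (ρB : Representation k G B) (ρC : Representation k G C)
   (f : A →ₗ[k] B) (g : B →ₗ[k] C) : Prop where
  hf : ∀ x m, f (ρA x m) = ρB x (f m)
  hg : ∀ x m, g (ρB x m) = ρC x (g m)
  inj : Function.Injective f
  surj : Function.Surjective g
  exact : Function.Exact f g

variable {ρA : Representation k G A} {ρB : Representation k G B} {ρC : Representation k G C}
   {f : A →ₗ[k] B} {g : B →ₗ[k] C} 

def PHom.ofLin (f : A →ₗ[k] B) (hf : ∀ x m, f (ρA x m) = ρB x (f m)) : PHom ρA ρB :=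
  ⟨MonoidHom.id _, f, hf⟩

def SES.F (s : SES ρA ρB ρC f g) : PHom ρA ρB := PHom.ofLin f s.hf
def SES.Gm (s : SES ρA ρB ρC f g) : PHom ρB ρC := PHom.ofLin g s.hg

lemma SES.cF_inj (s : SES ρA ρB ρC f g) (n : ℕ) : Function.Injective (cmap s.F n) := by
  intro a b h
  funext x
  exact s.inj (congrFun h x)

lemma SES.cG_surj (s : SES ρA ρB ρC f g) (n : ℕ) : Function.Surjective (cmap s.Gm n) := by
  intro c
  exact ⟨fun x => Function.surjInv s.surj (c x), funext fun x => Function.surjInv_eq s.surj _⟩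

lemma SES.c_exact (s : SES ρA ρB ρC f g) (n : ℕ) (b) (h : cmap s.Gm n b = 0) : ∃ a, cmap s.F n a = b := by
  have : ∀ x, ∃ a, f a = b x := fun x => (s.exact _).1 (congrFun h x)
  choose a ha using this
  exact ⟨a, funext ha⟩

lemma SES.GF (s : SES ρA ρB ρC f g) (n : ℕ) (a) : cmap s.Gm n (cmap s.F n a) = 0 := by
  funext x
  exact s.exact.apply_apply_eq_zero _

lemma SES.wd (s : SES ρA ρB ρC f g) {n : ℕ} {a b} (h : cd ρB n b = cmap s.F (n+1) a)
    (hb : cmap s.Gm n b ∈ Bd ρC n) : a ∈ Bd ρA (n+1) := by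
  cases n with
  | zero =>
    obtain ⟨a', rfl⟩ := s.c_exact 0 b (Bd_zero.1 hb)
    exact ⟨a', s.cF_inj _ (by rw [← h, cd_cmap])⟩
  | succ n =>
    obtain ⟨e, he⟩ := hb
    obtain ⟨e', rfl⟩ := s.cG_surj _ e
    obtain ⟨a', ha'⟩ := s.c_exact _ (b - cd ρB n e') (by rw [map_sub, ← he, cd_cmap, sub_self])
    exact ⟨a', s.cF_inj _ (by rw [← h, ← cd_cmap, ha', map_sub, cd_cd, sub_zero])⟩

lemma SES.ex (s : SES ρA ρB ρC f g) {n : ℕ} {c} (hc : cd ρC n c = 0) :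
    ∃ a b, cmap s.Gm n b = c ∧ cd ρB n b = cmap s.F (n+1) a ∧ cd ρA (n+1) a = 0 := by
  obtain ⟨b, rfl⟩ := s.cG_surj _ c
  obtain ⟨a, ha⟩ := s.c_exact _ (cd ρB n b) (by rw [← cd_cmap, hc])
  refine ⟨a, b, rfl, ha.symm, s.cF_inj _ ?_⟩
  rw [← cd_cmap, ha, cd_cd, map_zero]

def SES.dA (s : SES ρA ρB ρC f g) {n : ℕ} (c : LinearMap.ker (cd ρC n)) : (Fin (n+1) → G) → A :=
  (s.ex (LinearMap.mem_ker.1 c.2)).choose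
def SES.dB (s : SES ρA ρB ρC f g) {n : ℕ} (c : LinearMap.ker (cd ρC n)) : (Fin n → G) → B :=
  (s.ex (LinearMap.mem_ker.1 c.2)).choose_spec.choose
lemma SES.dspec (s : SES ρA ρB ρC f g) {n : ℕ} (c : LinearMap.ker (cd ρC n)) :
    cmap s.Gm n (s.dB c) = c ∧ cd ρB n (s.dB c) = cmap s.F (n+1) (s.dA c) ∧ cd ρA (n+1) (s.dA c) = 0 :=
  (s.ex (LinearMap.mem_ker.1 c.2)).choose_spec.choose_spec

def SES.δ (s : SES ρA ρB ρC f g) (n : ℕ) : H ρC n →ₗ[k] H ρA (n+1) :=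
  Submodule.liftQ _ 
    { toFun := fun c => Hmk ρA (n+1) (s.dA c) (s.dspec c).2.2
      map_add' := by
        intro c c'
        obtain ⟨h1, h2, h3⟩ := s.dspec (c+c')
        obtain ⟨h1', h2', h3'⟩ := s.dspec c
        obtain ⟨h1'', h2'', h3''⟩ := s.dspec c'
        rw [Hmk_add, Hmk_eq]
        refine s.wd (b := s.dB (c+c') - (s.dB c + s.dB c')) (by rw [map_sub, map_add, h2, h2', h2'', ← map_add, ← map_sub]) ?_
        rw [map_sub, map_add, h1, h1', h1'']
        simp
      map_smul' := by
        intro r c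
        obtain ⟨h1, h2, h3⟩ := s.dspec (r • c)
        obtain ⟨h1', h2', h3'⟩ := s.dspec c
        rw [RingHom.id_apply, Hmk_smul, Hmk_eq]
        refine s.wd (b := s.dB (r • c) - r • s.dB c) (by rw [map_sub, map_smul, h2, h2', ← map_smul, ← map_sub]) ?_
        rw [map_sub, map_smul, h1, h1']
        simp } (by
      rintro c h
      refine Hmk_eq_zero.2 ?_
      obtain ⟨h1', h2', h3'⟩ := s.dspec c
      exact s.wd h2' (by rw [h1']; exact h))

lemma SES.δ_mk (s : SES ρA ρB ρC f g) {n : ℕ} {a b} (h : cd ρB n b = cmap s.F (n+1) a) (hc ha) :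
    s.δ n (Hmk ρC n (cmap s.Gm n b) hc) = Hmk ρA (n+1) a ha := by
  obtain ⟨h1, h2, h3⟩ := s.dspec ⟨_, hc⟩
  change Hmk ρA (n+1) (s.dA ⟨_, hc⟩) _ = _
  rw [Hmk_eq]
  refine s.wd (b := s.dB ⟨_, hc⟩ - b) (by rw [map_sub, h2, h, ← map_sub]) ?_
  rw [map_sub, h1, sub_self]
  exact Submodule.zero_mem _

lemma SES.ex' (s : SES ρA ρB ρC f g) {n : ℕ} (x : H ρC n) :
    ∃ a b ha hc, cd ρB n b = cmap s.F (n+1) a ∧ x = Hmk ρC n (cmap s.Gm n b) hc ∧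
      s.δ n x = Hmk ρA (n+1) a ha := by
  obtain ⟨c, hc, rfl⟩ := Hmk_surj x
  obtain ⟨a, b, rfl, h2, h3⟩ := s.ex hc
  exact ⟨a, b, h3, hc, h2, rfl, s.δ_mk h2 _ _⟩

lemma SES.exact1 (s : SES ρA ρB ρC f g) (n : ℕ) : Function.Exact (Hmap s.F n) (Hmap s.Gm n) := by
  intro x
  constructor
  · intro h
    obtain ⟨b, hb, rfl⟩ := Hmk_surj x
    rw [Hmap_mk, Hmk_eq_zero] at h
    cases n with
    | zero =>
      obtain ⟨a, rfl⟩ := s.c_exact 0 b (Bd_zero.1 h)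
      exact ⟨Hmk ρA 0 a (s.cF_inj _ (by rw [← cd_cmap, hb, map_zero])), rfl⟩
    | succ n =>
      obtain ⟨e, he⟩ := h
      obtain ⟨e', rfl⟩ := s.cG_surj _ e
      obtain ⟨a', ha'⟩ := s.c_exact _ (b - cd ρB n e') (by rw [map_sub, ← he, cd_cmap, sub_self])
      refine ⟨Hmk ρA _ a' (s.cF_inj _ (by rw [← cd_cmap, ha', map_sub, hb, cd_cd, map_zero, sub_zero])), ?_⟩
      rw [Hmap_mk, Hmk_eq, ha']
      exact ⟨-e', by simp⟩
  · rintro ⟨y, rfl⟩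
    rw [← Hmap_comp]
    exact Hmap_zero _ (LinearMap.ext fun a => s.exact.apply_apply_eq_zero a) _ _

lemma SES.exact2 (s : SES ρA ρB ρC f g) (n : ℕ) : Function.Exact (Hmap s.Gm n) (s.δ n) := by
  intro x
  constructor
  · intro h
    obtain ⟨a, b, ha, hc, h1, rfl, h2⟩ := s.ex' x
    rw [h2, Hmk_eq_zero] at h
    obtain ⟨a', rfl⟩ := h
    refine ⟨Hmk ρB n (b - cmap s.F n a') (by rw [map_sub, h1, cd_cmap, sub_self]), ?_⟩
    rw [Hmap_mk]
    refine Hmk_congr _ ?_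
    rw [map_sub, s.GF, sub_zero]
  · rintro ⟨y, rfl⟩
    obtain ⟨b, hb, rfl⟩ := Hmk_surj y
    rw [Hmap_mk, s.δ_mk (a := 0) (by rw [hb, map_zero]) _ (map_zero _), Hmk_eq_zero]
    exact Submodule.zero_mem _

lemma SES.exact3 (s : SES ρA ρB ρC f g) (n : ℕ) : Function.Exact (s.δ n) (Hmap s.F (n+1)) := by
  intro x
  constructor
  · intro h
    obtain ⟨a, ha, rfl⟩ := Hmk_surj x
    rw [Hmap_mk, Hmk_eq_zero] at h
    obtain ⟨b, hb⟩ := h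
    refine ⟨Hmk ρC n (cmap s.Gm n b) (by rw [cd_cmap, hb, s.GF]), ?_⟩
    rw [s.δ_mk hb]
  · rintro ⟨y, rfl⟩
    obtain ⟨a, b, ha, hc, h1, rfl, h2⟩ := s.ex' y
    rw [h2, Hmap_mk, Hmk_eq_zero]
    exact ⟨b, h1⟩

lemma SES.inj0 (s : SES ρA ρB ρC f g) : Function.Injective (Hmap s.F 0) := by
  rw [injective_iff_map_eq_zero]
  intro x h
  obtain ⟨a, ha, rfl⟩ := Hmk_surj x
  rw [Hmap_mk, Hmk_eq_zero] at h
  rw [Hmk_eq_zero]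
  exact Bd_zero.2 (s.cF_inj _ (by rw [Bd_zero.1 h, map_zero]))

variable {G' A' B' C' : Type} [Group G']
  [AddCommGroup A'] [Module k A'] [AddCommGroup B'] [Module k B'] [AddCommGroup C'] [Module k C']
 {ρA' : Representation k G' A'} {ρB' : Representation k G' B'} {ρC' : Representation k G' C'}
   {f' : A' →ₗ[k] B'} {g' : B' →ₗ[k] C'} 

lemma SES.δ_nat (s : SES ρA ρB ρC f g) (s' : SES ρA' ρB' ρC' f' g')
    (φA : PHom ρA ρA') (φB : PHom ρB ρB') (φC : PHom ρC ρC')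
    (e1 : ∀ x, φA.grp x = φB.grp x) (e2 : ∀ x, φC.grp x = φB.grp x)
    (hl : ∀ a, φB.lin (f a) = f' (φA.lin a)) (hr : ∀ b, φC.lin (g b) = g' (φB.lin b)) (n : ℕ) (x) :
    s'.δ n (Hmap φC n x) = Hmap φA (n+1) (s.δ n x) := by
  obtain ⟨a, b, ha, hc, h1, rfl, h2⟩ := s.ex' x
  rw [h2, Hmap_mk, Hmap_mk]
  have : cmap φC n (cmap s.Gm n b) = cmap s'.Gm n (cmap φB n b) := by
    funext x
    simp only [cmap_apply]
    change φC.lin (g _) = g' (φB.lin _)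
    rw [hr]
    simp only [e2]
    rfl
  rw [Hmk_congr _ this]
  refine s'.δ_mk ?_ _ _
  rw [cd_cmap, h1]
  funext x
  simp only [cmap_apply]
  change φB.lin (f _) = f' (φA.lin _)
  rw [hl]
  simp only [e1]
  rfl

end les
end CC
end

noncomputable section
namespace CC

section coind
variable {k : Type} [CommRing k] {N S : Type} [Group N] [Group S] 

/-- functions `S → M` with right translation through `α` -/
def coind (k : Type) [CommRing k] (α : N →* S) (M : Type) [AddCommGroup M] [Module k M] :
    Representation k N (S → M) where
  toFun n := { toFun := fun F x => F (x * α n), map_add' := fun _ _ => rfl, map_smul' := fun _ _ => rfl }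
  map_one' := by ext F x; simp
  map_mul' a b := by ext F x; simp [mul_assoc]

variable {M : Type} [AddCommGroup M] [Module k M]

@[simp] lemma coind_apply (α : N →* S) (n : N) (F : S → M) (x : S) :
    coind k α M n F x = F (x * α n) := rfl

lemma contract_cons_zero {n : ℕ} (ν : N) (g : Fin (n+1) → N) :
    Fin.contractNth 0 (· * ·) (Fin.cons ν g : Fin (n+2) → N) = Fin.cons (ν * g 0) (fun i : Fin n => g i.succ) := by
  funext i
  refine Fin.cases ?_ (fun i => ?_) i
  · simp [Fin.contractNth]
  · simp [Fin.contractNth]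

lemma contract_cons_succ {n : ℕ} (j : Fin (n+1)) (ν : N) (g : Fin (n+1) → N) :
    Fin.contractNth j.succ (· * ·) (Fin.cons ν g : Fin (n+2) → N) = 
      Fin.cons ν (Fin.contractNth j (· * ·) g) := by
  funext i
  refine Fin.cases ?_ (fun i => ?_) i
  · simp [Fin.contractNth]
  · simp only [Fin.contractNth, Fin.val_succ, Fin.cons_succ, Nat.add_lt_add_iff_right]
    by_cases h : (i:ℕ) < j
    · simp only [h, if_true]
      rw [show (i.succ.castSucc : Fin (n+2)) = (i.castSucc).succ from rfl, Fin.cons_succ]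
    · simp only [h, if_false, add_left_inj]
      rw [show (i.succ.castSucc : Fin (n+2)) = (i.castSucc).succ from rfl, Fin.cons_succ]

lemma exists_cosetrep (α : N →* S) (hα : Function.Injective α) :
    ∃ (t : S → S) (ν : S → N), (∀ x, x = t x * α (ν x)) ∧ (∀ x g, t (x * α g) = t x) ∧
      ∀ x g, ν (x * α g) = ν x * g := by
  let t : S → S := fun x => Quotient.out (QuotientGroup.mk (s := α.range) x)
  have h1 : ∀ x, ∃ n, x = t x * α n := by
    intro x
    have : (QuotientGroup.mk (s := α.range) (t x)) = QuotientGroup.mk (s := α.range) x := Quotient.out_eq _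
    rw [QuotientGroup.eq] at this
    obtain ⟨n, hn⟩ := this
    exact ⟨n, by rw [hn]; group⟩
  choose ν hν using h1
  have h2 : ∀ x g, t (x * α g) = t x := by
    intro x g
    have : (QuotientGroup.mk (s := α.range) (x * α g)) = QuotientGroup.mk (s := α.range) x := by
      symm
      rw [QuotientGroup.eq]
      exact ⟨g, by group⟩
    simp only [t, this]
  refine ⟨t, ν, hν, h2, fun x g => hα ?_⟩
  have := hν (x * α g)
  rw [h2] at this
  have h3 := hν x
  rw [map_mul]
  apply mul_left_cancel (a := t x)
  rw [← this, ← mul_assoc, ← h3]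

lemma coind_acyclic (α : N →* S) (hα : Function.Injective α) (n : ℕ) (x : H (coind k α M) (n+1)) : x = 0 := by
  obtain ⟨c, hc, rfl⟩ := Hmk_surj x
  obtain ⟨t, ν, h1, h2, h3⟩ := exists_cosetrep α hα
  rw [Hmk_eq_zero]
  refine ⟨fun g x => c (Fin.cons (ν x) g) (t x), ?_⟩
  funext g x
  have hz := congrFun (congrFun hc (Fin.cons (ν x) g)) (t x)
  rw [cd_apply, Fin.sum_univ_succ, contract_cons_zero] at hz
  simp only [contract_cons_succ] at hz
  rw [cd_apply]
  simp only [Pi.add_apply, Pi.smul_apply, Finset.sum_apply, Fin.cons_zero, Fin.cons_succ, coind_apply, ← h1,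
    Pi.zero_apply, Fin.val_zero, zero_add, pow_one, neg_smul, one_smul, Fin.val_succ] at hz ⊢
  rw [h2, h3]
  rw [← sub_eq_zero, ← neg_eq_zero]
  rw [← hz]
  simp only [pow_succ _ ((_:ℕ) + 1), mul_neg, mul_one, neg_smul, Finset.sum_neg_distrib, Pi.neg_apply]
  abel
end coind

section constr
variable {k : Type} [CommRing k] {G A B : Type} [Group G]
  [AddCommGroup A] [Module k A] [AddCommGroup B] [Module k B]

def quotRep (ρ : Representation k G B) (W : Submodule k B) (h : ∀ g, ∀ w ∈ W, ρ g w ∈ W) :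
    Representation k G (B ⧸ W) where
  toFun g := W.mapQ W (ρ g) (fun w hw => h g w hw)
  map_one' := by ext; simp
  map_mul' a b := by ext; simp

def subRep (ρ : Representation k G B) (W : Submodule k B) (h : ∀ g, ∀ w ∈ W, ρ g w ∈ W) :
    Representation k G W where
  toFun g := (ρ g).restrict (fun w hw => h g w hw)
  map_one' := by ext; simp
  map_mul' a b := by ext; simp

@[simp] lemma subRep_coe (ρ : Representation k G B) (W : Submodule k B) (h) (g : G) (w : W) :
  ((subRep ρ W h g w : W) : B) = ρ g w := rfl

@[simp] lemma quotRep_mk (ρ : Representation k G B) (W : Submodule k B) (h) (g : G) (b : B) :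
  quotRep ρ W h g (W.mkQ b) = W.mkQ (ρ g b) := rfl

lemma range_stable {ρA : Representation k G A} {ρB : Representation k G B} {f : A →ₗ[k] B}
    (hf : ∀ x m, f (ρA x m) = ρB x (f m)) : ∀ g, ∀ w ∈ LinearMap.range f, ρB g w ∈ LinearMap.range f := by
  rintro g _ ⟨a, rfl⟩
  exact ⟨ρA g a, hf g a⟩

lemma ses_quot {ρA : Representation k G A} {ρB : Representation k G B} {f : A →ₗ[k] B}
    (hf : ∀ x m, f (ρA x m) = ρB x (f m)) (hi : Function.Injective f) :
    SES ρA ρB (quotRep ρB (LinearMap.range f) (range_stable hf)) f (LinearMap.range f).mkQ :=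
  ⟨hf, fun _ _ => rfl, hi, Submodule.mkQ_surjective _, by
    intro b; simp [Submodule.mkQ_apply]⟩

lemma ses_sub (ρB : Representation k G B) (W : Submodule k B) (h : ∀ g, ∀ w ∈ W, ρB g w ∈ W) :
    SES (subRep ρB W h) ρB (quotRep ρB W h) W.subtype W.mkQ :=
  ⟨fun _ _ => rfl, fun _ _ => rfl, Subtype.val_injective, Submodule.mkQ_surjective _, by
    intro b; simp [Submodule.mkQ_apply]⟩

/-- shift embedding -/
def shiftι (ρ : Representation k G A) : A →ₗ[k] (G → A) where
  toFun m x := ρ x m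
  map_add' _ _ := by funext; simp
  map_smul' _ _ := by funext; simp

lemma shiftι_inj (ρ : Representation k G A) : Function.Injective (shiftι ρ) := by
  intro a b h
  have := congrFun h 1
  simpa [shiftι] using this

lemma shiftι_eq (ρ : Representation k G A) (x : G) (m : A) :
    shiftι ρ (ρ x m) = coind k (MonoidHom.id G) A x (shiftι ρ m) := by
  funext y; simp [shiftι]

abbrev I (ρ : Representation k G A) : Representation k G (G → A) := coind k (MonoidHom.id G) A

abbrev sh (ρ : Representation k G A) : Representation k G ((G → A) ⧸ LinearMap.range (shiftι ρ)) :=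
  quotRep (I ρ) (LinearMap.range (shiftι ρ)) (range_stable (shiftι_eq ρ))

lemma shSES (ρ : Representation k G A) : SES ρ (I ρ) (sh ρ) (shiftι ρ) (LinearMap.range (shiftι ρ)).mkQ :=
  ses_quot (shiftι_eq ρ) (shiftι_inj ρ)

lemma I_acyclic (ρ : Representation k G A) (n : ℕ) (x : H (I ρ) (n+1)) : x = 0 :=
  coind_acyclic _ Function.injective_id n x

lemma sh_surj (ρ : Representation k G A) (n : ℕ) : Function.Surjective ((shSES ρ).δ n) := by
  intro x
  exact ((shSES ρ).exact3 n x).1 (I_acyclic _ _ _)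

lemma sh_inj (ρ : Representation k G A) (n : ℕ) : Function.Injective ((shSES ρ).δ (n+1)) := by
  rw [injective_iff_map_eq_zero]
  intro x hx
  obtain ⟨y, rfl⟩ := ((shSES ρ).exact2 (n+1) x).1 hx
  rw [I_acyclic _ _ y, map_zero]

/-- inner automorphism -/
def inner (ρ : Representation k G A) (g : G) : PHom ρ ρ :=
  ⟨(MulAut.conj g⁻¹).toMonoidHom, ρ g, fun x m => by
    simp only [MulEquiv.toMonoidHom_eq_coe, MonoidHom.coe_coe, MulAut.conj_apply, inv_inv, map_mul, Module.End.mul_apply]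
    rw [← Module.End.mul_apply (ρ g) (ρ g⁻¹), ← map_mul, mul_inv_cancel, map_one, Module.End.one_apply]⟩

end constr

lemma Hmap_inner {k : Type} [CommRing k] {G : Type} [Group G] (n : ℕ) : ∀ {A : Type}
    [AddCommGroup A] [Module k A] (ρ : Representation k G A) (g : G) (x : H ρ n), Hmap (inner ρ g) n x = x := by
  induction n with
  | zero =>
    intro A _ _ ρ g x
    obtain ⟨m, hm, rfl⟩ := Hconst_surj x
    rw [Hmap_const (hm' := by intro h; change ρ h (ρ g m) = ρ g m; rw [hm, hm])]
    have : (inner ρ g).lin m = m := hm g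
    simp only [this]
  | succ n ih =>
    intro A _ _ ρ g x
    obtain ⟨y, rfl⟩ := sh_surj ρ n x
    rw [← (shSES ρ).δ_nat (shSES ρ) (inner ρ g) (inner (I ρ) g) (inner (sh ρ) g) (fun _ => rfl) (fun _ => rfl)
      (fun a => (shiftι_eq ρ g a).symm) (fun b => rfl), ih]

section Serre
variable {k : Type} [CommRing k]

structure IsSerre (P : ∀ (X : Type) [AddCommGroup X] [Module k X], Prop) : Prop where
  mid : ∀ {X Y Z : Type} [AddCommGroup X] [Module k X] [AddCommGroup Y] [Module k Y] [AddCommGroup Z] [Module k Z]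
    (f : X →ₗ[k] Y) (g : Y →ₗ[k] Z), Function.Exact f g → P X → P Z → P Y
  zero : P Unit

variable {P : ∀ (X : Type) [AddCommGroup X] [Module k X], Prop}
  {X Y Z W : Type} [AddCommGroup X] [Module k X] [AddCommGroup Y] [Module k Y] [AddCommGroup Z] [Module k Z]
  [AddCommGroup W] [Module k W]

lemma IsSerre.inj (hP : IsSerre P) (g : Y →ₗ[k] Z) (hg : Function.Injective g) (h : P Z) : P Y :=
  hP.mid (0 : Unit →ₗ[k] Y) g (fun y => ⟨fun h => ⟨(), by
    rw [LinearMap.zero_apply]; exact (hg (by rw [h, map_zero])).symm⟩, by rintro ⟨_, rfl⟩; simp⟩) hP.zero h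

lemma IsSerre.surj (hP : IsSerre P) (f : X →ₗ[k] Y) (hf : Function.Surjective f) (h : P X) : P Y :=
  hP.mid f (0 : Y →ₗ[k] Unit) (fun y => ⟨fun _ => hf y, fun _ => rfl⟩) h hP.zero

lemma IsSerre.subs (hP : IsSerre P) (h : ∀ x : X, x = 0) : P X :=
  hP.inj (0 : X →ₗ[k] Unit) (fun a b _ => by rw [h a, h b]) hP.zero

lemma IsSerre.mid' (hP : IsSerre P) (f : X →ₗ[k] Y) (g : Y →ₗ[k] W) (h : Z →ₗ[k] W) (e : ∀ y, g y = 0 → ∃ x, f x = y)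
    (hr : ∀ y, ∃ z, h z = g y) (hX : P X) (hZ : P Z) : P Y := by
  have h1 : P (LinearMap.range h) := hP.surj h.rangeRestrict h.surjective_rangeRestrict hZ
  have h2 : P (LinearMap.range g) := hP.inj (Submodule.inclusion (by rintro _ ⟨y, rfl⟩; exact hr y))
    (Submodule.inclusion_injective _) h1
  have h3 : P (LinearMap.range f) := hP.surj f.rangeRestrict f.surjective_rangeRestrict hX
  have h4 : P (LinearMap.ker g) := hP.inj (Submodule.inclusion (p' := LinearMap.range f) (fun y hy => e y hy))
    (Submodule.inclusion_injective _) h3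
  exact hP.mid (LinearMap.ker g).subtype g.rangeRestrict (by
    intro y
    simp [Subtype.ext_iff]) h4 h2

end Serre
end CC
end

noncomputable section
namespace CC

section desc
variable {k : Type} [CommRing k] {G Q X : Type} [Group G] [Group Q] [AddCommGroup X] [Module k X]

/-- descend a representation along a surjection -/
def descend (σ : Representation k G X) (π : G →* Q) (hπ : Function.Surjective π)
    (h : ∀ n, π n = 1 → σ n = 1) : Representation k Q X where
  toFun q := σ (Function.surjInv hπ q)
  map_one' := h _ (Function.surjInv_eq hπ _)
  map_mul' a b := by
    have e : ∀ x y, π x = π y → σ x = σ y := fun x y hxy => by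
      have := h (x * y⁻¹) (by rw [map_mul, hxy, ← map_mul, mul_inv_cancel, map_one])
      calc σ x = σ (x * y⁻¹ * y) := by rw [inv_mul_cancel_right]
        _ = σ y := by rw [map_mul, this, one_mul]
    rw [← map_mul]
    apply e
    rw [map_mul]
    simp only [Function.surjInv_eq hπ]

lemma descend_apply (σ : Representation k G X) (π : G →* Q) (hπ : Function.Surjective π)
    (h : ∀ n, π n = 1 → σ n = 1) (g : G) : descend σ π hπ h (π g) = σ g := by
  change σ (Function.surjInv hπ (π g)) = _
  have := h ((Function.surjInv hπ (π g)) * g⁻¹) (by rw [map_mul, Function.surjInv_eq hπ, ← map_mul, mul_inv_cancel, map_one])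
  calc σ _ = σ (Function.surjInv hπ (π g) * g⁻¹ * g) := by rw [inv_mul_cancel_right]
        _ = σ g := by rw [map_mul, this, one_mul]
end desc

section hrep
variable {k : Type} [CommRing k] {G Q : Type} [Group G] [Group Q] (π : G →* Q) (hπ : Function.Surjective π)
  {M : Type} [AddCommGroup M] [Module k M] 

abbrev res (N : Subgroup G) (ρ : Representation k G M) : Representation k N M := ρ.comp N.subtype

/-- conjugation by `g⁻¹` on kernel -/
def cjK (g : G) : π.ker →* π.ker := (MulAut.conjNormal g⁻¹ : MulAut π.ker).toMonoidHom

lemma cjK_coe (g : G) (n : π.ker) : (cjK π g n : G) = g⁻¹ * n * g := by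
  simp [cjK, MulAut.conjNormal_apply]

def cjP (ρ : Representation k G M) (g : G) : PHom (res π.ker ρ) (res π.ker ρ) :=
  ⟨cjK π g, ρ g, fun x m => by
    simp only [MonoidHom.comp_apply, Subgroup.subtype_apply, cjK_coe]
    rw [← Module.End.mul_apply, ← Module.End.mul_apply, ← map_mul, ← map_mul]
    congr 2; group⟩

def hrepG (ρ : Representation k G M) (j : ℕ) : Representation k G (H (res π.ker ρ) j) where
  toFun g := Hmap (cjP π ρ g) j
  map_one' := by
    ext x
    have : cjP π ρ 1 = PHom.id _ := PHom.ext' (fun g => Subtype.ext (by change (cjK π 1 g : G) = _; rw [cjK_coe]; simp [PHom.id])) (fun m => by simp [cjP, PHom.id])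
    rw [this, Hmap_id]; rfl
  map_mul' a b := by
    ext x
    have : cjP π ρ (a * b) = (cjP π ρ a).comp (cjP π ρ b) :=
      PHom.ext' (fun g => Subtype.ext (by
        change (cjK π (a*b) g : G) = (cjK π b (cjK π a g) : G)
        simp only [cjK_coe]; group)) (fun m => by simp [cjP, PHom.comp])
    rw [this, Hmap_comp]; rfl

lemma hrepG_ker (ρ : Representation k G M) (j : ℕ) (n : G) (hn : π n = 1) : hrepG π ρ j n = 1 := by
  ext x
  have : cjP π ρ n = inner (res π.ker ρ) ⟨n, hn⟩ := PHom.ext' (fun g => Subtype.ext (by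
    change (cjK π n g : G) = _; rw [cjK_coe]; simp [inner])) (fun m => rfl)
  change Hmap (cjP π ρ n) j x = x
  rw [this, Hmap_inner]

/-- the representation of the quotient on the cohomology of the kernel -/
def hrep (ρ : Representation k G M) (j : ℕ) : Representation k Q (H (res π.ker ρ) j) :=
  descend (hrepG π ρ j) π hπ (hrepG_ker π ρ j)

lemma hrep_apply (ρ : Representation k G M) (j : ℕ) (g : G) (x) :
    hrep π hπ ρ j (π g) x = Hmap (cjP π ρ g) j x := by
  rw [hrep, descend_apply]; rfl

/-- evaluation H^0 → M -/
def ev0 (ρ : Representation k G M) : H ρ 0 →ₗ[k] M :=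
  Submodule.liftQ _ ((LinearMap.proj default : ((Fin 0 → G) → M) →ₗ[k] M).comp (LinearMap.ker (cd ρ 0)).subtype) (by
    rintro ⟨c, hc⟩ h
    have : c = 0 := (Bd_zero (ρ := ρ)).1 h
    subst this; rfl)

lemma ev0_const (ρ : Representation k G M) (m hm) : ev0 ρ (Hconst ρ m hm) = m := rfl

lemma ev0_inj (ρ : Representation k G M) : Function.Injective (ev0 ρ) := by
  intro x y h
  obtain ⟨m, hm, rfl⟩ := Hconst_surj x
  obtain ⟨m', hm', rfl⟩ := Hconst_surj y
  rw [ev0_const, ev0_const] at h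
  subst h; rfl

lemma ev0_inv (ρ : Representation k G M) (g : G) (x) : ρ g (ev0 ρ x) = ev0 ρ x := by
  obtain ⟨m, hm, rfl⟩ := Hconst_surj x
  rw [ev0_const, hm]

lemma Hmap_ev0 {G₂ M₂ : Type} [Group G₂] [AddCommGroup M₂] [Module k M₂] {ρ : Representation k G M}
   {ρ₂ : Representation k G₂ M₂} (φ : PHom ρ ρ₂) (x) : ev0 ρ₂ (Hmap φ 0 x) = φ.lin (ev0 ρ x) := by
  obtain ⟨m, hm, rfl⟩ := Hconst_surj x
  rfl

/-- inflation -/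
def infP (ρ : Representation k G M) : PHom (hrep π hπ ρ 0) ρ :=
  ⟨π, ev0 _, fun g m => by rw [hrep_apply, Hmap_ev0]; rfl⟩

lemma inf0_bij (ρ : Representation k G M) : Function.Bijective (Hmap (infP π hπ ρ) 0) := by
  constructor
  · intro x y h
    apply ev0_inj
    apply ev0_inj
    have := congrArg (ev0 _) h
    rw [Hmap_ev0, Hmap_ev0] at this
    exact this
  · intro x
    obtain ⟨m, hm, rfl⟩ := Hconst_surj x
    refine ⟨Hconst _ (Hconst (res π.ker ρ) m (fun n => hm n)) ?_, ?_⟩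
    · intro q
      obtain ⟨g, rfl⟩ := hπ q
      rw [hrep_apply]
      apply ev0_inj
      rw [Hmap_ev0]
      exact hm g
    · rfl

def resP (N : Subgroup G) (ρ : Representation k G M) : PHom ρ (res N ρ) := ⟨N.subtype, LinearMap.id, fun _ _ => rfl⟩

variable {A B C : Type} [AddCommGroup A] [Module k A] [AddCommGroup B] [Module k B] [AddCommGroup C] [Module k C]
  {ρA : Representation k G A} {ρB : Representation k G B} {ρC : Representation k G C}
   {f : A →ₗ[k] B} {g : B →ₗ[k] C} 

lemma SES.res (s : SES ρA ρB ρC f g) (N : Subgroup G) : SES (res N ρA) (res N ρB) (res N ρC) f g :=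
  ⟨fun x m => s.hf x m, fun x m => s.hg x m, s.inj, s.surj, s.exact⟩

lemma hrep_δ (s : SES ρA ρB ρC f g) (j : ℕ) (q : Q) (x) :
    (s.res π.ker).δ j (hrep π hπ ρC j q x) = hrep π hπ ρA (j+1) q ((s.res π.ker).δ j x) := by
  obtain ⟨y, rfl⟩ := hπ q
  rw [hrep_apply, hrep_apply]
  exact (s.res π.ker).δ_nat (s.res π.ker) (cjP π ρA y) (cjP π ρB y) (cjP π ρC y) (fun _ => rfl) (fun _ => rfl)
    (fun a => (s.hf y a).symm) (fun a => (s.hg y a).symm) j x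

lemma hrep_map (u : PHom (CC.res π.ker ρA) (CC.res π.ker ρB)) (hu : u.grp = MonoidHom.id _)
     (h : ∀ x m, u.lin (ρA x m) = ρB x (u.lin m)) (j : ℕ) (q : Q) (x) :
    Hmap u j (hrep π hπ ρA j q x) = hrep π hπ ρB j q (Hmap u j x) := by
  obtain ⟨y, rfl⟩ := hπ q
  rw [hrep_apply, hrep_apply, ← Hmap_comp, ← Hmap_comp]
  congr 1
  congr 1
  refine PHom.ext' (fun n => ?_) (fun m => h y m)
  change (cjP π ρA y).grp (u.grp n) = u.grp ((cjP π ρB y).grp n)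
  rw [hu]; rfl

/-- the map from functions on the quotient -/
def indL (ρ : Representation k G M) : (Q → M) →ₗ[k] H (CC.res π.ker (I ρ)) 0 where
  toFun F := Hconst _ (fun x => F (π x)) (fun n => by
    funext x
    have : π n = 1 := n.2
    simp [this])
  map_add' _ _ := rfl
  map_smul' _ _ := rfl

def indP (ρ : Representation k G M) : PHom (coind k (MonoidHom.id Q) M) (hrep π hπ (I ρ) 0) :=
  ⟨MonoidHom.id Q, indL π ρ, fun q F => by
    obtain ⟨g, rfl⟩ := hπ q
    rw [hrep_apply]
    apply ev0_inj
    rw [Hmap_ev0]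
    funext x
    change F (π x * π g) = F (π (x * g))
    rw [map_mul]⟩

lemma indL_bij (hπ : Function.Surjective π) (ρ : Representation k G M) : Function.Bijective (indL (π := π) ρ) := by
  constructor
  · intro F F' h
    have : (fun x => F (π x)) = fun x => F' (π x) := congrArg (ev0 _) h
    funext q
    obtain ⟨g, rfl⟩ := hπ q
    exact congrFun this g
  · intro x
    obtain ⟨m, hm, rfl⟩ := Hconst_surj x
    refine ⟨fun q => m (Function.surjInv hπ q), ?_⟩
    apply ev0_inj
    change (fun x => m (Function.surjInv hπ (π x))) = m
    funext x
    have h : π (x⁻¹ * Function.surjInv hπ (π x)) = 1 := by rw [map_mul, Function.surjInv_eq hπ]; simp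
    have := congrFun (hm ⟨_, h⟩) x
    simpa using this

lemma hI_acyclic (ρ : Representation k G M) (n : ℕ) (x : H (hrep π hπ (I ρ) 0) (n+1)) : x = 0 := by
  obtain ⟨y, rfl⟩ := (Hmap_bij' (indP π hπ ρ) Function.bijective_id (indL_bij π hπ ρ) (n+1)).2 x
  rw [coind_acyclic _ Function.injective_id n y, map_zero]

lemma resI_acyclic (N : Subgroup G) (ρ : Representation k G M) (n : ℕ) (x : H (CC.res N (I ρ)) (n+1)) : x = 0 :=
  coind_acyclic N.subtype Subtype.val_injective n x

/-! the exact sequence `0 → H^0(N,M) → H^0(N,I) → H^0(N,M') → H^1(N,M) → 0` -/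
abbrev sN (ρ : Representation k G M) := (shSES ρ).res π.ker

abbrev bm (ρ : Representation k G M) := Hmap (sN π ρ).Gm 0

lemma bm_eq (ρ : Representation k G M) (q : Q) (x) : bm π ρ (hrep π hπ (I ρ) 0 q x) = hrep π hπ (sh ρ) 0 q (bm π ρ x) :=
  hrep_map π hπ (sN π ρ).Gm rfl (fun x m => (shSES ρ).hg x m) 0 q x

abbrev repB (ρ : Representation k G M) : Representation k Q (LinearMap.range (bm π ρ)) :=
  subRep (hrep π hπ (sh ρ) 0) (LinearMap.range (bm π ρ)) (range_stable (bm_eq π hπ ρ))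

lemma ses1 (ρ : Representation k G M) : SES (hrep π hπ ρ 0) (hrep π hπ (I ρ) 0) (repB π hπ ρ)
    (Hmap (sN π ρ).F 0) (bm π ρ).rangeRestrict where
  hf q x := hrep_map π hπ (sN π ρ).F rfl (fun x m => (shSES ρ).hf x m) 0 q x
  hg q x := Subtype.ext (bm_eq π hπ ρ q x)
  inj := (sN π ρ).inj0
  surj := LinearMap.surjective_rangeRestrict _
  exact x := by
    rw [← (sN π ρ).exact1 0 x, Subtype.ext_iff]; rfl

lemma ses2 (ρ : Representation k G M) : SES (repB π hπ ρ) (hrep π hπ (sh ρ) 0) (hrep π hπ ρ 1)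
    (LinearMap.range (bm π ρ)).subtype ((sN π ρ).δ 0) where
  hf q x := rfl
  hg q x := hrep_δ π hπ (shSES ρ) 0 q x
  inj := Subtype.val_injective
  surj := fun x => ((sN π ρ).exact3 0 x).1 (resI_acyclic _ _ _ _)
  exact x := by
    rw [(sN π ρ).exact2 0 x]; simp

lemma δN_bij (ρ : Representation k G M) (j : ℕ) : Function.Bijective ((sN π ρ).δ (j+1)) := by
  constructor
  · rw [injective_iff_map_eq_zero]
    intro x hx
    obtain ⟨y, rfl⟩ := ((sN π ρ).exact2 (j+1) x).1 hx
    rw [resI_acyclic _ _ _ y, map_zero]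
  · exact fun x => ((sN π ρ).exact3 _ x).1 (resI_acyclic _ _ _ _)

lemma hsh_bij (ρ : Representation k G M) (i j : ℕ) :
    ∃ e : H (hrep π hπ (sh ρ) (j+1)) i →ₗ[k] H (hrep π hπ ρ (j+2)) i, Function.Bijective e :=
  ⟨Hmap (PHom.ofLin ((sN π ρ).δ (j+1)) (fun q x => hrep_δ π hπ (shSES ρ) (j+1) q x)) i,
    Hmap_bij' _ Function.bijective_id (δN_bij π ρ j) i⟩

/-- the low degree shift map -/
def infB (ρ : Representation k G M) : PHom (repB π hπ ρ) (sh ρ) :=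
  (infP π hπ (sh ρ)).comp (ses2 π hπ ρ).F

lemma inf_δ (ρ : Representation k G M) (n : ℕ) (x) :
    (shSES ρ).δ n (Hmap (infB π hπ ρ) n x) = Hmap (infP π hπ ρ) (n+1) ((ses1 π hπ ρ).δ n x) :=
  (ses1 π hπ ρ).δ_nat (shSES ρ) (infP π hπ ρ) (infP π hπ (I ρ)) (infB π hπ ρ) (fun _ => rfl) (fun _ => rfl)
    (fun a => (Hmap_ev0 (sN π ρ).F a)) (fun b => (Hmap_ev0 (sN π ρ).Gm b)) n x

lemma deltaOne_inj (ρ : Representation k G M) (n : ℕ) : Function.Injective ((ses1 π hπ ρ).δ (n+1)) := by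
  rw [injective_iff_map_eq_zero]
  intro x hx
  obtain ⟨y, rfl⟩ := ((ses1 π hπ ρ).exact2 (n+1) x).1 hx
  rw [hI_acyclic π hπ _ _ y, map_zero]

lemma deltaOne_surj (ρ : Representation k G M) (n : ℕ) : Function.Surjective ((ses1 π hπ ρ).δ n) :=
  fun x => ((ses1 π hπ ρ).exact3 n x).1 (hI_acyclic π hπ _ _ _)

end hrep

section LHS
variable {k : Type} [CommRing k] {G Q : Type} [Group G] [Group Q] (π : G →* Q) (hπ : Function.Surjective π)
  {P : ∀ (X : Type) [AddCommGroup X] [Module k X], Prop}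

lemma lhs1 {M : Type} [AddCommGroup M] [Module k M] (ρ : Representation k G M) 
   (x : H ρ 1) (hx : Hmap (resP π.ker ρ) 1 x = 0) : ∃ y, Hmap (infP π hπ ρ) 1 y = x := by
  obtain ⟨m, rfl⟩ := sh_surj ρ 0 x
  have e := (shSES ρ).δ_nat (sN π ρ) (resP π.ker ρ) (resP π.ker (I ρ)) (resP π.ker (sh ρ)) (fun _ => rfl)
    (fun _ => rfl) (fun _ => rfl) (fun _ => rfl) 0 m
  rw [hx] at e
  obtain ⟨b, hb⟩ := ((sN π ρ).exact2 0 _).1 e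
  obtain ⟨m', rfl⟩ := (inf0_bij π hπ (sh ρ)).2 m
  obtain ⟨b', hb'⟩ : ∃ b', Hmap (ses2 π hπ ρ).F 0 b' = m' := by
    obtain ⟨z, hz, rfl⟩ := Hconst_surj m'
    have hzb : z ∈ LinearMap.range (bm π ρ) := ⟨b, by
      rw [hb]; apply ev0_inj; rw [Hmap_ev0, Hmap_ev0]; rfl⟩
    exact ⟨Hconst _ (⟨z, hzb⟩ : LinearMap.range (bm π ρ)) (fun g => Subtype.ext (hz g)), rfl⟩
  refine ⟨(ses1 π hπ ρ).δ 0 b', ?_⟩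
  rw [← inf_δ, ← hb', ← Hmap_comp]; rfl

lemma res_inv {M : Type} [AddCommGroup M] [Module k M] (ρ : Representation k G M) (j : ℕ)
   (x : H ρ j) : ∃ z : H (hrep π hπ ρ j) 0, ev0 _ z = Hmap (resP π.ker ρ) j x := by
  refine ⟨Hconst _ (Hmap (resP π.ker ρ) j x) (fun q => ?_), rfl⟩
  obtain ⟨g, rfl⟩ := hπ q
  rw [hrep_apply, ← Hmap_comp]
  have : (cjP π ρ g).comp (resP π.ker ρ) = (resP π.ker ρ).comp (inner ρ g) :=
    PHom.ext' (fun n => by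
      change (cjK π g n : G) = _
      rw [cjK_coe]; simp [inner, PHom.comp, resP]) (fun _ => rfl)
  rw [this, Hmap_comp, Hmap_inner]

theorem lhs (hP : IsSerre P) (n : ℕ) : ∀ {M : Type} [AddCommGroup M] [Module k M] (ρ : Representation k G M),
    (∀ i j, i + j = n → P (H (hrep π hπ ρ j) i)) → P (H ρ n) := by
  induction n with
  | zero => exact fun ρ h => hP.surj _ (inf0_bij π hπ ρ).2 (h 0 0 rfl)
  | succ n ih =>
    intro M _ _ ρ h
    cases n with
    | zero =>
      exact hP.mid' (Hmap (infP π hπ ρ) 1) (Hmap (resP π.ker ρ) 1) (ev0 (hrep π hπ ρ 1)) (lhs1 π hπ ρ)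
        (res_inv π hπ ρ 1) (h 1 0 rfl) (h 0 1 rfl)
    | succ n =>
      refine hP.surj _ (sh_surj ρ (n+1)) (ih (sh ρ) fun i j hij => ?_)
      cases j with
      | zero =>
        obtain rfl : i = n + 1 := hij
        exact hP.mid _ _ ((ses2 π hπ ρ).exact1 (n+1)) (hP.inj _ (deltaOne_inj π hπ ρ n) (h (n+2) 0 rfl))
          (h (n+1) 1 rfl)
      | succ j =>
        obtain ⟨e, he⟩ := hsh_bij π hπ ρ i j
        exact hP.inj e he.1 (h i (j+2) (by omega))

theorem edge (hP : IsSerre P) (n : ℕ) : ∀ {M : Type} [AddCommGroup M] [Module k M] (ρ : Representation k G M),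
    (∀ i j, i + (j+1) + 1 = n → P (H (hrep π hπ ρ (j+1)) i)) → P (LinearMap.ker (Hmap (infP π hπ ρ) n)) := by
  induction n with
  | zero => exact fun ρ h => hP.subs (fun x => Subtype.ext ((inf0_bij π hπ ρ).1 (by rw [x.2]; simp)))
  | succ n ih =>
    intro M _ _ ρ h
    cases n with
    | zero =>
      refine hP.subs (fun x => ?_)
      obtain ⟨x, hx⟩ := x
      apply Subtype.ext
      change x = 0
      obtain ⟨b, rfl⟩ := deltaOne_surj π hπ ρ 0 x
      rw [LinearMap.mem_ker, ← inf_δ] at hx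
      obtain ⟨y, hy⟩ := ((shSES ρ).exact2 0 _).1 hx
      obtain ⟨y', rfl⟩ := (inf0_bij π hπ (I ρ)).2 y
      refine ((ses1 π hπ ρ).exact2 0 _).2 ⟨y', ?_⟩
      apply ev0_inj
      apply Subtype.ext
      apply ev0_inj
      have := congrArg (ev0 _) hy
      rw [Hmap_ev0, Hmap_ev0, Hmap_ev0] at this
      rw [Hmap_ev0]
      refine Eq.trans ?_ this
      exact Hmap_ev0 (sN π ρ).Gm _
    | succ n =>
      have h1 := ih (sh ρ) (fun i j hij => by
        obtain ⟨e, he⟩ := hsh_bij π hπ ρ i j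
        exact hP.inj e he.1 (h i (j+1) (by omega)))
      have h2 : P (LinearMap.ker (Hmap (infB π hπ ρ) (n+1))) := by
        let g : LinearMap.ker (Hmap (infB π hπ ρ) (n+1)) →ₗ[k] LinearMap.ker (Hmap (infP π hπ (sh ρ)) (n+1)) :=
          (Hmap (ses2 π hπ ρ).F (n+1)).restrict (fun x hx => by
            rw [LinearMap.mem_ker] at *
            rw [← Hmap_comp]; exact hx)
        have hδ : ∀ y, (ses2 π hπ ρ).δ n y ∈ LinearMap.ker (Hmap (infB π hπ ρ) (n+1)) := by
          intro y
          rw [LinearMap.mem_ker, infB, Hmap_comp, ((ses2 π hπ ρ).exact3 n).apply_apply_eq_zero, map_zero]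
        refine hP.mid ((ses2 π hπ ρ).δ n |>.codRestrict _ hδ) g ?_ (h n 0 (by omega)) h1
        intro x
        have := (ses2 π hπ ρ).exact3 n x.1
        rw [Subtype.ext_iff]
        change (Hmap (ses2 π hπ ρ).F (n+1)) x.1 = 0 ↔ _
        rw [this]
        simp [Set.mem_range, Subtype.ext_iff]
      let g : LinearMap.ker (Hmap (infB π hπ ρ) (n+1)) →ₗ[k] LinearMap.ker (Hmap (infP π hπ ρ) (n+1+1)) :=
        ((ses1 π hπ ρ).δ (n+1)).restrict (fun x hx => by
          rw [LinearMap.mem_ker] at *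
          rw [← inf_δ, hx, map_zero])
      refine hP.surj g ?_ h2
      rintro ⟨x, hx⟩
      obtain ⟨b, rfl⟩ := deltaOne_surj π hπ ρ (n+1) x
      refine ⟨⟨b, ?_⟩, rfl⟩
      rw [LinearMap.mem_ker, ← inf_δ] at hx
      rw [LinearMap.mem_ker]
      exact sh_inj ρ n (by rw [hx, map_zero])

end LHS
end CC
end

noncomputable section
namespace CC

section mapS
variable {k : Type} [CommRing k] {G Z : Type} [Group G] [Group Z] {M : Type} [AddCommGroup M] [Module k M]

def mapS (χ : G →* Z) (ρ : Representation k G M) : Representation k G (Z → M) where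
  toFun g := { toFun := fun F t => ρ g (F (t * χ g)), map_add' := fun _ _ => by funext; simp, map_smul' := fun _ _ => by funext; simp }
  map_one' := by ext F x; simp
  map_mul' a b := by ext F x; simp [mul_assoc]

lemma mapS_apply (χ : G →* Z) (ρ : Representation k G M) (g : G) (F : Z → M) (t : Z) :
    mapS χ ρ g F t = ρ g (F (t * χ g)) := rfl

def constL (k Z M : Type) [CommRing k] [AddCommGroup M] [Module k M] : M →ₗ[k] (Z → M) :=
  { toFun := fun m _ => m, map_add' := fun _ _ => rfl, map_smul' := fun _ _ => rfl }

lemma constL_apply (m : M) (t : Z) : constL k Z M m t = m := rfl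

lemma constL_eq (χ : G →* Z) (ρ : Representation k G M) (g : G) (m : M) :
    constL k Z M (ρ g m) = mapS χ ρ g (constL k Z M m) := rfl

lemma constL_inj : Function.Injective (constL k Z M) := fun a b h => congrFun h 1

variable (e : G →* G) (χ : G →* Z) 

structure Ret (e : G →* G) (χ : G →* Z) : Prop where
  inj : ∀ g, χ g = 1 → e g = 1 → g = 1
  idem : ∀ g, e (e g) = e g
  chi : ∀ g, χ (e g) = 1
  sec : ∀ z, ∃ g, χ g = z ∧ e g = 1

variable {e χ}

def evS (r : Ret e χ) (ρ : Representation k G M) (h : ∀ g, ρ (e g) = ρ g) : PHom (mapS χ ρ) (mapS χ ρ) :=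
  ⟨e, (constL k Z M).comp (LinearMap.proj 1), fun g F => by
    funext t
    simp [constL_apply, mapS_apply, r.chi, h]⟩

/-- uncurry equivalence -/
def uncP (r : Ret e χ) : PHom (coind k (χ.prod e) M) (mapS χ (coind k e M)) :=
  ⟨MonoidHom.id G, { toFun := fun F z x => F (z, x), map_add' := fun _ _ => rfl, map_smul' := fun _ _ => rfl }, 
    fun g F => rfl⟩

lemma mapS_acyclic (r : Ret e χ) (n : ℕ) (x : H (mapS χ (coind k e M)) (n+1)) : x = 0 := by
  obtain ⟨y, rfl⟩ := (Hmap_bij' (uncP (k := k) (M := M) r) Function.bijective_id 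
    ⟨fun F F' h => by funext ⟨z, x⟩; exact congrFun (congrFun h z) x, fun F => ⟨fun p => F p.1 p.2, rfl⟩⟩ (n+1)).2 x
  rw [coind_acyclic _ (by
    rw [injective_iff_map_eq_one]
    intro g hg
    simp only [MonoidHom.prod_apply, Prod.mk_eq_one] at hg
    exact r.inj g hg.1 hg.2) n y, map_zero]

lemma shiftι_eq' (ρ : Representation k G M) (h : ∀ g, ρ (e g) = ρ g) (x : G) (m : M) :
    shiftι ρ (ρ x m) = coind k e M x (shiftι ρ m) := by
  funext y; simp [shiftι, h]

lemma SES.mapS {A B C : Type}  [AddCommGroup A] [Module k A] [AddCommGroup B] [Module k B] [AddCommGroup C] [Module k C]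
  {ρA : Representation k G A} {ρB : Representation k G B} {ρC : Representation k G C}
   {f : A →ₗ[k] B} {g : B →ₗ[k] C} (s : SES ρA ρB ρC f g) (χ : G →* Z) :
   SES (mapS χ ρA) (mapS χ ρB) (mapS χ ρC) (f.compLeft Z) (g.compLeft Z) where
  hf x m := by funext t; simp [mapS_apply, s.hf]
  hg x m := by funext t; simp [mapS_apply, s.hg]
  inj a b h := by funext t; exact s.inj (congrFun h t)
  surj c := ⟨fun t => Function.surjInv s.surj (c t), by funext t; exact Function.surjInv_eq s.surj _⟩
  exact b := by
    constructor
    · intro h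
      have : ∀ t, ∃ a, f a = b t := fun t => (s.exact (b t)).1 (congrFun h t)
      choose a ha using this
      exact ⟨a, funext ha⟩
    · rintro ⟨a, rfl⟩
      funext t
      exact s.exact.apply_apply_eq_zero (a t)

end mapS

lemma Hmap_evS {k : Type} [CommRing k] {G Z : Type} [Group G] [Group Z] {e : G →* G} {χ : G →* Z} (r : Ret e χ)
   (n : ℕ) : ∀ {M : Type} [AddCommGroup M] [Module k M] (ρ : Representation k G M) (h : ∀ g, ρ (e g) = ρ g)
    (x : H (mapS χ ρ) n), Hmap (evS r ρ h) n x = x := by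
  induction n with
  | zero =>
    intro M _ _ ρ h x
    obtain ⟨F, hF, rfl⟩ := Hconst_surj x
    apply ev0_inj
    rw [Hmap_ev0, ev0_const]
    funext t
    change F 1 = F t
    obtain ⟨g, hg1, hg2⟩ := r.sec t⁻¹
    have := congrFun (hF g) t
    rw [mapS_apply, ← h, hg2, hg1, mul_inv_cancel, map_one] at this
    exact this
  | succ n ih =>
    intro M _ _ ρ h x
    have s0 := ses_quot (shiftι_eq' ρ h) (shiftι_inj ρ)
    have h' : ∀ g, coind k e M (e g) = coind k e M g := fun g => by
      ext F y; simp [r.idem]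
    have h'' : ∀ g, quotRep (coind k e M) (LinearMap.range (shiftι ρ)) (range_stable (shiftι_eq' ρ h)) (e g) = 
       quotRep (coind k e M) (LinearMap.range (shiftι ρ)) (range_stable (shiftι_eq' ρ h)) g := fun g => by
      ext1
      ext1 F
      simp only [LinearMap.comp_apply]
      rw [quotRep_mk, quotRep_mk, h']
    have s := s0.mapS χ
    obtain ⟨y, rfl⟩ := (s.exact3 n x).1 (mapS_acyclic r n _)
    rw [← s.δ_nat s (evS r ρ h) (evS r _ h') (evS r _ h'') (fun _ => rfl) (fun _ => rfl)
      (fun a => rfl) (fun b => rfl), ih]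

section deg
variable {k : Type} [CommRing k] {Z : Type} [CommGroup Z] {r : ℕ}

def eC (s : Fin r) : (Fin r → Z) →* (Fin r → Z) where
  toFun g := Function.update g s 1
  map_one' := by funext i; by_cases h : i = s <;> simp [Function.update, h]
  map_mul' a b := by funext i; by_cases h : i = s <;> simp [Function.update, h]

def chiC (s : Fin r) : (Fin r → Z) →* Z := Pi.evalMonoidHom _ s

lemma eC_apply (s : Fin r) (g : Fin r → Z) (i) : eC s g i = if i = s then 1 else g i := by
  simp [eC, Function.update_apply]

lemma retC (s : Fin r) : Ret (eC s) (chiC (Z := Z) s) where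
  inj g h1 h2 := by
    funext i
    have := congrFun h2 i
    rw [eC_apply] at this
    by_cases h : i = s
    · subst h; exact h1
    · simpa [h] using this
  idem g := by funext i; by_cases h : i = s <;> simp [eC_apply, h]
  chi g := by simp [chiC, eC_apply]
  sec z := ⟨Function.update 1 s z, by simp [chiC], by
    funext i
    by_cases h : i = s <;> simp [eC_apply, h]⟩

variable {M : Type} [AddCommGroup M] [Module k M]
open Classical in
def eStar (ρ : Representation k (Fin r → Z) M) (j : ℕ) (s : Fin r) : Module.End k (H ρ j) :=
  if h : ∀ g, ρ (eC s g) = ρ g then Hmap ⟨eC s, LinearMap.id, fun g m => by rw [h]; rfl⟩ j else 1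

def eStarP (ρ : Representation k (Fin r → Z) M) (s : Fin r) (h : ∀ g, ρ (eC s g) = ρ g) : PHom ρ ρ :=
  ⟨eC s, LinearMap.id, fun g m => by rw [h]; rfl⟩

lemma eStar_apply (ρ : Representation k (Fin r → Z) M) (j : ℕ) (s : Fin r) (h : ∀ g, ρ (eC s g) = ρ g) :
    eStar ρ j s = Hmap (eStarP ρ s h) j := dif_pos h

end deg

theorem deg {k : Type} [CommRing k] {Z : Type} [CommGroup Z] {r : ℕ} (j : ℕ) : ∀ {M : Type} [AddCommGroup M] [Module k M]
   (ρ : Representation k (Fin r → Z) M) (l : List (Fin r)) (hl : l.Nodup) (hlen : l.length = j + 1)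
   (h : ∀ s ∈ l, ∀ g, ρ (eC s g) = ρ g) (x : H ρ j), (l.map (fun s => 1 - eStar ρ j s)).prod x = 0 := by
  induction j with
  | zero =>
    intro M _ _ ρ l hl hlen h x
    obtain ⟨s, rfl⟩ := List.length_eq_one_iff.1 hlen
    simp only [List.map_cons, List.map_nil, List.prod_cons, List.prod_nil, mul_one]
    rw [eStar_apply ρ 0 s (h s (by simp)), LinearMap.sub_apply, sub_eq_zero]
    apply ev0_inj
    rw [Hmap_ev0]; rfl
  | succ j ih =>
    intro M _ _ ρ l hl hlen h x
    rcases List.eq_nil_or_concat l with rfl | ⟨l', s, rfl⟩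
    · simp at hlen
    rw [List.concat_eq_append] at *
    rw [List.map_append, List.prod_append, Module.End.mul_apply]
    simp only [List.map_cons, List.map_nil, List.prod_cons, List.prod_nil, mul_one]
    have hs := h s (by simp)
    rw [eStar_apply ρ (j+1) s hs]
    have S := ses_quot (constL_eq (chiC s) ρ) constL_inj
    have h0 : Hmap S.F (j+1) ((1 - Hmap (eStarP ρ s hs) (j+1) : Module.End k (H ρ (j+1))) x) = 0 := by
      rw [LinearMap.sub_apply, map_sub, Module.End.one_apply, ← Hmap_comp, sub_eq_zero]
      conv_lhs => rw [← Hmap_evS (retC s) (j+1) ρ hs (Hmap S.F (j+1) x), ← Hmap_comp]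
      congr 1
    obtain ⟨y, hy⟩ := (S.exact3 j _).1 h0
    rw [← hy]
    have hnd : l'.Nodup ∧ s ∉ l' := by
      have := hl
      rw [List.nodup_append] at this
      refine ⟨this.1, fun hh => this.2.2 s hh s (by simp) rfl⟩
    have h' : ∀ t ∈ l', ∀ g, ρ (eC t g) = ρ g := fun t ht => h t (by simp [ht])
    have hm : ∀ t ∈ l', ∀ g, mapS (chiC s) ρ (eC t g) = mapS (chiC s) ρ g := by
      intro t ht g
      have : chiC s (eC t g) = chiC s g := by
        have : s ≠ t := fun e => hnd.2 (e ▸ ht)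
        simp [chiC, eC_apply, this]
      ext1 F
      funext z
      rw [mapS_apply, mapS_apply, this, h' t ht]
    have hq : ∀ t ∈ l', ∀ g, quotRep (mapS (chiC s) ρ) _ (range_stable (constL_eq (chiC s) ρ)) (eC t g) = 
         quotRep (mapS (chiC s) ρ) _ (range_stable (constL_eq (chiC s) ρ)) g := by
      intro t ht g
      ext1
      ext1 F
      simp only [LinearMap.comp_apply]
      rw [quotRep_mk, quotRep_mk, hm t ht]
    have key : ∀ (l'' : List (Fin r)), (∀ t ∈ l'', t ∈ l') → ∀ y,
       (l''.map (fun s => 1 - eStar ρ (j+1) s)).prod (S.δ j y) = S.δ j ((l''.map (fun t => 1 - eStar _ j t)).prod y) := by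
      intro l''
      induction l'' with
      | nil => intro _ y; rfl
      | cons t l'' ih2 =>
        intro hh y
        have ht := hh t (by simp)
        simp only [List.map_cons, List.prod_cons, Module.End.mul_apply]
        rw [ih2 (fun u hu => hh u (by simp [hu])), eStar_apply _ _ _ (h' t ht), eStar_apply _ _ _ (hq t ht)]
        simp only [LinearMap.sub_apply, map_sub, Module.End.one_apply]
        congr 1
        exact (S.δ_nat S (eStarP ρ t (h' t ht)) (eStarP _ t (hm t ht)) (eStarP _ t (hq t ht)) (fun _ => rfl) (fun _ => rfl)
          (fun _ => rfl) (fun _ => rfl) j _).symm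
    rw [key l' (fun _ h => h), ih _ l' hnd.1 (by simpa using hlen) hq, map_zero]

end CC
end

noncomputable section
namespace CC

section FF
variable {k : Type} [CommRing k] {Z : Type} [CommGroup Z] {M : Type} [AddCommGroup M] [Module k M]

def toMH (e : AddMonoid.End (Additive Z)) : Z →* Z := MonoidHom.toAdditive.symm e

lemma toMH_apply (e : AddMonoid.End (Additive Z)) (z : Z) : toMH e z = (e (Additive.ofMul z)).toMul := rfl

def pullP (ρ : Representation k Z M) (hρ : ∀ g, ρ g = 1) (e : AddMonoid.End (Additive Z)) : PHom ρ ρ :=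
  ⟨toMH e, LinearMap.id, fun g m => by rw [hρ, hρ]; rfl⟩

def FF (ρ : Representation k Z M) (hρ : ∀ g, ρ g = 1) (j : ℕ) (e : AddMonoid.End (Additive Z)) : Module.End k (H ρ j) :=
  Hmap (pullP ρ hρ e) j

lemma FF_one (ρ : Representation k Z M) (hρ : ∀ g, ρ g = 1) (j : ℕ) : FF ρ hρ j 1 = 1 := by
  ext x
  exact Hmap_id j x

lemma FF_mul (ρ : Representation k Z M) (hρ : ∀ g, ρ g = 1) (j : ℕ) (a b) : FF ρ hρ j (a * b) = FF ρ hρ j b * FF ρ hρ j a := by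
  ext x
  change Hmap (pullP ρ hρ (a * b)) j x = Hmap (pullP ρ hρ b) j (Hmap (pullP ρ hρ a) j x)
  rw [← Hmap_comp]
  congr 1

def iotaP {r : ℕ} (ρ : Representation k Z M) (hρ : ∀ g, ρ g = 1) (w : Fin r → AddMonoid.End (Additive Z)) :
    PHom (1 : Representation k (Fin r → Z) M) ρ :=
  ⟨Pi.monoidHom (fun s => toMH (w s)), LinearMap.id, fun g m => by rw [hρ]; rfl⟩

def prodP (r : ℕ) (ρ : Representation k Z M) (hρ : ∀ g, ρ g = 1) : 
    PHom ρ (1 : Representation k (Fin r → Z) M) :=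
  ⟨⟨⟨fun g => ∏ i, g i, by simp⟩, fun a b => by simp [Finset.prod_mul_distrib]⟩, LinearMap.id, fun g m => by rw [hρ]; rfl⟩

lemma FF_list {r : ℕ} (ρ : Representation k Z M) (hρ : ∀ g, ρ g = 1) (j : ℕ) (ψ : AddMonoid.End (Additive Z)) (x : H ρ j)
   (l : List (Fin r)) : l.Nodup → ∀ w : Fin r → AddMonoid.End (Additive Z), (∀ s ∈ l, w s = ψ) →
   Hmap (iotaP ρ hρ w) j ((l.map (fun s => 1 - eStar (1 : Representation k (Fin r → Z) M) j s)).prod (Hmap (prodP r ρ hρ) j x))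
    = (fwdDiff ψ)^[l.length] (fun e => FF ρ hρ j e x) (∑ s, w s - l.length • ψ) := by
  induction l with
  | nil =>
    intro _ w _
    simp only [List.map_nil, List.prod_nil, Module.End.one_apply, List.length_nil, Function.iterate_zero, id, zero_smul, sub_zero]
    rw [← Hmap_comp]
    unfold FF
    congr 2
    apply PHom.ext'
    · intro z
      rw [zero_nsmul, sub_zero]
      change ∏ i, toMH (w i) z = toMH (∑ s, w s) z
      simp only [toMH_apply]
      have : ∀ y : Additive Z, (∑ s, w s) y = ∑ s, w s y := fun y => AddMonoidHom.finsetSum_apply _ _ _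
      rw [this, toMul_sum]
    · intro m; rfl
  | cons s l ih =>
    intro hn w hw
    rw [List.nodup_cons] at hn
    simp only [List.map_cons, List.prod_cons, Module.End.mul_apply, List.length_cons]
    have h1 : ∀ g, (1 : Representation k (Fin r → Z) M) (eC s g) = (1 : Representation k (Fin r → Z) M) g := fun _ => rfl
    rw [eStar_apply _ _ _ h1, LinearMap.sub_apply, map_sub, Module.End.one_apply, ih hn.2 w (fun t ht => hw t (by simp [ht])), ← Hmap_comp]
    have e2 : (iotaP ρ hρ w).comp (eStarP 1 s h1) = iotaP ρ hρ (Function.update w s 0) := by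
      apply PHom.ext'
      · intro z
        funext i
        change eC s (fun t => toMH (w t) z) i = toMH (Function.update w s 0 i) z
        rw [eC_apply]
        by_cases h : i = s
        · subst h; simp [toMH_apply]
        · simp [h]
      · intro m; rfl
    rw [e2, ih hn.2 _ (fun t ht => by
      have hts : t ≠ s := fun e => hn.1 (e ▸ ht)
      rw [Function.update_of_ne hts]; exact hw t (by simp [ht]))]
    rw [Function.iterate_succ_apply', fwdDiff]
    have e3 : ∑ t, Function.update w s 0 t = ∑ t, w t - ψ := by
      rw [← hw s (by simp), Finset.sum_update_of_mem (Finset.mem_univ s), zero_add, 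
        Finset.sum_eq_sum_sdiff_singleton_add (Finset.mem_univ s) w]
      simp
    rw [e3]
    congr 2
    · rw [succ_nsmul]
      generalize l.length • ψ = u
      abel_nf
    · rw [succ_nsmul]
      generalize l.length • ψ = u
      abel_nf

theorem FF_fwdDiff (ρ : Representation k Z M) (hρ : ∀ g, ρ g = 1) (j : ℕ) (ψ b : AddMonoid.End (Additive Z)) :
   (fwdDiff ψ)^[j+1] (FF ρ hρ j) b = 0 := by
  ext x
  have h := FF_list (r := j + 2) ρ hρ j ψ x ((List.finRange (j+1)).map Fin.succ) 
    ((List.nodup_finRange _).map (Fin.succ_injective _)) (Fin.cons b (fun _ => ψ)) (by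
      intro s hs
      simp only [List.mem_map] at hs
      obtain ⟨t, _, rfl⟩ := hs
      simp)
  rw [deg j _ _ ((List.nodup_finRange _).map (Fin.succ_injective _)) (by simp) (fun _ _ _ => rfl), map_zero] at h
  simp only [List.length_map, List.length_finRange, Fin.sum_univ_succ, Fin.cons_zero, Fin.cons_succ, Finset.sum_const, Finset.card_univ,
    Fintype.card_fin] at h
  rw [LinearMap.zero_apply, h]
  have : ∀ (n : ℕ) (b), ((fwdDiff ψ)^[n] (FF ρ hρ j) b) x = (fwdDiff ψ)^[n] (fun e => FF ρ hρ j e x) b := by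
    intro n
    induction n with
    | zero => intro b; rfl
    | succ n ih =>
      intro b
      rw [Function.iterate_succ_apply', Function.iterate_succ_apply', fwdDiff, fwdDiff, LinearMap.sub_apply, ih, ih]
  rw [this]
  rw [add_sub_cancel_right]

end FF
end CC
end

noncomputable section
namespace CC

open scoped IsMulCommutative in
lemma alg_mul_comm {A : Type} [Ring A] {a b : A} (h : a * b = b * a) (ha : IsAlgebraic ℤ a) (hb : IsAlgebraic ℤ b) :
    IsAlgebraic ℤ (a * b) := by
  have hc : ∀ x ∈ ({a, b} : Set A), ∀ y ∈ ({a, b} : Set A), x * y = y * x := by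
    rintro x (rfl | rfl) y (rfl | rfl) <;> first | rfl | exact h | exact h.symm
  have := Algebra.isMulCommutative_adjoin ℤ hc
  let S := Algebra.adjoin ℤ ({a, b} : Set A)
  let a' : S := ⟨a, Algebra.subset_adjoin (by simp)⟩
  let b' : S := ⟨b, Algebra.subset_adjoin (by simp)⟩
  have e : Function.Injective S.val := Subtype.val_injective
  have h1 : IsAlgebraic ℤ a' := (isAlgebraic_algHom_iff S.val e).1 ha
  have h2 : IsAlgebraic ℤ b' := (isAlgebraic_algHom_iff S.val e).1 hb
  exact (isAlgebraic_algHom_iff S.val e).2 (h1.mul h2)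

open scoped IsMulCommutative in
lemma alg_poly {A : Type} [Ring A] {a : A} (ha : IsAlgebraic ℤ a) (f : Polynomial ℤ) :
    IsAlgebraic ℤ (Polynomial.aeval a f) := by
  let S := Algebra.adjoin ℤ ({a} : Set A)
  let a' : S := ⟨a, Algebra.subset_adjoin (by simp)⟩
  have e : Function.Injective S.val := Subtype.val_injective
  have h1 : IsAlgebraic ℤ a' := (isAlgebraic_algHom_iff S.val e).1 ha
  have : Polynomial.aeval a f = S.val (Polynomial.aeval a' f) := by
    rw [← Polynomial.aeval_algHom_apply]; rfl
  rw [this, isAlgebraic_algHom_iff S.val e]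
  have := (isAlgebraic_algebraMap (R := ℤ) (A := S) 1)
  induction f using Polynomial.induction_on' with
  | add p q hp hq => 
    have e1 : Polynomial.aeval a' (p + q) = Polynomial.aeval a' p + Polynomial.aeval a' q := map_add _ _ _
    rw [e1]
    refine IsAlgebraic.add (hp ?_) (hq ?_)
    · rw [← Polynomial.aeval_algHom_apply]; rfl
    · rw [← Polynomial.aeval_algHom_apply]; rfl
  | monomial n c =>
    rw [Polynomial.aeval_monomial]
    exact (isAlgebraic_algebraMap c).mul (h1.pow n)

section poly
variable {E V : Type} [Ring E] [Ring V] (F : E → V) (d : ℕ)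

lemma shift_span (h : ∀ ψ b, (fwdDiff ψ)^[d] F b = 0) (ψ b : E) (n : ℕ) :
    F (b + n • ψ) ∈ Submodule.span ℤ ((fun i : ℕ => F (b + i • ψ)) '' (Set.Iio d)) := by
  rw [shift_eq_sum_fwdDiff_iter ψ F n b]
  refine Submodule.sum_mem _ fun k hk => ?_
  refine Submodule.smul_of_tower_mem _ _ ?_
  by_cases hkd : k < d
  · rw [fwdDiff_iter_eq_sum_shift]
    refine Submodule.sum_mem _ fun i hi => Submodule.smul_mem _ _ (Submodule.subset_span ⟨i, ?_, rfl⟩)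
    simp at hi ⊢; omega
  · have : (fwdDiff ψ)^[k] F b = 0 := by
      obtain ⟨e, rfl⟩ : ∃ e, k = e + d := ⟨k - d, by omega⟩
      rw [Function.iterate_add_apply]
      have h0 : (fwdDiff ψ)^[d] F = 0 := funext fun b => h ψ b
      rw [h0]
      have : ∀ e : ℕ, (fwdDiff ψ)^[e] (0 : E → V) = 0 := by
        intro e
        induction e with
        | zero => rfl
        | succ e ih => rw [Function.iterate_succ_apply', ih]; funext x; simp [fwdDiff]
      rw [this]; rfl
    rw [this]; exact zero_mem _

lemma shift_span_int (h : ∀ ψ b, (fwdDiff ψ)^[d] F b = 0) (ψ : E) : ∃ T : Finset E, ∀ b, ∀ n : ℤ, 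
    F (b + n • ψ) ∈ Submodule.span ℤ ((fun t => F (b + t)) '' (T : Set E)) := by
  classical
  refine ⟨(Finset.range d).image (fun i => i • ψ) ∪ (Finset.range d).image (fun i => i • (-ψ)), fun b n => ?_⟩
  rcases Int.eq_nat_or_neg n with ⟨m, rfl | rfl⟩
  · have := shift_span F d h ψ b m
    rw [natCast_zsmul]
    refine Submodule.span_mono ?_ this
    rintro _ ⟨i, hi, rfl⟩
    exact ⟨i • ψ, by simp at hi ⊢; exact Or.inl ⟨i, hi, rfl⟩, rfl⟩
  · have := shift_span F d h (-ψ) b m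
    have e : (-(m : ℤ)) • ψ = m • (-ψ) := by simp
    rw [e]
    refine Submodule.span_mono ?_ this
    rintro _ ⟨i, hi, rfl⟩
    exact ⟨i • (-ψ), by simp only [Finset.coe_union, Finset.coe_image]; exact Or.inr ⟨i, by simpa using hi, rfl⟩, rfl⟩

lemma lemA (h : ∀ ψ b, (fwdDiff ψ)^[d] F b = 0) (s : Finset E) : ∃ T : Finset E, ∀ b, ∀ x ∈ Submodule.span ℤ (s : Set E), 
    F (b + x) ∈ Submodule.span ℤ ((fun t => F (b + t)) '' (T : Set E)) := by
  classical
  induction s using Finset.induction_on with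
  | empty =>
    refine ⟨{0}, fun b x hx => ?_⟩
    simp at hx
    subst hx
    exact Submodule.subset_span ⟨0, by simp, rfl⟩
  | insert ψ s hs ih =>
    obtain ⟨T, hT⟩ := ih
    obtain ⟨T', hT'⟩ := shift_span_int F d h ψ
    refine ⟨(T ×ˢ T').image (fun p => p.1 + p.2), fun b x hx => ?_⟩
    rw [Finset.coe_insert, Submodule.mem_span_insert] at hx
    obtain ⟨n, y, hy, rfl⟩ := hx
    rw [← add_assoc]
    refine Submodule.span_le.2 ?_ (hT (b + n • ψ) y hy)
    rintro _ ⟨t, ht, rfl⟩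
    change F (b + n • ψ + t) ∈ _
    rw [add_right_comm]
    refine Submodule.span_mono ?_ (hT' (b + t) n)
    rintro _ ⟨t', ht', rfl⟩
    refine ⟨t + t', ?_, by simp [add_assoc]⟩
    simp only [Finset.coe_image]
    exact ⟨(t, t'), by simp; exact ⟨ht, ht'⟩, rfl⟩

lemma F_pow (hm : ∀ a b, F (a * b) = F b * F a) (h1 : F 1 = 1) (a : E) (n : ℕ) : F (a ^ n) = F a ^ n := by
  induction n with
  | zero => simp [h1]
  | succ n ih => rw [pow_succ', hm, ih, pow_succ]

lemma F_int (h : ∀ ψ b, (fwdDiff ψ)^[d] F b = 0) (hm : ∀ a b, F (a * b) = F b * F a) (h1 : F 1 = 1) (γ : E) (hγ : IsIntegral ℤ γ) :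
    IsIntegral ℤ (F γ) := by
  obtain ⟨s, hs⟩ := hγ.fg_adjoin_singleton
  obtain ⟨T, hT⟩ := lemA F d h s
  have hfg : (Submodule.span ℤ ((fun t => F (0 + t)) '' (T : Set E))).FG := 
    Submodule.fg_span (T.finite_toSet.image _)
  have hN := isNoetherian_of_fg_of_noetherian _ hfg
  refine IsIntegral.of_mem_of_fg (Algebra.adjoin ℤ {F γ}) ?_ _ (Algebra.subset_adjoin rfl)
  have hle : Subalgebra.toSubmodule (Algebra.adjoin ℤ {F γ}) ≤ Submodule.span ℤ ((fun t => F (0 + t)) '' (T : Set E)) := by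
    rw [Algebra.adjoin_singleton_eq_range_aeval]
    rintro _ ⟨f, rfl⟩
    simp only [AlgHom.toRingHom_eq_coe, RingHom.coe_coe]
    rw [Polynomial.aeval_eq_sum_range]
    refine Submodule.sum_mem _ fun i _ => Submodule.smul_mem _ _ ?_
    rw [← F_pow F hm h1, ← zero_add (γ ^ i)]
    apply hT
    rw [hs]
    exact pow_mem (Algebra.subset_adjoin (by simp)) i
  have : (Submodule.comap (Submodule.span ℤ ((fun t => F (0 + t)) '' (T : Set E))).subtype 
     (Subalgebra.toSubmodule (Algebra.adjoin ℤ {F γ}))).FG := hN.noetherian _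
  have := this.map (Submodule.span ℤ ((fun t => F (0 + t)) '' (T : Set E))).subtype
  rwa [Submodule.map_comap_subtype, inf_eq_right.2 hle] at this

lemma F_newton (h : ∀ ψ b, (fwdDiff ψ)^[d+1] F b = 0) : ∀ n : ℕ, F (n : E) = ∑ k ∈ Finset.range (d+1), n.choose k • (fwdDiff (1:E))^[k] F 0 := by
    intro n
    have h0 : ∀ k, d + 1 ≤ k → (fwdDiff (1:E))^[k] F 0 = 0 := by
      intro k hk
      obtain ⟨e, rfl⟩ : ∃ e, k = e + (d+1) := ⟨k - (d+1), by omega⟩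
      rw [Function.iterate_add_apply, show (fwdDiff (1:E))^[d+1] F = 0 from funext fun b => h 1 b]
      have : ∀ e : ℕ, (fwdDiff (1:E))^[e] (0 : E → V) = 0 := by
        intro e
        induction e with
        | zero => rfl
        | succ e ih => rw [Function.iterate_succ_apply', ih]; funext x; simp [fwdDiff]
      rw [this]; rfl
    have := shift_eq_sum_fwdDiff_iter (1:E) F n 0
    rw [zero_add, nsmul_one] at this
    rw [this]
    rcases le_total n d with hn | hn
    · refine Finset.sum_subset (Finset.range_mono (by omega)) fun k _ hk => ?_
      rw [Nat.choose_eq_zero_of_lt (by simpa using hk), zero_smul]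
    · refine (Finset.sum_subset (Finset.range_mono (by omega)) fun k _ hk => ?_).symm
      rw [h0 k (by simpa using hk), smul_zero]

lemma F_nat (h : ∀ ψ b, (fwdDiff ψ)^[d+1] F b = 0) : ∃ B : ℕ → V, ∀ n : ℕ, (d.factorial) • F (n : E) = ∑ i ∈ Finset.range (d+1), (n ^ i) • B i := by
  have hN := F_newton F d h
  let D : ℕ → V := fun k => (fwdDiff (1:E))^[k] F 0
  have hk : ∀ k, k ≤ d → ∀ n : ℕ, ((d.factorial * n.choose k : ℕ) : ℤ) = 
     ∑ i ∈ Finset.range (d+1), ((d.factorial / k.factorial : ℕ) : ℤ) * (descPochhammer ℤ k).coeff i * (n:ℤ)^i := by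
    intro k hk n
    have h2 := descPochhammer_eval_eq_descFactorial ℤ n k
    rw [Polynomial.eval_eq_sum_range' (n := d+1) (by rw [descPochhammer_natDegree]; omega)] at h2
    simp_rw [mul_assoc]
    rw [← Finset.mul_sum, h2, Nat.descFactorial_eq_factorial_mul_choose, ← Nat.cast_mul, ← mul_assoc, 
      Nat.div_mul_cancel (Nat.factorial_dvd_factorial hk)]
  refine ⟨fun i => ∑ k ∈ Finset.range (d+1), (((d.factorial / k.factorial : ℕ) : ℤ) * (descPochhammer ℤ k).coeff i) • D k, fun n => ?_⟩
  rw [hN, Finset.smul_sum]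
  simp_rw [Finset.smul_sum]
  rw [Finset.sum_comm]
  refine Finset.sum_congr rfl fun k hk' => ?_
  rw [← mul_smul, ← natCast_zsmul, hk k (by simp at hk'; omega), Finset.sum_smul]
  refine Finset.sum_congr rfl fun i _ => ?_
  rw [← natCast_zsmul, ← mul_smul]
  congr 1
  push_cast; ring

lemma F_nat_poly (h : ∀ ψ b, (fwdDiff ψ)^[d+1] F b = 0) (hm : ∀ a b, F (a * b) = F b * F a) (h1 : F 1 = 1) (c : ℕ) (hc : c ≠ 0) :
    ∃ Q : Polynomial ℤ, Q.coeff 0 ≠ 0 ∧ Polynomial.aeval (F (c : E)) Q = 0 := by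
  obtain ⟨B, hB⟩ := F_nat F d h
  let R : Polynomial ℤ := ∏ i ∈ Finset.range (d+1), (Polynomial.X - Polynomial.C ((c:ℤ)^i))
  have hR : ∀ i ∈ Finset.range (d+1), R.eval ((c:ℤ)^i) = 0 := by
    intro i hi
    rw [Polynomial.eval_prod]
    exact Finset.prod_eq_zero hi (by simp)
  have key : ∀ P : Polynomial ℤ, (d.factorial) • Polynomial.aeval (F (c : E)) P = ∑ i ∈ Finset.range (d+1), P.eval ((c:ℤ)^i) • B i := by
    intro P
    rw [Polynomial.aeval_eq_sum_range, Finset.smul_sum]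
    simp_rw [Polynomial.eval_eq_sum_range, Finset.sum_smul]
    rw [Finset.sum_comm]
    refine Finset.sum_congr rfl fun k _ => ?_
    rw [← F_pow F hm h1, ← Nat.cast_pow, smul_comm, hB, Finset.smul_sum]
    refine Finset.sum_congr rfl fun i _ => ?_
    rw [← natCast_zsmul, ← mul_smul]
    congr 1
    push_cast; ring
  refine ⟨Polynomial.C ((d.factorial : ℕ) : ℤ) * R, ?_, ?_⟩
  · rw [Polynomial.coeff_C_mul]
    refine mul_ne_zero (by exact_mod_cast Nat.factorial_ne_zero d) ?_
    rw [Polynomial.coeff_zero_eq_eval_zero, Polynomial.eval_prod, Finset.prod_ne_zero_iff]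
    intro i _
    simp [hc]
  · rw [map_mul, Polynomial.aeval_C]
    have := key R
    rw [Finset.sum_eq_zero (fun i hi => by rw [hR i hi, zero_smul])] at this
    rw [nsmul_eq_mul] at this
    simpa using this

theorem F_alg (h : ∀ ψ b, (fwdDiff ψ)^[d+1] F b = 0) (hm : ∀ a b, F (a * b) = F b * F a) (h1 : F 1 = 1) (β : E) (hβ : IsAlgebraic ℤ β) :
    IsAlgebraic ℤ (F β) := by
  obtain ⟨y, hy, hyi⟩ := hβ.exists_integral_multiple
  have hci : IsIntegral ℤ (y.natAbs • β) := by
    rcases Int.natAbs_eq y with e | e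
    · rw [e] at hyi; rwa [natCast_zsmul] at hyi
    · rw [e] at hyi; rw [neg_smul, natCast_zsmul] at hyi
      simpa using hyi.neg
  have hc : y.natAbs ≠ 0 := by simpa using hy
  set c := y.natAbs
  rw [nsmul_eq_mul] at hci
  have hF := (F_int F (d+1) h hm h1 _ hci).isAlgebraic
  obtain ⟨Q, hQ0, hQ⟩ := F_nat_poly F d h hm h1 c hc
  have hcomm : ∀ x, F (c : E) * F x = F x * F (c:E) := fun x => by
    rw [← hm, ← hm, (Nat.cast_commute c x).eq]
  have hQc : IsAlgebraic ℤ (F (c:E)) := ⟨Q, fun e => by simp [e] at hQ0, hQ⟩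
  have hu := alg_poly hQc Q.divX
  have e1 : Polynomial.aeval (F (c:E)) Q.divX * F (c:E) = - ((Q.coeff 0 : ℤ) : V) := by
    rw [← Polynomial.divX_mul_X_add Q, map_add, map_mul, Polynomial.aeval_X, Polynomial.aeval_C] at hQ
    rw [eq_neg_iff_add_eq_zero]
    simpa using hQ
  have e2 : (-(Q.coeff 0)) • F β = Polynomial.aeval (F (c:E)) Q.divX * F (c * β) := by
    rw [(Nat.cast_commute c β).eq, hm, ← mul_assoc, e1, zsmul_eq_mul]
    push_cast; rfl
  have e3 : IsAlgebraic ℤ ((-(Q.coeff 0)) • F β) := by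
    rw [e2]
    refine alg_mul_comm ?_ hu hF
    have : Commute (F (c:E)) (F (c * β)) := hcomm _
    refine Polynomial.induction_on' (motive := fun f => Polynomial.aeval (F (c:E)) f * F (c * β) = F (c * β) * Polynomial.aeval (F (c:E)) f) Q.divX ?_ ?_
    · intro p q hp hq; rw [map_add, add_mul, mul_add, hp, hq]
    · intro n a
      rw [Polynomial.aeval_monomial]
      exact ((Algebra.commute_algebraMap_left a _).mul_left (this.pow_left n)).eq
  exact e3.of_smul (mem_nonZeroDivisors_of_ne_zero (by simpa using hQ0))

end poly

theorem FF_alg {k : Type} [CommRing k] {Z : Type} [CommGroup Z] {M : Type} [AddCommGroup M] [Module k M] 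
   (ρ : Representation k Z M) (hρ : ∀ g, ρ g = 1) (j : ℕ) (β : AddMonoid.End (Additive Z)) (hβ : IsAlgebraic ℤ β) :
   IsAlgebraic ℤ (FF ρ hρ j β) :=
  F_alg (FF ρ hρ j) j (FF_fwdDiff ρ hρ j) (FF_mul ρ hρ j) (FF_one ρ hρ j) β hβ

lemma H_kill {k : Type} [CommRing k] {Z : Type} [Group Z] {M : Type} [AddCommGroup M] [Module k M] 
   (ρ : Representation k Z M) (c : k) (hc : ∀ m : M, c • m = 0) (j : ℕ) (x : H ρ j) : c • x = 0 := by
  obtain ⟨f, hf, rfl⟩ := Hmk_surj x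
  rw [Hmk_smul, Hmk_eq_zero]
  have : c • f = 0 := funext fun _ => hc _
  rw [this]; exact zero_mem _

lemma pow_dvd_choose {p m j i : ℕ} (hp : p.Prime) (hi : 1 ≤ i) (hij : i ≤ j) : p ^ m ∣ (p ^ (m + j)).choose i := by
  have h1 : p ^ (m+j) * (p ^ (m+j) - 1).choose (i-1) = (p ^ (m+j)).choose i * i := by
    obtain ⟨i, rfl⟩ : ∃ i', i = i' + 1 := ⟨i - 1, by omega⟩
    have := Nat.add_one_mul_choose_eq (p ^ (m+j) - 1) i
    rw [Nat.sub_add_cancel (Nat.one_le_pow _ _ hp.pos)] at this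
    simpa using this
  have h2 : p ^ (m+j) ∣ (p ^ (m+j)).choose i * i := ⟨_, h1.symm⟩
  obtain ⟨e, i', hi', rfl⟩ := Nat.exists_eq_pow_mul_and_not_dvd (by omega : i ≠ 0) p hp.ne_one
  have he : e ≤ j := by
    by_contra hh
    have : j < p ^ e := lt_of_lt_of_le (by omega : j < e) (Nat.lt_pow_self hp.one_lt).le
    have : 0 < i' := Nat.pos_of_ne_zero (by rintro rfl; simp at hi)
    nlinarith
  have h3 : p ^ (m + j) ∣ (p ^ (m+j)).choose (p ^ e * i') * p ^ e := by
    rw [← mul_assoc] at h2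
    exact (Nat.Coprime.pow_left _ ((Nat.Prime.coprime_iff_not_dvd hp).2 hi')).dvd_of_dvd_mul_right h2
  obtain ⟨t, ht⟩ := h3
  have h4 : p ^ (m+j) = p ^ (m + (j - e)) * p ^ e := by rw [← pow_add]; congr 1; omega
  rw [h4, mul_right_comm] at ht
  rw [← h4] at ht
  have := Nat.eq_of_mul_eq_mul_right (Nat.pow_pos hp.pos) ht
  rw [this, pow_add, mul_assoc]
  exact dvd_mul_right _ _

theorem FF_ppow {k : Type} [CommRing k] {Z : Type} [CommGroup Z] {M : Type} [AddCommGroup M] [Module k M] 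
   (ρ : Representation k Z M) (hρ : ∀ g, ρ g = 1) (j : ℕ) (hj : 1 ≤ j) (p m : ℕ) (hp : p.Prime) (hM : ∀ x : M, (p ^ m) • x = 0) :
   FF ρ hρ j ((p ^ (m + j) : ℕ) : AddMonoid.End (Additive Z)) = 0 := by
  rw [F_newton (FF ρ hρ j) j (FF_fwdDiff ρ hρ j)]
  have hV : ∀ v : Module.End k (H ρ j), (p ^ m) • v = 0 := by
    intro v
    ext x
    have := H_kill ρ ((p ^ m : ℕ) : k) (fun m => by rw [Nat.cast_smul_eq_nsmul]; exact hM m) j (v x)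
    rwa [Nat.cast_smul_eq_nsmul] at this
  refine Finset.sum_eq_zero fun i hi => ?_
  rcases Nat.eq_zero_or_pos i with rfl | h0
  · simp only [Nat.choose_zero_right, Function.iterate_zero, id, one_smul]
    ext x
    obtain ⟨j, rfl⟩ : ∃ j', j = j' + 1 := ⟨j - 1, by omega⟩
    obtain ⟨f, hf, rfl⟩ := Hmk_surj x
    let ρ' : Representation k Unit M := 1
    let a : PHom ρ ρ' := ⟨1, LinearMap.id, fun g m => by simp [ρ']⟩
    let b : PHom ρ' ρ := ⟨1, LinearMap.id, fun g m => by simp [ρ', hρ]⟩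
    have e : pullP ρ hρ 0 = b.comp a := by
      apply PHom.ext'
      · intro z; rfl
      · intro z; rfl
    change Hmap (pullP ρ hρ 0) (j+1) _ = 0
    rw [e, Hmap_comp]
    have : ∀ y : H ρ' (j+1), y = 0 := by
      intro y
      obtain ⟨z, rfl⟩ := (Hmap_bij' (⟨MonoidHom.id _, { toFun := fun F => F (), map_add' := fun _ _ => rfl, map_smul' := fun _ _ => rfl }, fun g F => by rfl⟩ : 
          PHom (coind k (MonoidHom.id Unit) M) ρ') Function.bijective_id ⟨fun F F' h => by funext u; exact h, fun m => ⟨fun _ => m, rfl⟩⟩ (j+1)).2 y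
      rw [coind_acyclic _ Function.injective_id j z, map_zero]
    rw [this (Hmap a _ _), map_zero]
  · obtain ⟨t, ht⟩ := pow_dvd_choose (m := m) hp h0 (show i ≤ j by simp at hi; omega)
    rw [ht, mul_smul, hV]

end CC
end

noncomputable section
namespace CC

lemma fin_of_fibers {X Y : Type} [AddCommGroup X] [AddCommGroup Y] (g : X →+ Y) (hr : (Set.range g).Finite)
    (hk : {x | g x = 0}.Finite) : Finite X := by
  rw [← Set.finite_univ_iff, ← Set.preimage_range g]
  refine hr.preimage' ?_
  rintro _ ⟨x0, rfl⟩
  refine (hk.image (fun t => t + x0)).subset ?_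
  intro x hx
  exact ⟨x - x0, by simp only [Set.mem_setOf_eq, map_sub]; rw [show g x = g x0 from hx, sub_self], by simp⟩

lemma serre_fin (k : Type) [CommRing k] : IsSerre (k := k) (fun X _ _ => Finite X) where
  mid {X Y Z} _ _ _ _ _ _ f g h hX hZ := by
    refine fin_of_fibers g.toAddMonoidHom (Set.toFinite _) ?_
    have : {x | g.toAddMonoidHom x = 0} = Set.range f := by
      ext x; exact h x
    rw [this]; exact Set.finite_range f
  zero := inferInstance

section good
variable {k : Type} [CommRing k]

def Good (k : Type) [CommRing k] (p : ℕ) (G : Type) [Group G] : Prop := ∀ (F : Type) [AddCommGroup F] [Module k F] [Finite F] (m : ℕ)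
  (hm : ∀ x : F, (p ^ m) • x = 0) (ρ : Representation k G F) (n : ℕ), Finite (H ρ n)

def GoodT (k : Type) [CommRing k] (p : ℕ) (G : Type) [Group G] : Prop := ∀ (F : Type) [AddCommGroup F] [Module k F] [Finite F] (m : ℕ)
  (hm : ∀ x : F, (p ^ m) • x = 0) (ρ : Representation k G F) (hρ : ∀ g, ρ g = 1) (n : ℕ), Finite (H ρ n)

lemma Good.T {p : ℕ} {G : Type} [Group G] (h : Good k p G) : GoodT k p G := fun F _ _ _ m hm ρ _ n => h F m hm ρ n

lemma H_killn {Z : Type} [Group Z] {M : Type} [AddCommGroup M] [Module k M] 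
   (ρ : Representation k Z M) (c : ℕ) (hc : ∀ m : M, c • m = 0) (j : ℕ) (x : H ρ j) : c • x = 0 := by
  have := H_kill ρ (c : k) (fun m => by rw [Nat.cast_smul_eq_nsmul]; exact hc m) j x
  rwa [Nat.cast_smul_eq_nsmul] at this

lemma Good.ext {p : ℕ} {G Q : Type} [Group G] [Group Q] (π : G →* Q) (hπ : Function.Surjective π) (h1 : Good k p π.ker) (h2 : Good k p Q) :
    Good k p G := by
  intro F _ _ _ m hm ρ n
  refine lhs π hπ (serre_fin k) n ρ fun i j _ => ?_
  have := h1 F m hm (res π.ker ρ) j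
  exact h2 _ m (fun x => H_killn _ _ hm j x) _ i

lemma Good.iso {p : ℕ} {G Q : Type} [Group G] [Group Q] (π : G ≃* Q) (h2 : Good k p Q) :
    Good k p G := by
  intro F _ _ _ m hm ρ n
  have h := h2 F m hm (ρ.comp π.symm.toMonoidHom) n
  have := (Hmap_bij' (⟨π.toMonoidHom, LinearMap.id, fun g m => by simp⟩ : PHom (ρ.comp π.symm.toMonoidHom) ρ) π.bijective Function.bijective_id n)
  exact Finite.of_surjective _ this.2

lemma hrep_triv {G Q : Type} [CommGroup G] [Group Q] (π : G →* Q) (hπ : Function.Surjective π) {M : Type} [AddCommGroup M]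
   [Module k M] (ρ : Representation k G M) (hρ : ∀ g, ρ g = 1) (j : ℕ) (q : Q) : hrep π hπ ρ j q = 1 := by
  obtain ⟨g, rfl⟩ := hπ q
  ext x
  rw [hrep_apply]
  have : cjP π ρ g = PHom.id _ := PHom.ext' (fun y => Subtype.ext (by
    change (cjK π g y : G) = _; rw [cjK_coe, mul_comm, ← mul_assoc, mul_inv_cancel, one_mul]; rfl)) (fun m => by 
      change ρ g m = m; rw [hρ]; rfl)
  rw [this, Hmap_id]; rfl

lemma GoodT.ext {p : ℕ} {G Q : Type} [CommGroup G] [Group Q] (π : G →* Q) (hπ : Function.Surjective π) (h1 : GoodT k p π.ker) (h2 : GoodT k p Q) :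
    GoodT k p G := by
  intro F _ _ _ m hm ρ hρ n
  refine lhs π hπ (serre_fin k) n ρ fun i j _ => ?_
  have := h1 F m hm (res π.ker ρ) (fun g => hρ _) j
  exact h2 _ m (fun x => H_killn _ _ hm j x) _ (hrep_triv π hπ ρ hρ j) i

lemma Good.fin (k : Type) [CommRing k] (p : ℕ) (G : Type) [Group G] [Finite G] : Good k p G := by
  intro F _ _ _ m hm ρ n
  let f : {c : (Fin n → G) → F // cd ρ n c = 0} → H ρ n := fun c => Hmk ρ n c.1 c.2
  refine Finite.of_surjective f fun x => ?_
  obtain ⟨c, hc, rfl⟩ := Hmk_surj x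
  exact ⟨⟨c, hc⟩, rfl⟩

lemma antidiff {B : Type} [AddCommGroup B] (f : ℤ → B) : ∃ Y : ℤ → B, ∀ n, Y (n+1) - Y n = f n := by
  let Y : ℤ → B := fun n => match n with
    | .ofNat n => ∑ i ∈ Finset.range n, f i
    | .negSucc n => - ∑ i ∈ Finset.range (n+1), f (-(i:ℤ)-1)
  refine ⟨Y, fun n => ?_⟩
  match n with
  | .ofNat n =>
    change Y (.ofNat (n+1)) - Y (.ofNat n) = _
    change ∑ i ∈ Finset.range (n+1), f i - ∑ i ∈ Finset.range n, f i = _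
    rw [Finset.sum_range_succ]; simp
  | .negSucc 0 =>
    change Y (.ofNat 0) - Y (.negSucc 0) = _
    change ∑ i ∈ Finset.range 0, f i - - ∑ i ∈ Finset.range (0+1), f (-(i:ℤ)-1) = _
    simp
  | .negSucc (n+1) =>
    have : Int.negSucc (n+1) + 1 = Int.negSucc n := by omega
    rw [this]
    change - ∑ i ∈ Finset.range (n+1), f (-(i:ℤ)-1) - - ∑ i ∈ Finset.range (n+1+1), f (-(i:ℤ)-1) = _
    rw [Finset.sum_range_succ _ (n+1)]
    have : Int.negSucc (n+1) = -((n+1 : ℕ):ℤ) - 1 := by omega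
    rw [this]; abel

lemma Good.int (k : Type) [CommRing k] (p : ℕ) : Good k p (Multiplicative ℤ) := by
  intro F _ _ _ m hm ρ n
  let z : Multiplicative ℤ := Multiplicative.ofAdd 1
  let D : (Multiplicative ℤ → F) →ₗ[k] (Multiplicative ℤ → F) :=
    { toFun := fun f x => f (z * x) - ρ z (f x)
      map_add' := fun f g => by funext x; simp only [Pi.add_apply, map_add]; abel
      map_smul' := fun c f => by funext x; simp only [Pi.smul_apply, map_smul, RingHom.id_apply, smul_sub] }
  have s : SES (k := k) ρ (I ρ) (I ρ) (shiftι ρ) D := {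
    hf := shiftι_eq ρ
    hg := fun x f => by funext y; change f (z * y * x) - ρ z (f (y * x)) = f (z * (y * x)) - ρ z (f (y * x)); rw [mul_assoc]
    inj := shiftι_inj ρ
    surj := fun K => by
      obtain ⟨Y, hY⟩ := antidiff (fun n : ℤ => ρ (Multiplicative.ofAdd (-(n+1))) (K (Multiplicative.ofAdd n)))
      refine ⟨fun x => ρ x (Y x.toAdd), ?_⟩
      funext x
      change ρ (z * x) (Y (z * x).toAdd) - ρ z (ρ x (Y x.toAdd)) = K x
      rw [← Module.End.mul_apply, ← map_mul, ← map_sub]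
      have e : (z * x).toAdd = x.toAdd + 1 := by simp [z, add_comm]
      rw [e, hY, ← Module.End.mul_apply, ← map_mul]
      have : z * x * Multiplicative.ofAdd (-(x.toAdd + 1)) = 1 := by
        apply Multiplicative.toAdd.injective
        simp only [toAdd_mul, toAdd_ofAdd, z, toAdd_one]; ring
      rw [this, map_one]; rfl
    exact := fun f => by
      constructor
      · intro h
        have h1 : ∀ x, f (z * x) = ρ z (f x) := fun x => sub_eq_zero.1 (congrFun h x)
        refine ⟨f 1, ?_⟩
        have h2 : ∀ n : ℤ, f (z ^ n) = ρ (z ^ n) (f 1) := by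
          intro n
          induction n with
          | zero => simp
          | succ n ih => rw [zpow_add_one, mul_comm, h1, ih, map_mul]; rfl
          | pred n ih =>
            have := h1 (z ^ (-(n:ℤ) - 1))
            rw [← zpow_one_add, show (1 + (-(n:ℤ) - 1)) = -(n:ℤ) by ring, ih] at this
            have e : ρ (z⁻¹) (ρ (z ^ (-(n:ℤ))) (f 1)) = ρ z⁻¹ (ρ z (f (z ^ (-(n:ℤ)-1)))) := by rw [this]
            rw [← Module.End.mul_apply, ← map_mul, ← Module.End.mul_apply, ← map_mul, inv_mul_cancel, map_one] at e
            have e3 : z ^ (-(n:ℤ) - 1) = z⁻¹ * z ^ (-(n:ℤ)) := by rw [zpow_sub_one, mul_comm]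
            rw [← e3] at e
            exact e.symm
        funext x
        have : x = z ^ (x.toAdd) := by
          apply Multiplicative.toAdd.injective
          simp [z]
        rw [this]
        exact (h2 _).symm
      · rintro ⟨a, rfl⟩
        funext x
        change ρ (z * x) a - ρ z (ρ x a) = 0
        rw [map_mul, sub_eq_zero]; rfl }
  match n with
  | 0 => exact Finite.of_injective _ (ev0_inj ρ)
  | 1 =>
    have hI : Finite (H (I ρ) 0) := by
      refine Finite.of_injective (fun x => ev0 (I ρ) x 1) fun x y h => ev0_inj _ ?_
      funext t
      have h1 := congrFun (ev0_inv (I ρ) t x) 1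
      have h2 := congrFun (ev0_inv (I ρ) t y) 1
      simp only [coind_apply, MonoidHom.id_apply, one_mul] at h1 h2
      rw [h1, h2]; exact h
    refine Finite.of_surjective (s.δ 0) fun x => (s.exact3 0 x).1 (I_acyclic ρ 0 _)
  | n+2 =>
    have hI : Finite (H (I ρ) (n+1)) := by
      have : Subsingleton (H (I ρ) (n+1)) := ⟨fun a b => by rw [I_acyclic ρ n a, I_acyclic ρ n b]⟩
      infer_instance
    refine Finite.of_surjective (s.δ (n+1)) fun x => (s.exact3 (n+1) x).1 (I_acyclic ρ (n+1) _)

lemma Good.cyclic (k : Type) [CommRing k] (p : ℕ) (G : Type) [Group G] [IsCyclic G] : Good k p G := by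
  rcases finite_or_infinite G with h | h
  · exact Good.fin k p G
  · obtain ⟨g, hg⟩ := IsCyclic.exists_zpow_surjective (G := G)
    refine Good.iso (MulEquiv.ofBijective (zpowersHom G g) ⟨?_, fun x => ?_⟩).symm (Good.int k p)
    · intro a b hab
      apply Multiplicative.toAdd.injective
      refine (injective_zpow_iff_not_isOfFinOrder.2 fun hf => ?_) hab
      have := hf.finite_zpowers
      refine h.not_finite (Set.finite_univ_iff.1 (this.subset fun x _ => hg x))
    · obtain ⟨n, rfl⟩ := hg x
      exact ⟨Multiplicative.ofAdd n, rfl⟩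

lemma finite_ppow_torsion {Z : Type} [CommGroup Z] (p : ℕ) (h : {x : Z | x ^ p = 1}.Finite) (s : ℕ) : {x : Z | x ^ (p ^ s) = 1}.Finite := by
  induction s with
  | zero => simp
  | succ s ih =>
    have : {x : Z | x ^ (p ^ (s+1)) = 1} = (fun x => x ^ p) ⁻¹' {x : Z | x ^ (p ^ s) = 1} := by
      ext x; simp only [Set.mem_setOf_eq, Set.mem_preimage, ← pow_mul, pow_succ']
    rw [this]
    refine ih.preimage' fun b _ => ?_
    by_cases hb : ∃ x0 : Z, x0 ^ p = b
    · obtain ⟨x0, rfl⟩ := hb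
      refine (h.image (fun t => t * x0)).subset ?_
      intro x hx
      refine ⟨x * x0⁻¹, ?_, by simp⟩
      have hx' : x ^ p = x0 ^ p := hx
      simp [mul_pow, hx']
    · convert Set.finite_empty
      ext x
      simp only [Set.mem_preimage, Set.mem_singleton_iff, Set.mem_empty_iff_false, iff_false]
      exact fun h => hb ⟨x, h⟩

lemma GoodT.divisible (k : Type) [CommRing k] (p : ℕ) (hp : p.Prime) (Z : Type) [CommGroup Z] (ht : {x : Z | x ^ p = 1}.Finite) (hd : ∀ x : Z, ∃ y, y ^ p = x) :
    GoodT k p Z := by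
  have hd' : ∀ s, Function.Surjective (powMonoidHom (p ^ s) : Z →* Z) := by
    intro s
    induction s with
    | zero => intro x; exact ⟨x, by simp⟩
    | succ s ih =>
      intro x
      obtain ⟨y, rfl⟩ := hd x
      obtain ⟨w, rfl⟩ := ih y
      exact ⟨w, by simp [← pow_mul, pow_succ]⟩
  intro F _ _ _ m hm ρ hρ n
  induction n using Nat.strong_induction_on generalizing F with
  | _ n ih =>
    rcases Nat.eq_zero_or_pos n with rfl | hn
    · exact Finite.of_injective _ (ev0_inj ρ)
    let π : Z →* Z := powMonoidHom (p ^ (m + n))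
    have hπ : Function.Surjective π := hd' _
    have hK : Finite π.ker := (finite_ppow_torsion p ht (m+n)).to_subtype
    have h1 := edge π hπ (serre_fin k) n ρ (fun i j hij => by
      have := Good.fin k p π.ker F m hm (res π.ker ρ) (j+1)
      exact ih i (by omega) _ (fun x => H_killn _ _ hm _ x) _ (hrep_triv π hπ ρ hρ (j+1)))
    let u : PHom (hrep π hπ ρ 0) ρ := ⟨MonoidHom.id Z, ev0 _, fun g x => by
      change ev0 (res π.ker ρ) (hrep π hπ ρ 0 g x) = _
      rw [hrep_triv π hπ ρ hρ, hρ]; rfl⟩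
    have e : infP π hπ ρ = (pullP ρ hρ ((p ^ (m + n) : ℕ) : AddMonoid.End (Additive Z))).comp u := by
      apply PHom.ext'
      · intro z
        change z ^ (p ^ (m+n)) = toMH ((p ^ (m + n) : ℕ) : AddMonoid.End (Additive Z)) z
        rw [toMH_apply, AddMonoid.End.natCast_apply]; rfl
      · intro m; rfl
    have e2 : LinearMap.ker (Hmap (infP π hπ ρ) n) = ⊤ := by
      rw [LinearMap.ker_eq_top]
      ext x
      rw [e, Hmap_comp]
      have := FF_ppow ρ hρ n hn p m hp hm
      exact LinearMap.congr_fun this _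
    rw [e2] at h1
    have h2 : Finite (H (hrep π hπ ρ 0) n) := Finite.of_injective (fun x => (⟨x, trivial⟩ : (⊤ : Submodule k (H (hrep π hπ ρ 0) n)))) (fun a b h => congrArg Subtype.val h)
    refine Finite.of_surjective _ (Hmap_bij' u Function.bijective_id ⟨ev0_inj _, fun x => ?_⟩ n).2
    exact ⟨Hconst _ x (fun g => by change ρ _ x = x; rw [hρ]; rfl), rfl⟩

def SecFin (p : ℕ) (G : Type) [Group G] : Prop := ∀ (K : Subgroup G) (X : Type) [CommGroup X] (f : K →* X), Function.Surjective f →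
  {x : X | x ^ p = 1}.Finite

lemma SecFin.sub {p : ℕ} {G : Type} [Group G] (h : SecFin p G) (K : Subgroup G) : SecFin p K := by
  intro L X _ f hf
  let e := L.equivMapOfInjective K.subtype K.subtype_injective
  exact h (L.map K.subtype) X (f.comp e.symm.toMonoidHom) (hf.comp e.symm.surjective)

lemma SecFin.quot {p : ℕ} {G Q : Type} [Group G] [Group Q] (h : SecFin p G) (π : G →* Q) (hπ : Function.Surjective π) : SecFin p Q := by
  intro L X _ f hf
  refine h (L.comap π) X (f.comp (π.subgroupComap L)) (hf.comp ?_)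
  rintro ⟨y, hy⟩
  obtain ⟨x, rfl⟩ := hπ y
  exact ⟨⟨x, hy⟩, rfl⟩

lemma SecFin.self {p : ℕ} {G X : Type} [Group G] [CommGroup X] (h : SecFin p G) (f : G →* X) (hf : Function.Surjective f) : {x : X | x ^ p = 1}.Finite :=
  h ⊤ X (f.comp (⊤ : Subgroup G).subtype) (fun x => by obtain ⟨y, rfl⟩ := hf x; exact ⟨⟨y, trivial⟩, rfl⟩)

lemma GoodT.ab (k : Type) [CommRing k] (p : ℕ) (hp : p.Prime) (c : ℕ) : ∀ (Z : Type) [CommGroup Z] (h : SecFin p Z), (powMonoidHom p : Z →* Z).range.index = c → GoodT k p Z := by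
  induction c using Nat.strong_induction_on with
  | _ c ih =>
  intro Z _ h hc
  by_cases h1 : (powMonoidHom p : Z →* Z).range = ⊤
  · refine GoodT.divisible k p hp Z (h.self (MonoidHom.id Z) Function.surjective_id) fun x => ?_
    have : x ∈ (powMonoidHom p : Z →* Z).range := h1 ▸ trivial
    obtain ⟨y, hy⟩ := this
    exact ⟨y, hy⟩
  · obtain ⟨z, hz⟩ : ∃ z, z ∉ (powMonoidHom p : Z →* Z).range := by
      by_contra hh; push Not at hh
      exact h1 (eq_top_iff.2 fun x _ => hh x)
    let Q := Z ⧸ Subgroup.zpowers z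
    let π : Z →* Q := QuotientGroup.mk' (Subgroup.zpowers z)
    have hπ : Function.Surjective π := QuotientGroup.mk'_surjective _
    have hker : π.ker = Subgroup.zpowers z := QuotientGroup.ker_mk' _
    refine GoodT.ext π hπ ?_ ?_
    · rw [hker]
      exact (Good.cyclic k p _).T
    · refine ih _ ?_ Q (h.quot π hπ) rfl
      have hf := h.self (QuotientGroup.mk' (powMonoidHom p : Z →* Z).range) (QuotientGroup.mk'_surjective _)
      have hfin : Finite (Z ⧸ (powMonoidHom p : Z →* Z).range) := by
        rw [← Set.finite_univ_iff]
        refine hf.subset fun x _ => ?_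
        obtain ⟨y, rfl⟩ := QuotientGroup.mk'_surjective _ x
        change _ ^ p = 1
        rw [← map_pow, QuotientGroup.mk'_apply, QuotientGroup.eq_one_iff]
        exact ⟨y, rfl⟩
      have hfi : (powMonoidHom p : Z →* Z).range.FiniteIndex := Subgroup.finiteIndex_of_finite_quotient
      have e : ((powMonoidHom p : Q →* Q).range.comap π).index = (powMonoidHom p : Q →* Q).range.index :=
        Subgroup.index_comap_of_surjective _ hπ
      rw [← e, ← hc]
      refine Subgroup.index_strictAnti ?_
      refine lt_of_le_of_ne ?_ ?_
      · rintro _ ⟨y, rfl⟩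
        exact ⟨π y, by simp⟩
      · intro he
        apply hz
        rw [he]
        refine ⟨1, ?_⟩
        have : π z = 1 := (QuotientGroup.eq_one_iff z).2 (Subgroup.mem_zpowers z)
        rw [this]; simp

lemma Good.ab (k : Type) [CommRing k] (p : ℕ) (hp : p.Prime) (Z : Type) [CommGroup Z] (h : SecFin p Z) : Good k p Z := by
  intro F _ _ _ m hm ρ n
  let π0 : Z →* Equiv.Perm F := 
    { toFun := fun g => ⟨ρ g, ρ g⁻¹, fun x => by rw [← Module.End.mul_apply, ← map_mul]; simp, fun x => by rw [← Module.End.mul_apply, ← map_mul]; simp⟩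
      map_one' := by ext x; simp
      map_mul' := fun a b => by ext x; simp }
  let π := π0.rangeRestrict
  have hπ : Function.Surjective π := π0.rangeRestrict_surjective
  refine lhs π hπ (serre_fin k) n ρ fun i j _ => ?_
  have hk : ∀ g : π.ker, res π.ker ρ g = 1 := by
    rintro ⟨g, hg⟩
    ext x
    have : π0 g = 1 := congrArg Subtype.val hg
    exact congrFun (congrArg (fun e : Equiv.Perm F => (e : F → F)) this) x
  have := GoodT.ab k p hp _ π.ker (h.sub _) rfl F m hm (res π.ker ρ) hk j
  exact Good.fin k p _ _ m (fun x => H_killn _ _ hm j x) _ i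

theorem Good.solvable (k : Type) [CommRing k] (p : ℕ) (hp : p.Prime) (G : Type) [Group G] (hs : IsSolvable G) (h : SecFin p G) : Good k p G := by
  obtain ⟨n, hn⟩ := hs.solvable
  have key : ∀ i, i ≤ n → Good k p (derivedSeries G (n - i)) := by
    intro i
    induction i with
    | zero => 
      intro _
      rw [Nat.sub_zero, hn]
      exact Good.fin k p _
    | succ i ih =>
      intro hi
      have h1 := ih (by omega)
      obtain ⟨d, hk⟩ : ∃ d, n - i = d + 1 := ⟨n - i - 1, by omega⟩
      have hk' : n - (i+1) = d := by omega
      rw [hk, derivedSeries_succ, ← Subgroup.map_subtype_commutator] at h1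
      rw [hk']
      refine Good.ext (Abelianization.of) Quot.mk_surjective ?_ (Good.ab k p hp _ ((h.sub _).quot Abelianization.of Quot.mk_surjective))
      rw [Abelianization.ker_of]
      exact Good.iso ((commutator (derivedSeries G d)).equivMapOfInjective (derivedSeries G d).subtype (Subgroup.subtype_injective _)) h1
  have := key n le_rfl
  rw [Nat.sub_self, derivedSeries_zero] at this
  exact Good.iso Subgroup.topEquiv.symm this

end good
end CC
end

noncomputable section
namespace CC

section zp
variable {p : ℕ} [hpf : Fact p.Prime] {A : Type} [AddCommGroup A]

lemma nsm_key {m n : ℕ} {a : A} (hm : p ^ m • a = 0) (hn : p ^ n • a = 0) {c d : ℕ} {x : ℤ_[p]}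
    (hc : x - (c : ℤ_[p]) ∈ Ideal.span {(p : ℤ_[p]) ^ m}) (hd : x - (d : ℤ_[p]) ∈ Ideal.span {(p : ℤ_[p]) ^ n}) :
    c • a = d • a := by
  obtain ⟨r, hr, hrm, hrn⟩ : ∃ r, p ^ r • a = 0 ∧ r ≤ m ∧ r ≤ n := by
    rcases le_total m n with h | h
    · exact ⟨m, hm, le_rfl, h⟩
    · exact ⟨n, hn, h, le_rfl⟩
  have key : ((c : ℤ_[p]) - d) ∈ Ideal.span {(p : ℤ_[p]) ^ r} := by
    have h1 := Ideal.span_singleton_le_span_singleton.2 (pow_dvd_pow (p : ℤ_[p]) hrm) hc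
    have h2 := Ideal.span_singleton_le_span_singleton.2 (pow_dvd_pow (p : ℤ_[p]) hrn) hd
    have := Ideal.sub_mem _ h2 h1
    simpa using this
  have h3 : ((p : ℤ) ^ r) ∣ ((c : ℤ) - d) := by
    rw [← PadicInt.pow_p_dvd_int_iff]
    rw [Ideal.mem_span_singleton] at key
    simpa using key
  obtain ⟨e, he⟩ := h3
  have : ((c : ℤ) - d) • a = 0 := by
    rw [he, mul_comm, mul_smul]
    have : ((p : ℤ) ^ r) • a = 0 := by
      rw [← hr, ← natCast_zsmul]; norm_cast
    rw [this, smul_zero]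
  rw [sub_smul, sub_eq_zero, natCast_zsmul, natCast_zsmul] at this
  exact this

def pexp (hA : ∀ a : A, ∃ n, p ^ n • a = 0) (a : A) : ℕ := (hA a).choose
lemma pexp_spec (hA : ∀ a : A, ∃ n, p ^ n • a = 0) (a : A) : p ^ (pexp hA a) • a = 0 := (hA a).choose_spec

def zsm (hA : ∀ a : A, ∃ n, p ^ n • a = 0) (x : ℤ_[p]) (a : A) : A := x.appr (pexp hA a) • a

lemma zsm_eq (hA : ∀ a : A, ∃ n, p ^ n • a = 0) (x : ℤ_[p]) (a : A) (m c : ℕ) (hm : p ^ m • a = 0)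
    (hc : x - (c : ℤ_[p]) ∈ Ideal.span {(p : ℤ_[p]) ^ m}) : zsm hA x a = c • a :=
  nsm_key (pexp_spec hA a) hm (PadicInt.appr_spec _ x) hc

lemma pow_kill_le {m n : ℕ} (h : m ≤ n) {a : A} (hm : p ^ m • a = 0) : p ^ n • a = 0 := by
  obtain ⟨k, rfl⟩ := Nat.exists_eq_add_of_le h
  rw [pow_add, mul_comm, mul_smul, hm, smul_zero]

@[reducible] def zpModule (hA : ∀ a : A, ∃ n, p ^ n • a = 0) : Module ℤ_[p] A where
  smul := zsm hA
  one_smul a := (zsm_eq hA 1 a (pexp hA a) 1 (pexp_spec hA a) (by simp)).trans (one_smul _ _)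
  mul_smul x y a := by
    have h0 := pexp_spec hA a
    set m := pexp hA a
    have h1 : zsm hA y a = y.appr m • a := zsm_eq hA y a m _ h0 (PadicInt.appr_spec _ _)
    change zsm hA (x * y) a = zsm hA x (zsm hA y a)
    rw [h1, zsm_eq hA x _ m (x.appr m) (by rw [smul_comm, h0, smul_zero]) (PadicInt.appr_spec _ _), ← mul_smul]
    refine zsm_eq hA _ a m _ h0 ?_
    have e : x * y - ((x.appr m * y.appr m : ℕ) : ℤ_[p]) = x * (y - y.appr m) + y.appr m * (x - x.appr m) := by
      push_cast; ring
    rw [e]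
    exact Ideal.add_mem _ (Ideal.mul_mem_left _ _ (PadicInt.appr_spec _ _)) (Ideal.mul_mem_left _ _ (PadicInt.appr_spec _ _))
  smul_zero x := by
    change x.appr _ • (0 : A) = 0
    simp
  zero_smul a := (zsm_eq hA 0 a (pexp hA a) 0 (pexp_spec hA a) (by simp)).trans (zero_smul _ _)
  smul_add x a b := by
    change zsm hA x (a + b) = zsm hA x a + zsm hA x b
    set m := max (pexp hA a) (pexp hA b)
    have ha : p ^ m • a = 0 := pow_kill_le (le_max_left _ _) (pexp_spec hA a)
    have hb : p ^ m • b = 0 := pow_kill_le (le_max_right _ _) (pexp_spec hA b)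
    rw [zsm_eq hA x a m _ ha (PadicInt.appr_spec _ _), zsm_eq hA x b m _ hb (PadicInt.appr_spec _ _),
      zsm_eq hA x (a + b) m _ (by rw [smul_add, ha, hb, add_zero]) (PadicInt.appr_spec _ _), smul_add]
  add_smul x y a := by
    have h0 := pexp_spec hA a
    set m := pexp hA a
    change zsm hA (x + y) a = zsm hA x a + zsm hA y a
    rw [zsm_eq hA x a m _ h0 (PadicInt.appr_spec _ _), zsm_eq hA y a m _ h0 (PadicInt.appr_spec _ _), ← add_smul]
    refine zsm_eq hA _ a m _ h0 ?_
    have e : x + y - ((x.appr m + y.appr m : ℕ) : ℤ_[p]) = (x - x.appr m) + (y - y.appr m) := by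
      push_cast; ring
    rw [e]
    exact Ideal.add_mem _ (PadicInt.appr_spec _ _) (PadicInt.appr_spec _ _)

end zp

structure PCtx (p : ℕ) (A : Type) [AddCommGroup A] : Prop where
  prim : ∀ a : A, ∃ n, p ^ n • a = 0
  div : ∀ a : A, ∃ b, p • b = a
  fin : {a : A | p • a = 0}.Finite

section ends
variable {p : ℕ} [hpf : Fact p.Prime] {A : Type} [AddCommGroup A] [Module ℤ_[p] A]

lemma zp_nat (hA : PCtx p A) (x : ℤ_[p]) (a : A) : ∃ c : ℕ, x • a = c • a := by
  obtain ⟨m, hm⟩ := hA.prim a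
  refine ⟨x.appr m, ?_⟩
  have := PadicInt.appr_spec m x
  obtain ⟨y, hy⟩ := Ideal.mem_span_singleton.1 this
  have h : (x - x.appr m) • a = 0 := by
    rw [hy, mul_comm, mul_smul]
    have : ((p : ℤ_[p]) ^ m) • a = 0 := by
      rw [← hm, ← Nat.cast_pow, Nat.cast_smul_eq_nsmul]
    rw [this, smul_zero]
  rw [sub_smul, sub_eq_zero] at h
  rw [h, Nat.cast_smul_eq_nsmul]

def linOf (hA : PCtx p A) (f : A →+ A) : Module.End ℤ_[p] A where
  toFun := f
  map_add' := f.map_add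
  map_smul' x a := by
    obtain ⟨m, hm⟩ := hA.prim a
    obtain ⟨y, hy⟩ := Ideal.mem_span_singleton.1 (PadicInt.appr_spec m x)
    have key : ∀ b : A, p ^ m • b = 0 → x • b = x.appr m • b := by
      intro b hb
      have h : (x - x.appr m) • b = 0 := by
        rw [hy, mul_comm, mul_smul]
        have : ((p : ℤ_[p]) ^ m) • b = 0 := by
          rw [← hb, ← Nat.cast_pow, Nat.cast_smul_eq_nsmul]
        rw [this, smul_zero]
      rw [sub_smul, sub_eq_zero] at h
      rw [h, Nat.cast_smul_eq_nsmul]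
    simp only [RingHom.id_apply]
    rw [key a hm, key (f a) (by rw [← map_nsmul, hm, map_zero]), map_nsmul]

abbrev EE (p : ℕ) [Fact p.Prime] (A : Type) [AddCommGroup A] [Module ℤ_[p] A] := Module.End ℤ_[p] A

lemma E_nsmul_apply (n : ℕ) (r : EE p A) (a : A) : (n • r) a = n • r a := by
  simp

lemma E_tf (hA : PCtx p A) (r : EE p A) (h : p • r = 0) : r = 0 := by
  ext a
  obtain ⟨b, rfl⟩ := hA.div a
  rw [map_nsmul, ← E_nsmul_apply, h, LinearMap.zero_apply, LinearMap.zero_apply]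

lemma E_tf_pow (hA : PCtx p A) (n : ℕ) (r : EE p A) (h : p ^ n • r = 0) : r = 0 := by
  induction n with
  | zero => simpa using h
  | succ n ih => exact ih (E_tf hA _ (by rw [← mul_smul, ← pow_succ', h]))

lemma E_sep (hA : PCtx p A) (r : EE p A) (h : ∀ n, ∃ s : EE p A, r = p ^ n • s) : r = 0 := by
  ext a
  obtain ⟨n, hn⟩ := hA.prim a
  obtain ⟨s, rfl⟩ := h n
  rw [E_nsmul_apply, ← map_nsmul, hn, map_zero, LinearMap.zero_apply]

lemma div_pow (hA : PCtx p A) (n : ℕ) : ∀ a : A, ∃ b, p ^ n • b = a := by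
  induction n with
  | zero => exact fun a => ⟨a, by simp⟩
  | succ n ih =>
    intro a
    obtain ⟨b, rfl⟩ := ih a
    obtain ⟨c, rfl⟩ := hA.div b
    exact ⟨c, by rw [pow_succ, mul_smul]⟩

lemma E_div (hA : PCtx p A) (n : ℕ) (r : EE p A) (h : ∀ a : A, p ^ n • a = 0 → r a = 0) : ∃ s : EE p A, r = p ^ n • s := by
  choose d hd using div_pow hA n
  have key : ∀ b c : A, p ^ n • b = p ^ n • c → r b = r c := by
    intro b c hbc
    rw [← sub_eq_zero, ← map_sub]
    exact h _ (by rw [smul_sub, hbc, sub_self])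
  let f : A →+ A := AddMonoidHom.mk' (fun a => r (d a)) (by
    intro a b
    rw [← map_add]
    exact key _ _ (by rw [smul_add, hd, hd, hd]))
  refine ⟨linOf hA f, ?_⟩
  ext a
  rw [E_nsmul_apply, ← map_nsmul]
  change r a = r (d (p ^ n • a))
  exact key _ _ (by rw [hd])

lemma fin_pow (hA : PCtx p A) (n : ℕ) : {a : A | p ^ n • a = 0}.Finite := by
  induction n with
  | zero => exact (Set.finite_singleton (0 : A)).subset (fun a ha => by simpa using ha)
  | succ n ih =>
    refine Set.Finite.of_finite_fibers (f := fun a : A => p • a) (ih.subset ?_) ?_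
    · rintro _ ⟨a, ha, rfl⟩
      change p ^ n • p • a = 0
      rw [← mul_smul, ← pow_succ]; exact ha
    · rintro _ ⟨a, ha, rfl⟩
      refine (hA.fin.image (fun t => t + a)).subset ?_
      rintro b ⟨hb, hb'⟩
      refine ⟨b - a, ?_, by simp⟩
      change p • (b - a) = 0
      rw [smul_sub, show p • b = p • a from hb', sub_self]

lemma E_reps (hA : PCtx p A) : ∃ S : Finset (EE p A), ∀ r : EE p A, ∃ s ∈ S, ∃ t : EE p A, r = s + p • t := by
  classical
  have : Finite {a : A | p • a = 0} := hA.fin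
  let F : EE p A → ({a : A | p • a = 0} → {a : A | p • a = 0}) := fun r a => ⟨r a, by
    change p • r a.1 = 0
    rw [← map_nsmul, show p • a.1 = 0 from a.2, map_zero]⟩
  have hfin : (Set.range F).Finite := Set.toFinite _
  choose g hg using fun y : Set.range F => y.2
  have : Finite (Set.range F) := hfin
  refine ⟨(Set.finite_range g).toFinset, fun r => ⟨g ⟨F r, r, rfl⟩, by simp, ?_⟩⟩
  have h1 : F (g ⟨F r, r, rfl⟩) = F r := hg ⟨F r, r, rfl⟩
  obtain ⟨t, ht⟩ := E_div hA 1 (r - g ⟨F r, r, rfl⟩) (by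
    intro a ha
    rw [pow_one] at ha
    have := congrArg Subtype.val (congrFun h1 ⟨a, ha⟩)
    change (g ⟨F r, r, rfl⟩) a = r a at this
    rw [LinearMap.sub_apply, this, sub_self])
  exact ⟨t, by rw [pow_one] at ht; rw [← ht]; abel⟩

lemma padic_series (b : ℕ → ℕ) : ∃ x : ℤ_[p], ∀ n, ∃ y, x = (∑ i ∈ Finset.range n, p ^ i * (b i : ℤ_[p])) + p ^ n * y := by
  have := IsPrecomplete.prec (I := IsLocalRing.maximalIdeal ℤ_[p]) (M := ℤ_[p]) inferInstance
    (f := fun n => ∑ i ∈ Finset.range n, (p : ℤ_[p]) ^ i * (b i : ℤ_[p])) (by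
      intro m n hmn
      rw [SModEq.sub_mem, PadicInt.maximalIdeal_eq_span_p, Ideal.span_singleton_pow]
      rw [smul_eq_mul, Ideal.mul_top, Ideal.mem_span_singleton]
      rw [← Finset.sum_range_add_sum_Ico _ hmn]
      rw [sub_add_cancel_left, dvd_neg]
      refine Finset.dvd_sum fun i hi => ?_
      exact Dvd.dvd.mul_right (pow_dvd_pow _ (Finset.mem_Ico.1 hi).1) _)
  obtain ⟨L, hL⟩ := this
  refine ⟨L, fun n => ?_⟩
  have := hL n
  rw [SModEq.sub_mem, PadicInt.maximalIdeal_eq_span_p, Ideal.span_singleton_pow, smul_eq_mul, Ideal.mul_top, Ideal.mem_span_singleton] at this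
  obtain ⟨y, hy⟩ := this
  exact ⟨-y, by rw [mul_neg, ← hy]; ring⟩

lemma E_finite (hA : PCtx p A) : Module.Finite ℤ_[p] (EE p A) := by
  classical
  obtain ⟨S, hS⟩ := E_reps hA
  refine ⟨⟨S, ?_⟩⟩
  rw [eq_top_iff]
  intro r _
  choose s hs t ht using hS
  let seq : ℕ → EE p A := fun n => t^[n] r
  have hseq : ∀ n, seq n = s (seq n) + p • seq (n + 1) := by
    intro n
    have : seq (n + 1) = t (seq n) := Function.iterate_succ_apply' _ _ _
    rw [this]; exact ht _
  let b : EE p A → ℕ → ℕ := fun e i => if s (seq i) = e then 1 else 0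
  choose x hx using fun e => padic_series (p := p) (b e)
  have hsum : ∀ n, r = (∑ i ∈ Finset.range n, p ^ i • s (seq i)) + p ^ n • seq n := by
    intro n
    induction n with
    | zero => simp [seq]
    | succ n ih =>
      rw [Finset.sum_range_succ, add_assoc, pow_succ, mul_smul, ← smul_add, ← hseq]; exact ih
  have hr : r - ∑ e ∈ S, x e • e = 0 := by
    apply E_sep hA
    intro n
    choose y hy using fun e => hx e n
    refine ⟨seq n - ∑ e ∈ S, y e • e, ?_⟩
    have h1 : ∑ e ∈ S, x e • e = (∑ i ∈ Finset.range n, p ^ i • s (seq i)) + p ^ n • ∑ e ∈ S, y e • e := by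
      rw [Finset.smul_sum]
      have : ∀ e ∈ S, x e • e = (∑ i ∈ Finset.range n, (p : ℤ_[p]) ^ i • (b e i) • e) + p ^ n • y e • e := by
        intro e _
        rw [hy e, add_smul, Finset.sum_smul, mul_smul]
        congr 1
        · refine Finset.sum_congr rfl fun i _ => ?_
          rw [mul_smul, Nat.cast_smul_eq_nsmul]
        · rw [← Nat.cast_pow, Nat.cast_smul_eq_nsmul]
      rw [Finset.sum_congr rfl this, Finset.sum_add_distrib, Finset.sum_comm]
      congr 1
      refine Finset.sum_congr rfl fun i _ => ?_
      rw [← Finset.smul_sum, ← Nat.cast_pow, Nat.cast_smul_eq_nsmul]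
      congr 1
      simp only [b, ite_smul, one_smul, zero_smul]
      rw [Finset.sum_ite_eq, if_pos (hs _)]
    rw [h1]
    conv_lhs => rw [hsum n]
    rw [smul_sub]; abel
  rw [sub_eq_zero] at hr
  rw [hr]
  exact Submodule.sum_mem _ fun e he => Submodule.smul_mem _ _ (Submodule.subset_span he)

/-- A commutative model of the algebra generated by a commuting set. -/
lemma exists_comm (hA : PCtx p A) (s : Set (EE p A)) (hs : ∀ x ∈ s, ∀ y ∈ s, x * y = y * x) :
    ∃ (R : Type) (_ : CommRing R) (_ : Algebra ℤ_[p] R) (i : R →ₐ[ℤ_[p]] EE p A),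
      Function.Injective i ∧ i.range = Algebra.adjoin ℤ_[p] s ∧ IsNoetherianRing R ∧ Module.Finite ℤ_[p] R := by
  let B := Algebra.adjoin ℤ_[p] s
  have hc : ∀ x y : B, x * y = y * x := by
    letI := Algebra.adjoinCommRingOfComm ℤ_[p] hs
    intro x y
    exact mul_comm x y
  letI : CommRing B := { (inferInstance : Ring B) with mul_comm := hc }
  have hf := E_finite hA
  have : IsNoetherian ℤ_[p] (EE p A) := isNoetherian_of_isNoetherianRing_of_finite _ _
  have hfB : Module.Finite ℤ_[p] B := Module.Finite.of_injective B.val.toLinearMap Subtype.val_injective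
  refine ⟨B, inferInstance, inferInstance, B.val, Subtype.val_injective, B.range_val, ?_, hfB⟩
  exact IsNoetherianRing.of_finite ℤ_[p] B

end ends
end CC
end

noncomputable section
namespace CC

section L1
variable {p : ℕ} [hpf : Fact p.Prime] {A : Type} [AddCommGroup A] [Module ℤ_[p] A]

def NearOne (g : EE p A) : Prop := ∃ e : EE p A, g = 1 + p ^ 2 • e

lemma NearOne.pow {g : EE p A} (h : NearOne g) (n : ℕ) : NearOne (g ^ n) := by
  obtain ⟨e, rfl⟩ := h
  induction n with
  | zero => exact ⟨0, by simp⟩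
  | succ n ih =>
    obtain ⟨b, hb⟩ := ih
    refine ⟨b + e + p ^ 2 • (b * e), ?_⟩
    rw [pow_succ, hb]
    simp only [mul_add, add_mul, mul_one, one_mul, smul_add, smul_mul_assoc, mul_smul_comm]
    abel

lemma brk {g : EE p A} (h : NearOne g) (m : ℕ) : ∃ F : EE p A →+ EE p A, ∀ r, g ^ m * r - r * g ^ m =
    m • (g * r - r * g) + p ^ 2 • F (g * r - r * g) := by
  induction m with
  | zero => exact ⟨0, fun r => by simp⟩
  | succ m ih =>
    obtain ⟨F, hF⟩ := ih
    obtain ⟨b, hb⟩ := h.pow m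
    obtain ⟨e, he⟩ := h
    refine ⟨m • (AddMonoidHom.mulLeft e) + (AddMonoidHom.mulLeft g).comp F + AddMonoidHom.mulRight b, fun r => ?_⟩
    have e1 : g ^ (m + 1) * r - r * g ^ (m + 1) = g * (g ^ m * r - r * g ^ m) + (g * r - r * g) * g ^ m := by
      rw [pow_succ']
      noncomm_ring
    rw [e1, hF]
    generalize g * r - r * g = d
    simp only [AddMonoidHom.add_apply, AddMonoidHom.coe_comp, Function.comp_apply, AddMonoidHom.coe_mulLeft, AddMonoidHom.coe_mulRight,
      AddMonoidHom.smul_apply]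
    rw [hb, mul_add, mul_smul_comm, mul_smul_comm]
    have e2 : m • (g * d) = m • d + p ^ 2 • m • (e * d) := by
      rw [he, add_mul, one_mul, smul_add, smul_mul_assoc, smul_comm m]
    rw [e2, mul_add, mul_one, mul_smul_comm]
    simp only [smul_add, succ_nsmul]
    abel

lemma L1_prime (hA : PCtx p A) {g : EE p A} (h : NearOne g) (m : ℕ) (hm : m.Prime) (r : EE p A)
    (hr : g ^ m * r = r * g ^ m) : g * r = r * g := by
  obtain ⟨F, hF⟩ := brk h m
  have h0 := hF r
  rw [hr, sub_self] at h0
  rw [← sub_eq_zero]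
  generalize g * r - r * g = d at h0
  refine E_sep hA d fun n => ?_
  induction n with
  | zero => exact ⟨d, by simp⟩
  | succ n ih =>
    obtain ⟨d', rfl⟩ := ih
    have h1 : m • d' + p ^ 2 • F d' = 0 := by
      apply E_tf_pow hA n
      rw [smul_add, h0, map_nsmul]
      rw [smul_comm (p ^ n) m, smul_comm (p ^ n) (p ^ 2)]
    by_cases hmp : m = p
    · subst hmp
      have h2 : d' + m • F d' = 0 := by
        apply E_tf hA
        rw [smul_add, ← mul_smul, ← pow_two, h1]
      refine ⟨-(F d'), ?_⟩
      rw [pow_succ, mul_smul, smul_neg, ← eq_neg_of_add_eq_zero_left h2]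
    · have hcop : IsCoprime (m : ℤ) (p : ℤ) := by
        rw [Nat.isCoprime_iff_coprime]
        exact (Nat.coprime_primes hm hpf.out).2 hmp
      obtain ⟨u, v, huv⟩ := hcop
      refine ⟨v • d' - u • (p • F d'), ?_⟩
      rw [pow_succ, mul_smul]
      congr 1
      have h3 : (m : ℤ) • d' = - ((p:ℤ) • p • F d') := by
        rw [natCast_zsmul, natCast_zsmul, ← mul_smul, ← pow_two]
        exact eq_neg_of_add_eq_zero_left h1
      calc d' = (u * m + v * p) • d' := by rw [huv, one_smul]
        _ = u • (m : ℤ) • d' + (p : ℤ) • v • d' := by rw [add_smul, mul_smul, mul_comm v, mul_smul]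
        _ = (p : ℤ) • (v • d' - u • (p • F d')) := by rw [h3, smul_sub, smul_comm (p : ℤ) u, smul_neg]; abel
        _ = _ := natCast_zsmul _ _

lemma L1 (hA : PCtx p A) : ∀ (m : ℕ) (hm : m ≠ 0) {g : EE p A} (h : NearOne g) (r : EE p A)
    (hr : g ^ m * r = r * g ^ m), g * r = r * g := by
  intro m
  induction m using Nat.recOnMul with
  | zero => exact fun h => absurd rfl h
  | one => intro _ g h r hr; simpa using hr
  | prime q hq => intro _ g h r hr; exact L1_prime hA h q hq r hr
  | mul a b iha ihb =>
    intro hm g h r hr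
    refine iha (by rintro rfl; simp at hm) h r (ihb (by rintro rfl; simp at hm) (h.pow a) r ?_)
    rw [← pow_mul]; exact hr

end L1

section FR

lemma FR {R : Type} [CommRing R] [IsNoetherianRing R] [IsReduced R] (f : Polynomial R) (hf : f.Monic) :
    {x : R | f.eval x = 0}.Finite := by
  have hfin := minimalPrimes.finite_of_isNoetherianRing R
  have : Finite (minimalPrimes R) := hfin
  have hp : ∀ P : minimalPrimes R, P.1.IsPrime := fun P => P.2.1.1
  let F : R → (∀ P : minimalPrimes R, R ⧸ P.1) := fun x P => Ideal.Quotient.mk P.1 x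
  have hinj : Function.Injective F := by
    intro x y hxy
    rw [← sub_eq_zero]
    have : x - y ∈ sInf (minimalPrimes R) := by
      rw [Ideal.mem_sInf]
      intro P hP
      have := congrFun hxy ⟨P, hP⟩
      exact Ideal.Quotient.eq.1 this
    have h2 : sInf (minimalPrimes R) = (⊥ : Ideal R).radical := Ideal.sInf_minimalPrimes
    rw [h2, show (⊥ : Ideal R).radical = ⊥ from nilradical_eq_bot_iff.2 inferInstance] at this
    exact this
  refine Set.Finite.of_finite_image (f := F) ?_ hinj.injOn
  refine (Set.Finite.pi (t := fun P : minimalPrimes R => {y : R ⧸ P.1 | (f.map (Ideal.Quotient.mk P.1)).eval y = 0}) ?_).subset ?_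
  · intro P
    have := hp P
    have hne : f.map (Ideal.Quotient.mk P.1) ≠ 0 := (hf.map _).ne_zero
    classical
    refine ((f.map (Ideal.Quotient.mk P.1)).roots.toFinset.finite_toSet).subset ?_
    intro y hy
    simp only [Finset.mem_coe, Multiset.mem_toFinset]
    exact (Polynomial.mem_roots hne).2 hy
  · rintro _ ⟨x, hx, rfl⟩ P _
    change (f.map (Ideal.Quotient.mk P.1)).eval (Ideal.Quotient.mk P.1 x) = 0
    rw [Polynomial.eval_map, Polynomial.eval₂_at_apply, show f.eval x = 0 from hx, map_zero]

end FR

section grp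
variable {p : ℕ} [hpf : Fact p.Prime] {A : Type} [AddCommGroup A] [Module ℤ_[p] A]
variable {G : Type} [Group G] (ρ : G →* EE p A)

def Irr : Prop := ∀ S : AddSubgroup A, (∀ (g : G), ∀ a ∈ S, ρ g a ∈ S) → S ≠ ⊤ → (S : Set A).Finite

variable {ρ}

lemma ρ_inv_mul (g : G) : ρ g⁻¹ * ρ g = 1 := by rw [← map_mul, inv_mul_cancel, map_one]
lemma ρ_mul_inv (g : G) : ρ g * ρ g⁻¹ = 1 := by rw [← map_mul, mul_inv_cancel, map_one]

lemma fin_range_zero (hA : PCtx p A) (S : AddSubgroup A) (hS : (S : Set A).Finite) (x : EE p A) (hx : ∀ a, x a ∈ S) : x = 0 := by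
  obtain ⟨k, hk⟩ : ∃ k, ∀ s ∈ S, p ^ k • s = 0 := by
    choose n hn using hA.prim
    refine ⟨hS.toFinset.sup n, fun s hs => pow_kill_le (Finset.le_sup (f := n) (by simpa using hs)) (hn s)⟩
  apply E_tf_pow hA k
  ext a
  rw [E_nsmul_apply, hk _ (hx a), LinearMap.zero_apply]

lemma ann_dich (hA : PCtx p A) (hi : Irr ρ) (J : Set (EE p A)) (hJ : ∀ g, ∀ j ∈ J, ρ g⁻¹ * j * ρ g ∈ J) (x : EE p A)
    (hx : ∀ j ∈ J, j * x = 0) : x = 0 ∨ ∀ j ∈ J, j = 0 := by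
  let S : AddSubgroup A :=
    { carrier := {a | ∀ j ∈ J, j a = 0}
      zero_mem' := fun j _ => map_zero j
      add_mem' := fun {a b} ha hb j hj => by rw [map_add, ha j hj, hb j hj, add_zero]
      neg_mem' := fun {a} ha j hj => by rw [map_neg, ha j hj, neg_zero] }
  by_cases hS : S = ⊤
  · right
    intro j hj
    ext a
    have : a ∈ S := by rw [hS]; trivial
    exact this j hj
  · left
    refine fin_range_zero hA S (hi S ?_ hS) x ?_
    · intro g a ha j hj
      have h1 := ha _ (hJ g j hj)
      have h2 : j * ρ g = ρ g * (ρ g⁻¹ * j * ρ g) := by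
        rw [← mul_assoc, ← mul_assoc, ρ_mul_inv, one_mul]
      have := congrArg (fun f : EE p A => f a) h2
      simp only [Module.End.mul_apply] at this h1
      rw [this, h1, map_zero]
    · intro a j hj
      have := congrArg (fun f : EE p A => f a) (hx j hj)
      simpa using this

lemma adj_conj (s : Set (EE p A)) (hs : ∀ g, ∀ x ∈ s, ρ g⁻¹ * x * ρ g ∈ s) (g : G) (x : EE p A)
    (hx : x ∈ Algebra.adjoin ℤ_[p] s) : ρ g⁻¹ * x * ρ g ∈ Algebra.adjoin ℤ_[p] s := by
  induction hx using Algebra.adjoin_induction with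
  | mem x hx => exact Algebra.subset_adjoin (hs g x hx)
  | algebraMap r =>
    rw [← Algebra.commutes r, mul_assoc, ρ_inv_mul, mul_one]
    exact Subalgebra.algebraMap_mem _ r
  | add x y _ _ hx hy => rw [mul_add, add_mul]; exact add_mem hx hy
  | mul x y _ _ hx hy =>
    have : ρ g⁻¹ * (x * y) * ρ g = (ρ g⁻¹ * x * ρ g) * (ρ g⁻¹ * y * ρ g) := by
      simp only [mul_assoc]
      rw [← mul_assoc (ρ g) (ρ g⁻¹), ρ_mul_inv, one_mul]
    rw [this]; exact mul_mem hx hy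

/-- The ring generated by a commuting invariant set is reduced. -/
lemma red (hA : PCtx p A) (hi : Irr ρ) {R : Type} [CommRing R] [Algebra ℤ_[p] R] [IsNoetherianRing R] (i : R →ₐ[ℤ_[p]] EE p A)
    (hinj : Function.Injective i) (hc : ∀ g r, ∃ r', i r' = ρ g⁻¹ * i r * ρ g) : IsReduced R := by
  by_contra hnr
  have hJ0 : nilradical R ≠ ⊥ := fun h => hnr ((nilradical_eq_bot_iff (R := R)).1 h)
  obtain ⟨n, hn⟩ := IsNoetherianRing.isNilpotent_nilradical R
  classical
  have hex : ∃ n, (nilradical R) ^ n = 0 := ⟨n, hn⟩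
  set m := Nat.find hex with hm
  have h1 := Nat.find_spec hex
  rw [← hm] at h1
  have hm0 : m ≠ 0 := by
    intro h; rw [h, pow_zero] at h1
    apply hJ0
    rw [← mul_one (nilradical R), h1, mul_zero]; rfl
  obtain ⟨l, hl⟩ := Nat.exists_eq_succ_of_ne_zero hm0
  have h2 : (nilradical R) ^ l ≠ 0 := Nat.find_min hex (by omega)
  obtain ⟨x, hx, hx0⟩ := Submodule.exists_mem_ne_zero_of_ne_bot h2
  obtain ⟨y, hy, hy0⟩ := Submodule.exists_mem_ne_zero_of_ne_bot hJ0
  have := ann_dich hA hi (i '' (nilradical R : Set R)) (by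
    rintro g _ ⟨j, hj, rfl⟩
    obtain ⟨r', hr'⟩ := hc g j
    refine ⟨r', ?_, hr'⟩
    obtain ⟨k, hk⟩ := mem_nilradical.1 hj
    refine mem_nilradical.2 ⟨k, hinj ?_⟩
    rw [map_pow, hr', map_zero]
    have : ∀ k, (ρ g⁻¹ * i j * ρ g) ^ k = ρ g⁻¹ * (i j) ^ k * ρ g := by
      intro k
      induction k with
      | zero => rw [pow_zero, pow_zero, mul_one, ρ_inv_mul]
      | succ k ih =>
        rw [pow_succ, ih, pow_succ]
        simp only [mul_assoc]
        rw [← mul_assoc (ρ g) (ρ g⁻¹), ρ_mul_inv, one_mul]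
    rw [this, ← map_pow, hk, map_zero, mul_zero, zero_mul]) (i x) (by
    rintro _ ⟨j, hj, rfl⟩
    rw [← map_mul]
    have : j * x ∈ (nilradical R) ^ m := by
      rw [hl, pow_succ, mul_comm j]
      exact Ideal.mul_mem_mul hx hj
    rw [h1] at this
    rw [show j * x = 0 from this, map_zero])
  rcases this with h | h
  · exact hx0 (hinj (by rw [h, map_zero]))
  · exact hy0 (hinj (by rw [h _ ⟨y, hy, rfl⟩, map_zero]))

lemma red_set (hA : PCtx p A) (hi : Irr ρ) (s : Set (EE p A)) (hcomm : ∀ x ∈ s, ∀ y ∈ s, x * y = y * x)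
    (hs : ∀ g, ∀ x ∈ s, ρ g⁻¹ * x * ρ g ∈ s) :
    ∃ (R : Type) (_ : CommRing R) (_ : Algebra ℤ_[p] R) (i : R →ₐ[ℤ_[p]] EE p A),
      Function.Injective i ∧ i.range = Algebra.adjoin ℤ_[p] s ∧ IsNoetherianRing R ∧ Module.Finite ℤ_[p] R ∧ IsReduced R ∧
      ∀ g r, ∃ r', i r' = ρ g⁻¹ * i r * ρ g := by
  obtain ⟨R, _, _, i, hinj, hr, hn, hf⟩ := exists_comm hA s hcomm
  have hc : ∀ g r, ∃ r', i r' = ρ g⁻¹ * i r * ρ g := by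
    intro g r
    have h1 : i r ∈ Algebra.adjoin ℤ_[p] s := hr ▸ ⟨r, rfl⟩
    have h2 := adj_conj s hs g _ h1
    rw [← hr] at h2
    exact h2
  exact ⟨R, _, _, i, hinj, hr, hn, hf, red hA hi i hinj hc, hc⟩

lemma conj_pow (x : G) (b : EE p A) (k : ℕ) : (ρ x * b * ρ x⁻¹) ^ k = ρ x * b ^ k * ρ x⁻¹ := by
  induction k with
  | zero => rw [pow_zero, pow_zero, mul_one, ρ_mul_inv]
  | succ k ih =>
    rw [pow_succ, ih, pow_succ]
    simp only [mul_assoc]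
    rw [← mul_assoc (ρ x⁻¹) (ρ x), ρ_inv_mul, one_mul]

lemma conj_aeval (x : G) (b : EE p A) (f : Polynomial ℤ_[p]) :
    Polynomial.aeval (ρ x * b * ρ x⁻¹) f = ρ x * Polynomial.aeval b f * ρ x⁻¹ := by
  induction f using Polynomial.induction_on' with
  | add f g hf hg => rw [map_add, map_add, hf, hg, mul_add, add_mul]
  | monomial n a =>
    rw [Polynomial.aeval_monomial, Polynomial.aeval_monomial, conj_pow]
    rw [← mul_assoc, ← mul_assoc, ← mul_assoc, Algebra.commutes]

lemma E_integral (hA : PCtx p A) (b : EE p A) : ∃ f : Polynomial ℤ_[p], f.Monic ∧ Polynomial.aeval b f = 0 := by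
  have := E_finite hA
  exact Algebra.IsIntegral.isIntegral (R := ℤ_[p]) b

/-- pigeonhole : conjugation by powers of `x` on a finite set -/
lemma pig {X : Type} {f : ℕ → X} {s : Set X} (hs : s.Finite) (h : ∀ n, f n ∈ s) : ∃ i j, i < j ∧ f i = f j := by
  have : ¬ Function.Injective (fun n => (⟨f n, h n⟩ : s)) := by
    intro hi
    have : Finite s := hs
    exact not_injective_infinite_finite _ hi
  rw [Function.not_injective_iff] at this
  obtain ⟨a, b, hab, hne⟩ := this
  have hab' : f a = f b := congrArg Subtype.val hab
  rcases lt_or_gt_of_ne hne with h | h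
  · exact ⟨a, b, h, hab'⟩
  · exact ⟨b, a, h, hab'.symm⟩

/-- finite orbit gives commuting of a power -/
lemma comm_of_roots (hA : PCtx p A) {R : Type} [CommRing R] [Algebra ℤ_[p] R] [IsNoetherianRing R] [IsReduced R]
    (i : R →ₐ[ℤ_[p]] EE p A) (hinj : Function.Injective i) (x : G) (hx : NearOne (ρ x)) (b : EE p A)
    (hb : ∀ n : ℕ, ∃ r, i r = ρ (x ^ n) * b * ρ (x ^ n)⁻¹) : ρ x * b = b * ρ x := by
  obtain ⟨f, hf, hfb⟩ := E_integral hA b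
  choose r hr using hb
  have hroot : ∀ n, r n ∈ {y : R | (f.map (algebraMap ℤ_[p] R)).eval y = 0} := by
    intro n
    change (f.map (algebraMap ℤ_[p] R)).eval (r n) = 0
    rw [Polynomial.eval_map_algebraMap]
    apply hinj
    rw [map_zero, ← Polynomial.aeval_algHom_apply, hr, conj_aeval, hfb, mul_zero, zero_mul]
  obtain ⟨a, c, hac, h⟩ := pig (FR _ (hf.map _)) hroot
  have h1 : ρ (x ^ a) * b * ρ (x ^ a)⁻¹ = ρ (x ^ c) * b * ρ (x ^ c)⁻¹ := by rw [← hr, ← hr, h]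
  obtain ⟨k, rfl⟩ := Nat.exists_eq_add_of_lt hac
  refine L1 hA (k + 1) (Nat.succ_ne_zero k) hx b ?_
  have h2 := congrArg (fun t => ρ (x ^ a)⁻¹ * t * ρ (x ^ (a + k + 1))) h1
  simp only [mul_assoc] at h2
  rw [← map_mul (ρ) (x ^ (a + k + 1))⁻¹, inv_mul_cancel, map_one, mul_one, ← mul_assoc (ρ (x ^ a)⁻¹), ρ_inv_mul, one_mul] at h2
  rw [← map_mul, ← mul_assoc, ← map_mul] at h2
  rw [show (x ^ a)⁻¹ * x ^ (a + k + 1) = x ^ (k + 1) by rw [add_assoc, pow_add, ← mul_assoc, inv_mul_cancel, one_mul]] at h2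
  rw [← map_pow]
  exact h2.symm

end grp
end CC
end

noncomputable section
namespace CC
open scoped commutatorElement

section grp
variable {p : ℕ} [hpf : Fact p.Prime] {A : Type} [AddCommGroup A] [Module ℤ_[p] A]
variable {G : Type} [Group G] {ρ : G →* EE p A}

lemma ρ_comm_inv {x : G} {b : EE p A} (h : ρ x * b = b * ρ x) : ρ x⁻¹ * b = b * ρ x⁻¹ := by
  have := congrArg (fun t => ρ x⁻¹ * t * ρ x⁻¹) h
  rw [← mul_assoc, ρ_inv_mul, one_mul, mul_assoc (ρ x⁻¹), mul_assoc b, ρ_mul_inv, mul_one] at this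
  exact this.symm

lemma alpha (hA : PCtx p A) (x y z : G) (hz : ρ (x * y * x⁻¹) = ρ (z * y)) (hzx : ρ z * ρ x = ρ x * ρ z)
    (hzy : ρ z * ρ y = ρ y * ρ z) : ∃ M : ℕ, M ≠ 0 ∧ IsNilpotent (ρ z ^ M - 1) := by
  have hy' : ρ z * ρ y⁻¹ = ρ y⁻¹ * ρ z := (ρ_comm_inv hzy.symm).symm
  obtain ⟨R, _, _, i, hinj, hr, hn, hf⟩ := exists_comm hA ({ρ y, ρ y⁻¹, ρ z} : Set (EE p A)) (by
    have h1 : ρ y * ρ y⁻¹ = ρ y⁻¹ * ρ y := by rw [ρ_mul_inv, ρ_inv_mul]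
    rintro a (rfl | rfl | rfl) b (rfl | rfl | rfl)
    all_goals first | rfl | assumption | (symm; assumption))
  obtain ⟨Y, hY⟩ : ∃ Y, i Y = ρ y := by
    have : ρ y ∈ i.range := by rw [hr]; exact Algebra.subset_adjoin (by simp)
    exact this
  obtain ⟨Y', hY'⟩ : ∃ Y, i Y = ρ y⁻¹ := by
    have : ρ y⁻¹ ∈ i.range := by rw [hr]; exact Algebra.subset_adjoin (by simp)
    exact this
  obtain ⟨Z, hZ⟩ : ∃ Y, i Y = ρ z := by
    have : ρ z ∈ i.range := by rw [hr]; exact Algebra.subset_adjoin (by simp)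
    exact this
  obtain ⟨Z', hZ', hZZ⟩ : ∃ Z' : EE p A, True ∧ Z' * ρ z = 1 := ⟨ρ z⁻¹, trivial, ρ_inv_mul z⟩
  have hYY : Y * Y' = 1 := hinj (by rw [map_mul, hY, hY', ρ_mul_inv, map_one])
  have hconj : ∀ n : ℕ, ρ (x ^ n) * ρ y * ρ (x ^ n)⁻¹ = ρ z ^ n * ρ y := by
    intro n
    induction n with
    | zero => simp
    | succ n ih =>
      have hzxn : ρ (x ^ n) * ρ z = ρ z * ρ (x ^ n) := by
        rw [map_pow]; exact (Commute.pow_right (show Commute (ρ z) (ρ x) from hzx) n).symm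
      calc ρ (x ^ (n + 1)) * ρ y * ρ (x ^ (n + 1))⁻¹ = ρ (x ^ n) * ρ (x * y * x⁻¹) * ρ (x ^ n)⁻¹ := by
            rw [← map_mul, ← map_mul, ← map_mul, ← map_mul]; congr 1; rw [pow_succ]; group
        _ = ρ z * (ρ (x ^ n) * ρ y * ρ (x ^ n)⁻¹) := by
            rw [hz, map_mul, ← mul_assoc, hzxn]; simp only [mul_assoc]
        _ = _ := by rw [ih, ← mul_assoc, pow_succ']
  obtain ⟨f, hf1, hf0⟩ := E_integral hA (ρ y)
  have hroot : ∀ n, (f.map (algebraMap ℤ_[p] R)).eval (Z ^ n * Y) = 0 := by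
    intro n
    rw [Polynomial.eval_map_algebraMap]
    apply hinj
    rw [map_zero, ← Polynomial.aeval_algHom_apply, map_mul, map_pow, hZ, hY, ← hconj, conj_aeval, hf0, mul_zero, zero_mul]
  let Q := R ⧸ nilradical R
  have : IsReduced Q := (Ideal.isRadical_iff_quotient_reduced _).1 (Ideal.radical_isRadical (⊥ : Ideal R))
  obtain ⟨a, c, hac, h⟩ := pig (f := fun n => Ideal.Quotient.mk (nilradical R) (Z ^ n * Y))
    (FR ((f.map (algebraMap ℤ_[p] R)).map (Ideal.Quotient.mk (nilradical R))) ((hf1.map _).map _)) (by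
      intro n
      change Polynomial.eval _ _ = 0
      rw [Polynomial.eval_map, Polynomial.eval₂_at_apply, hroot, map_zero])
  obtain ⟨k, rfl⟩ := Nat.exists_eq_add_of_lt hac
  refine ⟨k + 1, Nat.succ_ne_zero k, ?_⟩
  have h1 : Z ^ (a + k + 1) * Y - Z ^ a * Y ∈ nilradical R := Ideal.Quotient.eq.1 h.symm
  obtain ⟨W, hW⟩ : ∃ W : R, i W = ρ z⁻¹ ∨ True := ⟨0, Or.inr trivial⟩
  obtain ⟨n, hn⟩ := mem_nilradical.1 h1
  have h2 : (Z ^ a) ^ n * (Z ^ (k + 1) - 1) ^ n = 0 := by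
    calc (Z ^ a) ^ n * (Z ^ (k + 1) - 1) ^ n = (Z ^ (a + k + 1) * Y - Z ^ a * Y) ^ n * Y' ^ n * 1 := by
          rw [← mul_pow, ← mul_pow, mul_one]
          congr 1
          rw [sub_mul, mul_assoc, mul_assoc, hYY]; ring
      _ = 0 := by rw [hn, zero_mul, zero_mul]
  refine ⟨n, ?_⟩
  have h3 := congrArg i h2
  rw [map_mul, map_pow, map_pow, map_pow, map_sub, map_pow, map_one, hZ, map_zero] at h3
  have h4 : ∀ (m : ℕ) (t : EE p A), ρ z ^ m * t = 0 → t = 0 := by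
    intro m t ht
    have := congrArg (fun s => ρ (z ^ m)⁻¹ * s) ht
    rw [← map_pow, ← mul_assoc, ρ_inv_mul, one_mul, mul_zero] at this
    exact this
  rw [← pow_mul] at h3
  exact h4 _ _ h3

lemma commG {x y : G} : ρ x * ρ y = ρ y * ρ x ↔ ρ ⁅x, y⁆ = 1 := by
  rw [commutatorElement_def]
  constructor
  · intro h
    rw [map_mul, map_mul, map_mul, h, mul_assoc (ρ y), ρ_mul_inv, mul_one, ρ_mul_inv]
  · intro h
    have := congrArg (fun s => s * ρ (y * x)) h
    simp only [← map_mul, one_mul] at this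
    rw [← map_mul, ← map_mul, ← this]
    congr 1
    group

lemma lemX (hA : PCtx p A) (x y : G) (hy : NearOne (ρ y)) (hzx : ρ ⁅x, y⁆ * ρ x = ρ x * ρ ⁅x, y⁆)
    (hzy : ρ ⁅x, y⁆ * ρ y = ρ y * ρ ⁅x, y⁆)
    (hred : ∀ M : ℕ, IsNilpotent (ρ ⁅x, y⁆ ^ M - 1) → ρ ⁅x, y⁆ ^ M - 1 = 0) : ρ x * ρ y = ρ y * ρ x := by
  have hxy : x * y * x⁻¹ = ⁅x, y⁆ * y := by rw [commutatorElement_def]; group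
  obtain ⟨M, hM, hnil⟩ := alpha hA x y ⁅x, y⁆ (by rw [hxy]) hzx hzy
  have h1 := sub_eq_zero.1 (hred M hnil)
  refine (L1 hA M hM hy (ρ x) ?_).symm
  have h2 : ρ x * ρ y ^ M * ρ x⁻¹ = ρ y ^ M := by
    rw [← conj_pow, ← map_mul, ← map_mul, hxy, map_mul, (show Commute (ρ ⁅x, y⁆) (ρ y) from hzy).mul_pow, h1, one_mul]
  have := congrArg (fun s => s * ρ x) h2
  simp only [mul_assoc] at this
  rw [ρ_inv_mul, mul_one] at this
  exact this.symm

lemma red_sub (hA : PCtx p A) (hi : Irr ρ) (C : Subgroup G) (hC : C.Normal)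
    (hcomm : ∀ x ∈ C, ∀ y ∈ C, ρ x * ρ y = ρ y * ρ x) :
    ∃ (R : Type) (_ : CommRing R) (_ : Algebra ℤ_[p] R) (i : R →ₐ[ℤ_[p]] EE p A),
      Function.Injective i ∧ i.range = Algebra.adjoin ℤ_[p] (ρ '' C) ∧ IsNoetherianRing R ∧ Module.Finite ℤ_[p] R ∧ IsReduced R ∧
      ∀ g r, ∃ r', i r' = ρ g⁻¹ * i r * ρ g := by
  refine red_set hA hi (ρ '' C) ?_ ?_
  · rintro _ ⟨x, hx, rfl⟩ _ ⟨y, hy, rfl⟩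
    exact hcomm x hx y hy
  · rintro g _ ⟨x, hx, rfl⟩
    refine ⟨g⁻¹ * x * g, ?_, by rw [map_mul, map_mul]⟩
    have := hC.conj_mem x hx g⁻¹
    simpa using this

lemma nil0 (hA : PCtx p A) (hi : Irr ρ) (C : Subgroup G) (hC : C.Normal)
    (hcomm : ∀ x ∈ C, ∀ y ∈ C, ρ x * ρ y = ρ y * ρ x) (z : G) (hz : z ∈ C) (M : ℕ) (hn : IsNilpotent (ρ z ^ M - 1)) :
    ρ z ^ M - 1 = 0 := by
  obtain ⟨R, _, _, i, hinj, hr, -, -, hred, -⟩ := red_sub hA hi C hC hcomm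
  obtain ⟨Z, hZ⟩ : ∃ Z, i Z = ρ z := by
    have : ρ z ∈ i.range := by rw [hr]; exact Algebra.subset_adjoin ⟨z, hz, rfl⟩
    exact this
  have : IsNilpotent (Z ^ M - 1) := by
    obtain ⟨n, hn⟩ := hn
    refine ⟨n, hinj ?_⟩
    rw [map_pow, map_sub, map_pow, hZ, map_one, hn, map_zero]
  have h0 := this.eq_zero
  rw [← hZ, ← map_one i, ← map_pow, ← map_sub, h0, map_zero]

lemma comm_cl1 (hA : PCtx p A) (hi : Irr ρ) (N G0 : Subgroup G) (hN : N.Normal) (hG0 : G0.Normal) (hnil : Group.IsNilpotent N)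
    (hnear : ∀ g ∈ G0, NearOne (ρ g)) : ∀ x ∈ N ⊓ G0, ∀ y ∈ N ⊓ G0, ρ x * ρ y = ρ y * ρ x := by
  have hN1 : (N ⊓ G0).Normal := inferInstance
  let C : Subgroup G :=
    { carrier := {c | c ∈ N ⊓ G0 ∧ ∀ n ∈ N ⊓ G0, ρ c * ρ n = ρ n * ρ c}
      one_mem' := ⟨one_mem _, fun n _ => by rw [map_one, one_mul, mul_one]⟩
      mul_mem' := by
        rintro a b ⟨ha, ha'⟩ ⟨hb, hb'⟩
        refine ⟨mul_mem ha hb, fun n hn => ?_⟩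
        rw [map_mul, mul_assoc, hb' n hn, ← mul_assoc, ha' n hn, mul_assoc]
      inv_mem' := by
        rintro a ⟨ha, ha'⟩
        exact ⟨inv_mem ha, fun n hn => ρ_comm_inv (ha' n hn)⟩ }
  have hC : C.Normal := by
    refine ⟨fun c hc g => ⟨hN1.conj_mem _ hc.1 g, fun n hn => ?_⟩⟩
    have h1 := hc.2 (g⁻¹ * n * g) (by simpa using hN1.conj_mem n hn g⁻¹)
    rw [← map_mul, ← map_mul] at h1
    have := congrArg (fun s => ρ g * s * ρ g⁻¹) h1
    simp only [← map_mul] at this ⊢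
    convert this using 2 <;> group
  have hCc : ∀ x ∈ C, ∀ y ∈ C, ρ x * ρ y = ρ y * ρ x := fun x hx y hy => hx.2 y hy.1
  have key : ∀ n (x : G) (hx : x ∈ N), x ∈ G0 → (⟨x, hx⟩ : N) ∈ Subgroup.upperCentralSeries N n → x ∈ C := by
    intro n
    induction n with
    | zero =>
      intro x hx hx0 h
      rw [Subgroup.upperCentralSeries_zero, Subgroup.mem_bot] at h
      have : x = 1 := congrArg Subtype.val h
      rw [this]; exact one_mem _
    | succ n ih =>
      intro x hx hx0 h
      refine ⟨⟨hx, hx0⟩, fun y hy => ?_⟩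
      rw [Subgroup.mem_upperCentralSeries_succ_iff] at h
      have h1 := h ⟨y, hy.1⟩
      have hz0 : ⁅x, y⁆ ∈ N ⊓ G0 := by
        rw [commutatorElement_def]
        exact mul_mem (mul_mem (mul_mem ⟨hx, hx0⟩ hy) (inv_mem ⟨hx, hx0⟩)) (inv_mem hy)
      have hz : ⁅x, y⁆ ∈ C := ih ⁅x, y⁆ hz0.1 hz0.2 h1
      exact lemX hA x y (hnear y hy.2) (hz.2 x ⟨hx, hx0⟩) (hz.2 y hy) (nil0 hA hi C hC hCc _ hz)
  intro x hx y hy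
  obtain ⟨n, hn⟩ := hnil
  exact (key n x hx.1 hx.2 (by rw [hn]; trivial)).2 y hy

lemma comm_G0 (hA : PCtx p A) (hi : Irr ρ) (N G0 : Subgroup G) (hN : N.Normal) (hG0 : G0.Normal) (hnil : Group.IsNilpotent N)
    (hnear : ∀ g ∈ G0, NearOne (ρ g)) (hab : ∀ x ∈ G0, ∀ y ∈ G0, ⁅x, y⁆ ∈ N) :
    ∀ x ∈ G0, ∀ y ∈ G0, ρ x * ρ y = ρ y * ρ x := by
  have hN1 : (N ⊓ G0).Normal := inferInstance
  have c1 := comm_cl1 hA hi N G0 hN hG0 hnil hnear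
  have c2 : ∀ x ∈ G0, ∀ y ∈ N ⊓ G0, ρ x * ρ y = ρ y * ρ x := by
    intro x hx y hy
    obtain ⟨R, _, _, i, hinj, hr, hn, -, hred, -⟩ := red_sub hA hi (N ⊓ G0) hN1 c1
    refine comm_of_roots hA i hinj x (hnear x hx) (ρ y) fun n => ?_
    have : ρ (x ^ n) * ρ y * ρ (x ^ n)⁻¹ ∈ i.range := by
      rw [hr, ← map_mul, ← map_mul]
      exact Algebra.subset_adjoin ⟨_, hN1.conj_mem y hy (x ^ n), rfl⟩
    exact this
  intro x hx y hy
  have hz0 : ⁅x, y⁆ ∈ G0 := by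
    rw [commutatorElement_def]
    exact mul_mem (mul_mem (mul_mem hx hy) (inv_mem hx)) (inv_mem hy)
  have hz : ⁅x, y⁆ ∈ N ⊓ G0 := ⟨hab x hx y hy, hz0⟩
  exact lemX hA x y (hnear y hy) (c2 x hx _ hz).symm (c2 y hy _ hz).symm (nil0 hA hi _ hN1 c1 _ hz)

/-- the subgroup acting trivially on `A[p²]` -/
lemma exists_G1 (hA : PCtx p A) (ρ : G →* EE p A) : ∃ G1 : Subgroup G, G1.Normal ∧ G1.FiniteIndex ∧ ∀ g ∈ G1, NearOne (ρ g) := by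
  have : Finite {a : A | p ^ 2 • a = 0} := fin_pow hA 2
  let act : G →* Equiv.Perm {a : A | p ^ 2 • a = 0} :=
    MonoidHom.toHomPerm
    { toFun := fun g a => ⟨ρ g a, by
        change p ^ 2 • ρ g a.1 = 0
        rw [← map_nsmul, show p ^ 2 • a.1 = 0 from a.2, map_zero]⟩
      map_one' := by funext a; apply Subtype.ext; change ρ 1 a.1 = a.1; simp
      map_mul' := fun g h => by funext a; apply Subtype.ext; change ρ (g * h) a.1 = ρ g (ρ h a.1); simp }
  refine ⟨act.ker, inferInstance, inferInstance, fun g hg => ?_⟩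
  obtain ⟨e, he⟩ := E_div hA 2 (ρ g - 1) (fun a ha => by
    have h1 : act g = 1 := hg
    have := congrArg (fun s : Equiv.Perm {a : A | p ^ 2 • a = 0} => (s ⟨a, ha⟩).1) h1
    have h2 : ρ g a = a := this
    rw [LinearMap.sub_apply, h2, Module.End.one_apply, sub_self])
  exact ⟨e, by rw [← he]; abel⟩

lemma exists_G0 (hA : PCtx p A) (hi : Irr ρ) (N : Subgroup G) (hN : N.Normal) (hnil : Group.IsNilpotent N)
    (hva : ∃ H : Subgroup (G ⧸ N), H.index ≠ 0 ∧ ∀ x y : H, x * y = y * x) :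
    ∃ G0 : Subgroup G, G0.Normal ∧ G0.FiniteIndex ∧ (∀ g ∈ G0, NearOne (ρ g)) ∧ (∀ x ∈ G0, ∀ y ∈ G0, ⁅x, y⁆ ∈ N) ∧
    ∀ x ∈ G0, ∀ y ∈ G0, ρ x * ρ y = ρ y * ρ x := by
  obtain ⟨G1, hG1, hf1, hnear⟩ := exists_G1 hA ρ
  obtain ⟨B, hBi, hB⟩ := hva
  have : B.FiniteIndex := ⟨hBi⟩
  let G0 := G1 ⊓ B.normalCore.comap (QuotientGroup.mk' N)
  have hG0 : G0.Normal := inferInstance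
  have : (B.normalCore.comap (QuotientGroup.mk' N)).FiniteIndex := ⟨by
    rw [Subgroup.index_comap_of_surjective _ (QuotientGroup.mk'_surjective N)]
    exact Subgroup.FiniteIndex.index_ne_zero⟩
  have hG0f : G0.FiniteIndex := inferInstanceAs (G1 ⊓ B.normalCore.comap (QuotientGroup.mk' N)).FiniteIndex
  have hab : ∀ x ∈ G0, ∀ y ∈ G0, ⁅x, y⁆ ∈ N := by
    intro x hx y hy
    have hx' := B.normalCore_le hx.2
    have hy' := B.normalCore_le hy.2
    have := congrArg Subtype.val (hB ⟨_, hx'⟩ ⟨_, hy'⟩)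
    simp only [Subgroup.coe_mul] at this
    rw [← QuotientGroup.ker_mk' N, MonoidHom.mem_ker, map_commutatorElement, commutatorElement_eq_one_iff_mul_comm]
    exact this
  have hn0 : ∀ g ∈ G0, NearOne (ρ g) := fun g hg => hnear g hg.1
  exact ⟨G0, hG0, inferInstance, hn0, hab, comm_G0 hA hi N G0 hN hG0 hnil hn0 hab⟩

end grp
end CC
end

noncomputable section
namespace CC
open Polynomial

lemma alg_inv {S : Type} [CommRing S] {a b : S} (hab : a * b = 1) (ha : IsAlgebraic ℤ a) : IsAlgebraic ℤ b := by
  obtain ⟨f, hf, h0⟩ := ha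
  let inv : Invertible a := ⟨b, by rw [mul_comm]; exact hab, hab⟩
  refine ⟨f.reverse, by simpa using hf, ?_⟩
  have := (Polynomial.eval₂_reverse_eq_zero_iff (algebraMap ℤ S) a f).2 h0
  exact this

section
variable {p : ℕ} [hpf : Fact p.Prime]

/-- cancel a non-zero-divisor integral over `ℤ_p` to a power of `p` -/
lemma nzd_pow {R : Type} [CommRing R] [Algebra ℤ_[p] R] (s : R) (hs : ∀ y, s * y = 0 → y = 0) :
    ∀ (n : ℕ) (f : Polynomial ℤ_[p]) (hn : f.natDegree ≤ n) (hf : f ≠ 0) (h0 : aeval s f = 0), ∃ (u : R) (v : ℕ), u * s = (p : R) ^ v := by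
  intro n
  induction n with
  | zero =>
    intro f hn hf h0
    rw [Polynomial.eq_C_of_natDegree_le_zero hn] at h0 hf
    have hc : f.coeff 0 ≠ 0 := fun h => hf (by rw [h, C_0])
    rw [aeval_C] at h0
    refine ⟨0, (f.coeff 0).valuation, ?_⟩
    rw [PadicInt.unitCoeff_spec hc, map_mul, map_pow, map_natCast] at h0
    rw [zero_mul]
    have := congrArg (fun t => algebraMap ℤ_[p] R ((PadicInt.unitCoeff hc)⁻¹ : (ℤ_[p])ˣ) * t) h0
    simp only [mul_zero] at this
    rw [← mul_assoc, ← map_mul, Units.inv_mul, map_one, one_mul] at this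
    exact this.symm
  | succ n ih =>
    intro f hn hf h0
    have h1 := Polynomial.divX_mul_X_add f
    have h2 : aeval s f.divX * s + algebraMap ℤ_[p] R (f.coeff 0) = 0 := by
      rw [← h0]; conv_rhs => rw [← h1]
      simp
    by_cases hc : f.coeff 0 = 0
    · rw [hc, map_zero, add_zero, mul_comm] at h2
      refine ih f.divX (by rw [Polynomial.natDegree_divX_eq_natDegree_tsub_one]; omega) ?_ (hs _ h2)
      rintro h
      rw [h, hc] at h1
      exact hf (by rw [← h1]; simp)
    · refine ⟨-(algebraMap ℤ_[p] R ((PadicInt.unitCoeff hc)⁻¹ : (ℤ_[p])ˣ)) * aeval s f.divX, (f.coeff 0).valuation, ?_⟩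
      rw [mul_assoc, eq_neg_of_add_eq_zero_left h2]
      have h5 : (((PadicInt.unitCoeff hc)⁻¹ : (ℤ_[p])ˣ) : ℤ_[p]) * f.coeff 0 = (p : ℤ_[p]) ^ (f.coeff 0).valuation := by
        rw [Units.inv_mul_eq_iff_eq_mul]; exact PadicInt.unitCoeff_spec hc
      rw [neg_mul_neg, ← map_mul, h5, map_pow, map_natCast]
end

section grp
variable {p : ℕ} [hpf : Fact p.Prime] {A : Type} [AddCommGroup A] [Module ℤ_[p] A]
variable {G : Type} [Group G] {ρ : G →* EE p A}

def BP {R : Type} [CommRing R] {Γ : Type} [Group Γ] (t : Γ →* R) (P : Ideal R) : Subgroup Γ where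
  carrier := {x | IsAlgebraic ℤ (Ideal.Quotient.mk P (t x))}
  one_mem' := by
    change IsAlgebraic ℤ _
    rw [map_one, map_one]; exact isAlgebraic_one
  mul_mem' {a b} ha hb := by
    change IsAlgebraic ℤ _
    rw [map_mul, map_mul]; exact alg_mul_comm (mul_comm _ _) ha hb
  inv_mem' {a} ha := by
    refine alg_inv (a := Ideal.Quotient.mk P (t a)) ?_ ha
    rw [← map_mul, ← map_mul, mul_inv_cancel, map_one, map_one]

lemma mem_BP {R : Type} [CommRing R] {Γ : Type} [Group Γ] (t : Γ →* R) (P : Ideal R) (x : Γ) :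
    x ∈ BP t P ↔ ∃ f : ℤ[X], f ≠ 0 ∧ aeval (t x) f ∈ P := by
  change (∃ f : ℤ[X], f ≠ 0 ∧ _) ↔ _
  have : ∀ f : ℤ[X], aeval (Ideal.Quotient.mk P (t x)) f = Ideal.Quotient.mk P (aeval (t x) f) := by
    intro f
    exact Polynomial.aeval_algHom_apply ((Ideal.Quotient.mk P).toIntAlgHom) (t x) f
  simp only [this, Ideal.Quotient.eq_zero_iff_mem]

lemma BP_iso {R : Type} [CommRing R] {Γ : Type} [Group Γ] (t : Γ →* R) (P : Ideal R) (h : (BP t P).FiniteIndex) : BP t P = ⊤ := by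
  rw [eq_top_iff]
  intro x _
  obtain ⟨n, hn, -, hx⟩ := Subgroup.exists_pow_mem_of_index_ne_zero h.index_ne_zero x
  have h1 : IsAlgebraic ℤ (Ideal.Quotient.mk P (t (x ^ n))) := hx
  rw [map_pow, map_pow] at h1
  exact IsAlgebraic.of_pow hn h1

lemma exists_q (hA : PCtx p A) (hi : Irr ρ) (G0 : Subgroup G) (hG0 : G0.Normal) (hfi : G0.FiniteIndex)
    (hcomm : ∀ x ∈ G0, ∀ y ∈ G0, ρ x * ρ y = ρ y * ρ x) (g₀ : G) (htr : ¬ IsAlgebraic ℤ (ρ g₀)) :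
    ∃ q ∈ G0, ∀ h : ℤ[X], h ≠ 0 → ∃ (u : EE p A) (v : ℕ), u * aeval (ρ q) h = p ^ v • 1 ∧ ∀ x ∈ G0, u * ρ x = ρ x * u := by
  classical
  obtain ⟨R, _, _, i, hinj, hr, hnoe, hfin, hred, hc⟩ := red_sub hA hi G0 hG0 hcomm
  have ht : ∀ x : G0, ∃ r, i r = ρ x := by
    intro x
    have : ρ x ∈ i.range := by rw [hr]; exact Algebra.subset_adjoin ⟨x, x.2, rfl⟩
    exact this
  choose t0 ht0 using ht
  let t : G0 →* R :=
    { toFun := t0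
      map_one' := hinj (by rw [ht0, map_one]; simp)
      map_mul' := fun x y => hinj (by rw [map_mul, ht0, ht0, ht0, ← map_mul]; rfl) }
  have hti : ∀ x : G0, i (t x) = ρ x := ht0
  have hval : ∀ (x : G0) (f : ℤ[X]), i (aeval (t x) f) = aeval (ρ x) f := by
    intro x f
    rw [← hti]
    exact (Polynomial.aeval_algHom_apply (i.toRingHom.toIntAlgHom) (t x) f).symm
  have hmf := minimalPrimes.finite_of_isNoetherianRing R
  have hall : ∀ r : R, (∀ P ∈ minimalPrimes R, r ∈ P) → r = 0 := by
    intro r hr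
    have : r ∈ sInf (minimalPrimes R) := Ideal.mem_sInf.2 (fun {P} hP => hr P hP)
    have h2 : sInf (minimalPrimes R) = (⊥ : Ideal R).radical := Ideal.sInf_minimalPrimes
    rw [h2, show (⊥ : Ideal R).radical = ⊥ from nilradical_eq_bot_iff.2 inferInstance] at this
    exact this
  have hO : ∀ P ∈ minimalPrimes R, BP t P ≠ ⊤ := by
    intro P0 hP0 hB0
    let O : Finset (Ideal R) := hmf.toFinset.filter (fun P => BP t P = ⊤)
    let O' : Finset (Ideal R) := hmf.toFinset.filter (fun P => BP t P ≠ ⊤)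
    let J : Set R := {r | ∀ P ∈ minimalPrimes R, BP t P = ⊤ → r ∈ P}
    have hJ : ∀ g, ∀ j ∈ (i '' J), ρ g⁻¹ * j * ρ g ∈ i '' J := by
      rintro g _ ⟨r, hr, rfl⟩
      choose σ hσ using hc g
      choose τ hτ using hc g⁻¹
      have hστ : ∀ r, σ (τ r) = r := by
        intro r; apply hinj; rw [hσ, hτ, inv_inv]
        simp only [mul_assoc]; rw [ρ_inv_mul, mul_one, ← mul_assoc, ρ_inv_mul, one_mul]
      have hτσ : ∀ r, τ (σ r) = r := by
        intro r; apply hinj; rw [hτ, hσ, inv_inv]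
        simp only [mul_assoc]; rw [ρ_mul_inv, mul_one, ← mul_assoc, ρ_mul_inv, one_mul]
      let s : R ≃+* R :=
        { toFun := σ
          invFun := τ
          left_inv := hτσ
          right_inv := hστ
          map_mul' := fun a b => hinj (by
            rw [map_mul, hσ, hσ, hσ, map_mul]; simp only [mul_assoc]
            rw [← mul_assoc (ρ g) (ρ g⁻¹), ρ_mul_inv, one_mul])
          map_add' := fun a b => hinj (by rw [map_add, hσ, hσ, hσ, map_add, mul_add, add_mul]) }
      refine ⟨σ r, ?_, hσ r⟩
      intro P hP hBP
      have hPp : P.IsPrime := hP.1.1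
      have : r ∈ P.comap s := by
        refine hr _ ?_ ?_
        · refine ⟨⟨inferInstance, bot_le⟩, ?_⟩
          rintro Q ⟨hQ, -⟩ hQP
          have hQ' : (Q.comap s.symm).IsPrime := inferInstance
          have h1 : P ≤ Q.comap s.symm := hP.2 ⟨hQ', bot_le⟩ (by
            intro y hy
            have h3 := hQP hy
            have h4 : s (s.symm y) ∈ P := h3
            rwa [s.apply_symm_apply] at h4)
          intro y hy
          have h3 : s.symm (s y) ∈ Q := h1 hy
          rwa [s.symm_apply_apply] at h3
        · rw [eq_top_iff]
          intro x _
          have h1 : (⟨g⁻¹ * x * g, by simpa using hG0.conj_mem x x.2 g⁻¹⟩ : G0) ∈ BP t P := by rw [hBP]; trivial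
          rw [mem_BP] at h1 ⊢
          obtain ⟨f, hf, hfP⟩ := h1
          refine ⟨f, hf, ?_⟩
          change s (aeval (t x) f) ∈ P
          have h2 : s (aeval (t x) f) = aeval (s (t x)) f :=
            (Polynomial.aeval_algHom_apply (s.toRingHom.toIntAlgHom) (t x) f).symm
          have h3 : s (t x) = t ⟨g⁻¹ * x * g, by simpa using hG0.conj_mem x x.2 g⁻¹⟩ := by
            apply hinj
            rw [hti]
            change i (σ (t x)) = _
            rw [hσ, hti, ← map_mul, ← map_mul]
          rw [h2, h3]; exact hfP
      exact this
    have dich : ∀ x : R, (∀ P ∈ minimalPrimes R, BP t P ≠ ⊤ → x ∈ P) → i x = 0 ∨ ∀ j ∈ i '' J, j = 0 := by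
      intro x hx
      refine ann_dich hA hi (i '' J) hJ (i x) ?_
      rintro _ ⟨j, hj, rfl⟩
      rw [← map_mul, hall (j * x) ?_, map_zero]
      intro P hP
      by_cases h : BP t P = ⊤
      · exact P.mul_mem_right _ (hj P hP h)
      · exact P.mul_mem_left _ (hx P hP h)
    by_cases hJ0 : ∀ j ∈ i '' J, j = 0
    · -- everything is algebraic
      apply htr
      obtain ⟨n, hn, -, hx⟩ := Subgroup.exists_pow_mem_of_index_ne_zero hfi.index_ne_zero g₀
      refine IsAlgebraic.of_pow hn ?_
      rw [← map_pow]
      have hex : ∀ P : O, ∃ f : ℤ[X], f ≠ 0 ∧ aeval (t ⟨_, hx⟩) f ∈ P.1 := by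
        intro P
        rw [← mem_BP]
        have := (Finset.mem_filter.1 P.2).2
        rw [this]; trivial
      choose f hf hfP using hex
      refine ⟨∏ P : O, f P, Finset.prod_ne_zero_iff.2 (fun P _ => hf P), ?_⟩
      have := hval ⟨_, hx⟩ (∏ P : O, f P)
      rw [← this]
      refine hJ0 _ ⟨_, ?_, rfl⟩
      intro P hP hBP
      have hPO : P ∈ O := Finset.mem_filter.2 ⟨hmf.mem_toFinset.2 hP, hBP⟩
      rw [map_prod, ← Finset.mul_prod_erase _ _ (Finset.mem_univ (⟨P, hPO⟩ : O))]
      exact P.mul_mem_right _ (hfP ⟨P, hPO⟩)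
    · have hP0p : P0.IsPrime := hP0.1.1
      have hle : O'.inf id ≤ P0 := by
        intro x hx
        have : i x = 0 := (dich x (fun P hP hB => by
          have : O'.inf id ≤ P := Finset.inf_le (f := id) (Finset.mem_filter.2 ⟨hmf.mem_toFinset.2 hP, hB⟩)
          exact this hx)).resolve_right hJ0
        have : x = 0 := hinj (by rw [this, map_zero])
        rw [this]; exact P0.zero_mem
      obtain ⟨P, hP, hPP⟩ := (hP0p.inf_le').1 hle
      obtain ⟨h1, h2⟩ := Finset.mem_filter.1 hP
      have h3 := hmf.mem_toFinset.1 h1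
      have : P = P0 := le_antisymm hPP (hP0.2 ⟨h3.1.1, bot_le⟩ hPP)
      exact h2 (this ▸ hB0)
  obtain ⟨q, hq⟩ : ∃ q : G0, ∀ P ∈ minimalPrimes R, q ∉ BP t P := by
    by_contra hcon
    push Not at hcon
    obtain ⟨P, hP, hPf⟩ := Subgroup.exists_finiteIndex_of_leftCoset_cover (H := fun P : Ideal R => BP t P) (g := fun _ => (1 : G0))
      (s := hmf.toFinset) (by
        rw [Set.eq_univ_iff_forall]
        intro x
        obtain ⟨P, hP, hx⟩ := hcon x
        simp only [Set.mem_iUnion]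
        exact ⟨P, hmf.mem_toFinset.2 hP, x, hx, one_mul x⟩)
    exact hO P (hmf.mem_toFinset.1 hP) (BP_iso t P hPf)
  refine ⟨q, q.2, fun h hh => ?_⟩
  obtain ⟨f, hf1, hf0⟩ := E_integral hA (aeval (ρ q) h)
  obtain ⟨u, v, huv⟩ := nzd_pow (p := p) (aeval (t q) h) (by
    intro y hy
    refine hall y fun P hP => ?_
    have hPp : P.IsPrime := hP.1.1
    have : aeval (t q) h * y ∈ P := by rw [hy]; exact P.zero_mem
    refine (hPp.mem_or_mem this).resolve_left fun h1 => hq P hP ?_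
    rw [mem_BP]; exact ⟨h, hh, h1⟩) f.natDegree f le_rfl hf1.ne_zero (hinj (by
      rw [← Polynomial.aeval_algHom_apply, hval, hf0, map_zero]))
  refine ⟨i u, v, ?_, fun x hx => ?_⟩
  · rw [← hval, ← map_mul, huv, map_pow, map_natCast, ← Nat.cast_pow, nsmul_one]
  · rw [← hti ⟨x, hx⟩, ← map_mul, ← map_mul, mul_comm]

end grp
end CC
end

noncomputable section
namespace CC
open Polynomial

def W {H : Type} [Group H] (c : ℕ → H) (f : ℤ[X]) : H :=
  ((List.range (f.natDegree+1)).map fun k => (c k)^(f.coeff k)).prod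

lemma W_map {H H' : Type} [Group H] [Group H'] (π : H →* H') (c : ℕ → H) (f : ℤ[X]) :
    π (W c f) = W (fun k => π (c k)) f := by
  unfold W
  rw [map_list_prod, List.map_map]
  congr 1
  apply List.map_congr_left
  intro k _
  simp

lemma W_eval {H : Type} [Group H] {M : Type} [AddCommGroup M] (φ : Multiplicative M →* H) (β : AddMonoid.End M)
    (m : M) (f : ℤ[X]) :
    W (fun k => φ (Multiplicative.ofAdd ((β^k) m))) f = φ (Multiplicative.ofAdd (aeval β f m)) := by
  rw [← W_map φ (fun k => (Multiplicative.ofAdd ((β^k) m))) f]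
  congr 1
  unfold W
  rw [aeval_eq_sum_range]
  generalize f.natDegree + 1 = d
  induction d with
  | zero => simp
  | succ d ih =>
    rw [List.prod_range_succ, ih, Finset.sum_range_succ]
    rfl

lemma W_C {H : Type} [Group H] (c : ℕ → H) (m : ℤ) : W c (C m) = (c 0)^m := by
  simp [W]

lemma cen_comm {k : Type} [CommRing k] {G M : Type} [Group G] [AddCommGroup M] [Module k M] (ρ : Representation k G M)
    (u : Subalgebra.centralizer k (Set.range ρ)) (x : G) (m : M) : u.1 (ρ x m) = ρ x (u.1 m) := by
  have := (Subalgebra.mem_centralizer_iff k).1 u.2 (ρ x) (Set.mem_range_self x)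
  exact (LinearMap.congr_fun this m).symm

def HRf {k : Type} [CommRing k] {G M : Type} [Group G] [AddCommGroup M] [Module k M] (ρ : Representation k G M) (n : ℕ)
    (u : Subalgebra.centralizer k (Set.range ρ)) : Module.End k (H ρ n) :=
  Hmap (PHom.ofLin (ρA := ρ) (ρB := ρ) u.1 (cen_comm ρ u)) n

lemma HRf_mk {k : Type} [CommRing k] {G M : Type} [Group G] [AddCommGroup M] [Module k M] (ρ : Representation k G M) (n : ℕ)
    (u : Subalgebra.centralizer k (Set.range ρ)) (c) (hc) :
    HRf ρ n u (Hmk ρ n c hc) = Hmk ρ n (cmap (PHom.ofLin (ρA := ρ) (ρB := ρ) u.1 (cen_comm ρ u)) n c) (cmap_cocycle _ hc) := rfl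

def HR {k : Type} [CommRing k] {G M : Type} [Group G] [AddCommGroup M] [Module k M] (ρ : Representation k G M) (n : ℕ) :
    Subalgebra.centralizer k (Set.range ρ) →+* Module.End k (H ρ n) where
  toFun := HRf ρ n
  map_add' u v := by
    apply LinearMap.ext
    intro x
    obtain ⟨c, hc, rfl⟩ := Hmk_surj x
    rw [LinearMap.add_apply, HRf_mk, HRf_mk, HRf_mk]
    rfl
  map_zero' := by
    apply LinearMap.ext
    intro x
    exact Hmap_zero _ rfl n x
  map_one' := by
    apply LinearMap.ext
    intro x
    exact Hmap_id n x
  map_mul' u v := by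
    apply LinearMap.ext
    intro x
    rw [Module.End.mul_apply]
    unfold HRf
    rw [← Hmap_comp]
    rfl

lemma HR_apply {k : Type} [CommRing k] {G M : Type} [Group G] [AddCommGroup M] [Module k M] (ρ : Representation k G M) (n : ℕ)
    (u : Subalgebra.centralizer k (Set.range ρ)) (hu) : HR ρ n u = Hmap (PHom.ofLin (ρA := ρ) (ρB := ρ) u.1 hu) n := rfl

lemma HR_alg {k : Type} [CommRing k] {G M : Type} [Group G] [AddCommGroup M] [Module k M] (ρ : Representation k G M) (n : ℕ)
    (u : Subalgebra.centralizer k (Set.range ρ)) (hu : IsAlgebraic ℤ u.1) : IsAlgebraic ℤ (HR ρ n u) := by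
  obtain ⟨f, hf, h⟩ := hu
  refine ⟨f, hf, ?_⟩
  have h1 : aeval u f = 0 := by
    apply Subtype.ext
    have := (aeval_algHom_apply ((Subalgebra.centralizer k (Set.range ρ)).val.toRingHom.toIntAlgHom) u f)
    exact this.symm.trans h
  have := (aeval_algHom_apply ((HR ρ n).toIntAlgHom) u f)
  rw [h1, map_zero] at this
  exact this

lemma alg_grp {k : Type} [CommRing k] {Z M : Type} [Group Z] (hZ : ∀ a b : Z, a * b = b * a) [AddCommGroup M] [Module k M] (ρ : Representation k Z M)
    (c : PHom ρ ρ) (hc : c.lin = LinearMap.id) (hρ : ∀ g, ρ g = 1) (f : ℤ[X]) (hf : f ≠ 0) (hW : ∀ z, W (fun k => c.grp^[k] z) f = 1)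
    (j : ℕ) : IsAlgebraic ℤ (Hmap c j : Module.End k (H ρ j)) := by
  letI : CommGroup Z := { (inferInstance : Group Z) with mul_comm := hZ }
  let β : AddMonoid.End (Additive Z) := MonoidHom.toAdditive c.grp
  have hβ : IsAlgebraic ℤ β := by
    refine ⟨f, hf, ?_⟩
    ext z
    have h1 := W_eval (H := Z) (M := Additive Z) (MonoidHom.id Z) β z f
    have h2 : ∀ k, (β ^ k) z = Additive.ofMul (c.grp^[k] z.toMul) := by
      intro k
      induction k with
      | zero => rfl
      | succ k ih => 
        rw [pow_succ', Function.iterate_succ_apply']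
        change β ((β ^ k) z) = _
        rw [ih]; rfl
    have h3 := hW z.toMul
    have h4 : (fun k => (MonoidHom.id Z) (Multiplicative.ofAdd ((β^k) z))) = fun k => c.grp^[k] z.toMul := by
      funext k; rw [h2]; rfl
    have h5 := (congrArg (fun s => W s f) h4).symm.trans h1
    exact (h3.symm.trans h5).symm
  have := FF_alg ρ hρ j β hβ
  have e : FF ρ hρ j β = Hmap c j := by
    unfold FF
    congr 1
    apply PHom.ext'
    · intro g; rfl
    · intro m; rw [hc]; rfl
  rw [e] at this
  exact this

end CC
end

noncomputable section
namespace CC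
open Polynomial

structure Step {G : Type} [Group G] (q : G) (K S S' : Subgroup G) : Prop where
  nS : S.Normal
  nS' : S'.Normal
  le : S ≤ S'
  leK : S' ≤ K
  comm : ∀ k ∈ K, ∀ s ∈ S', k * s * k⁻¹ * s⁻¹ ∈ S
  alg : ∃ f : ℤ[X], f ≠ 0 ∧ ∀ z ∈ S', W (fun i => q^i * z * (q^i)⁻¹) f ∈ S

def PT {k : Type} [CommRing k] (t : k) (X : Type) [AddCommGroup X] [Module k X] : Prop :=
  ∃ f : ℤ[X], f ≠ 0 ∧ ∀ x : X, (aeval t f) • x = 0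

lemma PT_serre {k : Type} [CommRing k] (t : k) : IsSerre (k := k) (fun X => PT t X) where
  zero := ⟨1, one_ne_zero, fun x => rfl⟩
  mid := by
    intro X Y Z _ _ _ _ _ _ f g e hX hZ
    obtain ⟨a, ha, hx⟩ := hX
    obtain ⟨b, hb, hz⟩ := hZ
    refine ⟨a * b, mul_ne_zero ha hb, fun y => ?_⟩
    have h1 : g ((aeval t b) • y) = 0 := by rw [map_smul, hz]
    obtain ⟨x, hxy⟩ := (e _).1 h1
    rw [map_mul, mul_smul, ← hxy, ← map_smul, hx, map_zero]

theorem claim {k : Type} [CommRing k] (t : k) {G : Type} [Group G] (q : G) (K S : Subgroup G)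
    (hK : ∀ x y : G, x * y * x⁻¹ * y⁻¹ ∈ K)
    (h : Relation.ReflTransGen (Step q K) S K) :
    ∀ (Γ : Type) [Group Γ] (π : G →* Γ) (hπ : Function.Surjective π) (hker : π.ker = S)
     (M : Type) [AddCommGroup M] [Module k M] (ρ : Representation k Γ M) (hρ : ∀ x ∈ K, ρ (π x) = 1)
     (hu : IsAlgebraic ℤ (t • ρ (π q⁻¹) : Module.End k M)) (n : ℕ), PT t (H ρ n) := by
  induction h using Relation.ReflTransGen.head_induction_on with
  | refl =>
    intro Γ _ π hπ hker M _ _ ρ hρ hu n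
    have hc : ∀ a b : Γ, a * b = b * a := by
      intro a b
      obtain ⟨a, rfl⟩ := hπ a
      obtain ⟨b, rfl⟩ := hπ b
      have h1 : a * b * a⁻¹ * b⁻¹ ∈ π.ker := by rw [hker]; exact hK a b
      rw [MonoidHom.mem_ker, map_mul, map_mul, map_mul, map_inv, map_inv, mul_inv_eq_one, mul_inv_eq_iff_eq_mul] at h1
      exact h1
    have hcen : ∀ γ, ρ γ ∈ Subalgebra.centralizer k (Set.range ρ) := by
      intro γ
      rw [Subalgebra.mem_centralizer_iff]
      rintro _ ⟨x, rfl⟩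
      rw [← map_mul, ← map_mul, hc]
    let u : Subalgebra.centralizer k (Set.range ρ) := t • ⟨ρ (π q⁻¹), hcen _⟩
    obtain ⟨f, hf, h0⟩ := HR_alg ρ n u hu
    refine ⟨f, hf, fun x => ?_⟩
    have e : HR ρ n u = algebraMap k (Module.End k (H ρ n)) t := by
      apply LinearMap.ext
      intro x
      rw [Module.algebraMap_end_apply]
      conv_rhs => rw [← Hmap_inner n ρ (π q⁻¹) x]
      obtain ⟨c, hc1, rfl⟩ := Hmk_surj x
      rw [Hmap_mk, Hmk_smul]
      refine (HRf_mk ρ n u c hc1).trans ?_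
      apply Hmk_congr
      funext g
      have : ∀ γ, (inner ρ (π q⁻¹)).grp γ = γ := by
        intro γ
        change (MulAut.conj (π q⁻¹)⁻¹) γ = γ
        rw [MulAut.conj_apply, hc, inv_inv, ← mul_assoc, mul_inv_cancel, one_mul]
      rw [Pi.smul_apply, cmap_apply, cmap_apply]
      have h2 : (fun i => (inner ρ (π q⁻¹)).grp (g i)) = g := by funext i; exact this _
      first | rw [h2] | (rw [show (⇑(inner ρ (π q⁻¹)).grp ∘ g) = g from h2])
      rfl
    have e2 := aeval_algHom_apply (algebraMap k (Module.End k (H ρ n))).toIntAlgHom t f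
    rw [e] at h0
    have e3 : algebraMap k (Module.End k (H ρ n)) (aeval t f) = 0 := e2.symm.trans h0
    have := LinearMap.congr_fun e3 x
    rwa [Module.algebraMap_end_apply] at this
  | head hst hch ih =>
    rename_i S S'
    intro Γ _ π hπ hker M _ _ ρ hρ hu n
    have hn' := hst.nS'
    let Z : Subgroup Γ := S'.map π
    haveI hZ : Z.Normal := Subgroup.Normal.map hn' π hπ
    let π' := QuotientGroup.mk' Z
    have hπ' : Function.Surjective π' := QuotientGroup.mk'_surjective Z
    have hk' : π'.ker = Z := QuotientGroup.ker_mk' Z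
    have hkz : ∀ z : π'.ker, ∃ s ∈ S', π s = z := by
      intro z
      have : (z : Γ) ∈ Z := hk'.le z.2
      exact this
    have hkc : ∀ x ∈ K, ∀ s ∈ S', π x * π s = π s * π x := by
      intro x hx s hs
      have h1 : x * s * x⁻¹ * s⁻¹ ∈ π.ker := by rw [hker]; exact hst.comm x hx s hs
      rw [MonoidHom.mem_ker, map_mul, map_mul, map_mul, map_inv, map_inv, mul_inv_eq_one, mul_inv_eq_iff_eq_mul] at h1
      exact h1
    have hab : ∀ a b : π'.ker, a * b = b * a := by
      intro a b
      obtain ⟨x, hx, h1⟩ := hkz a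
      obtain ⟨y, hy, h2⟩ := hkz b
      apply Subtype.ext
      rw [Subgroup.coe_mul, Subgroup.coe_mul, ← h1, ← h2]
      exact hkc x (hst.leK hx) y hy
    have htriv : ∀ g, res π'.ker ρ g = 1 := by
      intro g
      obtain ⟨x, hx, h1⟩ := hkz g
      change ρ (g : Γ) = 1
      rw [← h1]
      exact hρ x (hst.leK hx)
    refine lhs π' hπ' (PT_serre t) n ρ ?_
    intro i j _
    refine ih (Γ ⧸ Z) (π'.comp π) (hπ'.comp hπ) ?_ _ (hrep π' hπ' ρ j) ?_ ?_ i
    · rw [← MonoidHom.comap_ker, hk']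
      change (S'.map π).comap π = S'
      rw [Subgroup.comap_map_eq, hker]
      exact sup_eq_left.2 hst.le
    · intro x hx
      apply LinearMap.ext
      intro y
      rw [MonoidHom.comp_apply, hrep_apply]
      have : cjP π' ρ (π x) = PHom.id _ := by
        apply PHom.ext'
        · intro g
          apply Subtype.ext
          obtain ⟨s, hs, h1⟩ := hkz g
          refine (cjK_coe π' (π x) g).trans ?_
          change _ = (g : Γ)
          rw [← h1, mul_assoc, ← hkc x hx s hs, inv_mul_cancel_left]
        · intro m
          change ρ (π x) m = m
          rw [hρ x hx]; rfl
      rw [this, Hmap_id]; rfl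
    · obtain ⟨f, hf, hW⟩ := hst.alg
      have hcompat : ∀ g m, (LinearMap.id : M →ₗ[k] M) (res π'.ker ρ (cjK π' (π q⁻¹) g) m) = res π'.ker ρ g ((LinearMap.id : M →ₗ[k] M) m) := by
        intro g m
        rw [htriv, htriv]; rfl
      let c : PHom (res π'.ker ρ) (res π'.ker ρ) := ⟨cjK π' (π q⁻¹), LinearMap.id, hcompat⟩
      have h1 : IsAlgebraic ℤ (Hmap c j : Module.End k (H (res π'.ker ρ) j)) := by
        refine alg_grp hab _ c rfl htriv f hf ?_ j
        intro z
        obtain ⟨s, hs, hz⟩ := hkz z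
        apply Subtype.ext
        have e1 := W_map π'.ker.subtype (fun k => c.grp^[k] z) f
        have e2 := W_map π (fun i => q^i * s * (q^i)⁻¹) f
        have e3 : ∀ i : ℕ, π'.ker.subtype (c.grp^[i] z) = π (q^i * s * (q^i)⁻¹) := by
          intro i
          induction i with
          | zero => simp [hz]
          | succ i ih2 =>
            rw [Function.iterate_succ_apply']
            refine (cjK_coe π' (π q⁻¹) _).trans ?_
            have : ((c.grp^[i] z : π'.ker) : Γ) = π (q^i * s * (q^i)⁻¹) := ih2
            rw [this, ← map_inv, ← map_mul, ← map_mul]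
            congr 1
            rw [pow_succ']
            group
        have e4 : (fun i => π'.ker.subtype (c.grp^[i] z)) = fun i => π (q^i * s * (q^i)⁻¹) := funext e3
        refine e1.trans ((congrArg (fun s => W s f) e4).trans (e2.symm.trans ?_))
        have : W (fun i => q^i * s * (q^i)⁻¹) f ∈ π.ker := by rw [hker]; exact hW s hs
        exact this
      have hcen : ∀ v : Module.End k M, v ∈ Subalgebra.centralizer k (Set.range (res π'.ker ρ)) := by
        intro v
        rw [Subalgebra.mem_centralizer_iff]
        rintro _ ⟨x, rfl⟩
        rw [htriv, one_mul, mul_one]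
      let u : Subalgebra.centralizer k (Set.range (res π'.ker ρ)) := t • ⟨ρ (π q⁻¹), hcen _⟩
      have h2 := HR_alg (res π'.ker ρ) j u hu
      have e1 : (t • hrep π' hπ' ρ j ((π'.comp π) q⁻¹) : Module.End k _) = HR (res π'.ker ρ) j u * Hmap c j := by
        apply LinearMap.ext
        intro y
        rw [LinearMap.smul_apply, MonoidHom.comp_apply, hrep_apply]
        obtain ⟨d, hd, rfl⟩ := Hmk_surj y
        rw [Module.End.mul_apply, Hmap_mk, Hmap_mk, Hmk_smul]
        refine Eq.trans ?_ (HRf_mk _ j u _ _).symm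
        rfl
      have e2 : HR (res π'.ker ρ) j u * Hmap c j = Hmap c j * HR (res π'.ker ρ) j u := by
        apply LinearMap.ext
        intro y
        obtain ⟨d, hd, rfl⟩ := Hmk_surj y
        rw [Module.End.mul_apply, Module.End.mul_apply, Hmap_mk]
        refine (HRf_mk _ j u _ _).trans ?_
        refine Eq.trans ?_ (congrArg (Hmap c j) (HRf_mk _ j u _ _)).symm
        rfl
      rw [e1]
      exact alg_mul_comm e2 h2 h1

end CC
end

noncomputable section
namespace CC
open Polynomial

def RB (X : Type) [AddCommGroup X] : Prop :=
  ∃ n : ℕ, ∀ k : ℕ, (∃ f : (Fin k →₀ ℤ) →+ X, Function.Injective f) → k ≤ n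

lemma RF {X : Type} [AddCommGroup X] (htf : ∀ m : X, m ≠ 0 → ¬ IsOfFinAddOrder m) (hr : RB X)
    (β : AddMonoid.End X) : IsAlgebraic ℤ β := by
  classical
  obtain ⟨n, hn⟩ := hr
  have hb : ∀ k (v : Fin k → X), LinearIndependent ℤ v → k ≤ n := fun k v hv =>
    hn k ⟨(Finsupp.linearCombination ℤ v).toAddMonoidHom, hv⟩
  let k := Nat.findGreatest (fun k => ∃ v : Fin k → X, LinearIndependent ℤ v) n
  have hk : ∃ v : Fin k → X, LinearIndependent ℤ v :=
    Nat.findGreatest_spec (P := fun k => ∃ v : Fin k → X, LinearIndependent ℤ v) (m := 0) (Nat.zero_le n) ⟨Fin.elim0, linearIndependent_empty_type⟩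
  have hk2 : ∀ v : Fin (k+1) → X, ¬ LinearIndependent ℤ v := by
    intro v hv
    have h1 := Nat.le_findGreatest (P := fun k => ∃ v : Fin k → X, LinearIndependent ℤ v) (hb _ v hv) ⟨v, hv⟩
    have : k + 1 ≤ k := h1
    omega
  have tf : ∀ (r : ℤ) (x : X), r ≠ 0 → r • x = 0 → x = 0 := by
    intro r x hr0 hx
    by_contra hne
    apply htf x hne
    rw [isOfFinAddOrder_iff_zsmul_eq_zero]
    exact ⟨r, hr0, hx⟩
  have ev : ∀ (f : ℤ[X]) (x : X), aeval β f x = ∑ i ∈ Finset.range (f.natDegree+1), f.coeff i • (β^i) x := by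
    intro f x
    rw [aeval_eq_sum_range]
    generalize Finset.range (f.natDegree+1) = s
    induction s using Finset.induction_on with
    | empty => simp
    | insert a s ha ih =>
      rw [Finset.sum_insert ha, Finset.sum_insert ha, ← ih]; rfl
  have hx : ∀ x : X, ∃ f : ℤ[X], f ≠ 0 ∧ aeval β f x = 0 := by
    intro x
    obtain ⟨g, hg, i, hi⟩ := Fintype.not_linearIndependent_iff.1 (hk2 (fun j => (β^(j:ℕ)) x))
    refine ⟨∑ j, C (g j) * Polynomial.X^(j:ℕ), ?_, ?_⟩
    · intro h0
      apply hi
      have := congrArg (fun f => coeff f (i:ℕ)) h0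
      simp only [finset_sum_coeff, coeff_C_mul, coeff_X_pow, coeff_zero] at this
      rw [Finset.sum_eq_single i] at this
      · simpa using this
      · intro b _ hb2
        have : ((i:ℕ) = (b:ℕ)) = False := by
          simp only [eq_iff_iff, iff_false]
          intro h; exact hb2 (Fin.ext h.symm)
        simp [this]
      · simp
    · rw [← hg, map_sum]
      have : ∀ s : Finset (Fin (k+1)), (∑ j ∈ s, aeval β (C (g j) * Polynomial.X^(j:ℕ))) x = ∑ j ∈ s, g j • (β^(j:ℕ)) x := by
        intro s
        induction s using Finset.induction_on with
        | empty => simp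
        | insert a s ha ih =>
          rw [Finset.sum_insert ha, Finset.sum_insert ha, ← ih, map_mul, aeval_C, map_pow, aeval_X]
          change (algebraMap ℤ (AddMonoid.End X) (g a) * β^(a:ℕ)) x + _ = _
          congr 1
      exact this _
  choose F hF0 hF using hx
  obtain ⟨v, hv⟩ := hk
  refine ⟨∏ i, F (v i), Finset.prod_ne_zero_iff.2 fun i _ => hF0 _, ?_⟩
  have hvi : ∀ i, aeval β (∏ i, F (v i)) (v i) = 0 := by
    intro i
    rw [← Finset.prod_erase_mul _ _ (Finset.mem_univ i), map_mul]
    change (aeval β _) ((aeval β (F (v i))) (v i)) = 0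
    rw [hF, map_zero]
  ext x
  obtain ⟨g, hg, i, hi⟩ := Fintype.not_linearIndependent_iff.1 (hk2 (Fin.cons x v))
  rw [Fin.sum_univ_succ] at hg
  simp only [Fin.cons_zero, Fin.cons_succ] at hg
  have h0 : g 0 ≠ 0 := by
    intro h0
    rw [h0, zero_smul, zero_add] at hg
    have h1 := Fintype.linearIndependent_iff.1 hv (fun i => g i.succ) hg
    apply hi
    refine Fin.cases h0 h1 i
  apply tf (g 0) _ h0
  have := congrArg (aeval β (∏ i, F (v i))) hg
  rw [map_add, map_sum, map_zsmul, map_zero] at this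
  simp only [map_zsmul, hvi, smul_zero, Finset.sum_const_zero, add_zero] at this
  exact this

end CC
end

noncomputable section
namespace CC
open Polynomial

def RBm (X : Type) [Group X] : Prop :=
  ∃ n : ℕ, ∀ k : ℕ, (∃ f : Multiplicative (Fin k →₀ ℤ) →* X, Function.Injective f) → k ≤ n

lemma RFm {X : Type} [Group X] (hc : ∀ a b : X, a * b = b * a) (htf : ∀ (x : X) (n : ℕ), n ≠ 0 → x ^ n = 1 → x = 1)
    (hr : RBm X) (c : X →* X) : ∃ f : ℤ[X], f ≠ 0 ∧ ∀ z, W (fun i => c^[i] z) f = 1 := by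
  letI : CommGroup X := { (inferInstance : Group X) with mul_comm := hc }
  let β : AddMonoid.End (Additive X) := MonoidHom.toAdditive c
  have h1 : IsAlgebraic ℤ β := by
    apply RF
    · intro m hm h
      rw [isOfFinAddOrder_iff_nsmul_eq_zero] at h
      obtain ⟨n, hn, h⟩ := h
      exact hm (htf m.toMul n (by omega) h)
    · obtain ⟨n, hn⟩ := hr
      refine ⟨n, fun k ⟨f, hf⟩ => hn k ⟨AddMonoidHom.toMultiplicative f, ?_⟩⟩
      intro a b hab
      exact hf hab
  obtain ⟨f, hf, h0⟩ := h1
  refine ⟨f, hf, fun z => ?_⟩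
  have h1 := W_eval (H := X) (M := Additive X) (MonoidHom.id X) β z f
  have h2 : ∀ k, (β ^ k) z = Additive.ofMul (c^[k] z) := by
    intro k
    induction k with
    | zero => rfl
    | succ k ih =>
      rw [pow_succ', Function.iterate_succ_apply']
      change β ((β ^ k) z) = _
      rw [ih]; rfl
  have h4 : (fun k => (MonoidHom.id X) (Multiplicative.ofAdd ((β^k) z))) = fun k => c^[k] z := by
    funext k; rw [h2]; rfl
  have h5 := (congrArg (fun s => W s f) h4).symm.trans h1
  refine h5.trans ?_
  rw [h0]; rfl

/-- second-centre type construction relative to `U` -/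
def up {Γ : Type} [Group Γ] (K U : Subgroup Γ) (hU : U.Normal) : Subgroup Γ where
  carrier := {x | x ∈ K ∧ ∀ y ∈ K, y * x * y⁻¹ * x⁻¹ ∈ U}
  one_mem' := ⟨one_mem _, fun y _ => by simpa using one_mem U⟩
  mul_mem' := by
    rintro a b ⟨ha, ha'⟩ ⟨hb, hb'⟩
    refine ⟨mul_mem ha hb, fun y hy => ?_⟩
    have := mul_mem (ha' y hy) (hU.conj_mem _ (hb' y hy) a)
    convert this using 1
    group
  inv_mem' := by
    rintro a ⟨ha, ha'⟩
    refine ⟨inv_mem ha, fun y hy => ?_⟩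
    have := hU.conj_mem _ (inv_mem (ha' y hy)) a⁻¹
    convert this using 1
    group

lemma up_normal {Γ : Type} [Group Γ] (K U : Subgroup Γ) (hK : K.Normal) (hU : U.Normal) : (up K U hU).Normal := by
  constructor
  rintro x ⟨hx, hx'⟩ g
  refine ⟨hK.conj_mem _ hx g, fun y hy => ?_⟩
  have h1 := hK.conj_mem _ hy g⁻¹
  have := hU.conj_mem _ (hx' _ h1) g
  convert this using 1
  group

def Tf {Γ : Type} [Group Γ] (K U : Subgroup Γ) (hU : U.Normal) : Prop :=
  ∀ x ∈ up K U hU, ∀ n : ℕ, n ≠ 0 → x ^ n ∈ U → x ∈ U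

lemma Tf_up {Γ : Type} [Group Γ] (K U : Subgroup Γ) (hK : K.Normal) (hU : U.Normal) (h : Tf K U hU) :
    Tf K (up K U hU) (up_normal K U hK hU) := by
  rintro x ⟨hx, hx'⟩ n hn hxn
  refine ⟨hx, fun y hy => ?_⟩
  refine h _ (hx' y hy) n hn ?_
  have h2 := hxn.2 y hy
  haveI := hU
  have key : ∀ m : ℕ, ((y * x * y⁻¹ * x⁻¹ : Γ) : Γ ⧸ U) ^ m = ((y * x^m * y⁻¹ * (x^m)⁻¹ : Γ) : Γ ⧸ U) := by
    intro m
    have hcen : ∀ g ∈ K, ((y * x * y⁻¹ * x⁻¹ : Γ) : Γ ⧸ U) * (g : Γ ⧸ U) = (g : Γ ⧸ U) * ((y * x * y⁻¹ * x⁻¹ : Γ) : Γ ⧸ U) := by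
      intro g hg
      have h3 := (hx' y hy).2 g hg
      rw [← QuotientGroup.eq_one_iff] at h3
      simp only [QuotientGroup.mk_mul, QuotientGroup.mk_inv] at h3 ⊢
      rw [mul_inv_eq_one, mul_inv_eq_iff_eq_mul] at h3
      exact h3.symm
    induction m with
    | zero => simp
    | succ m ih =>
      rw [pow_succ', ih]
      have e : (y * x^(m+1) * y⁻¹ * (x^(m+1))⁻¹ : Γ) = (y * x^m * y⁻¹ * (x^m)⁻¹) * (x^m * (y * x * y⁻¹ * x⁻¹) * (x^m)⁻¹) := by
        rw [pow_succ]; group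
      rw [e]
      have h4 := hcen (x^m) (pow_mem hx m)
      have h5 : ((x^m * (y * x * y⁻¹ * x⁻¹) * (x^m)⁻¹ : Γ) : Γ ⧸ U) = ((y * x * y⁻¹ * x⁻¹ : Γ) : Γ ⧸ U) := by
        rw [QuotientGroup.mk_mul, QuotientGroup.mk_mul, ← h4, QuotientGroup.mk_inv, mul_inv_cancel_right]
      rw [QuotientGroup.mk_mul (N := U) (y * x^m * y⁻¹ * (x^m)⁻¹), h5]
      have h6 : (y * x^m * y⁻¹ * (x^m)⁻¹) ∈ K := mul_mem (hK.conj_mem _ (pow_mem hx m) y) (inv_mem (pow_mem hx m))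
      exact hcen _ h6
  rw [← QuotientGroup.eq_one_iff, QuotientGroup.mk_pow, key, QuotientGroup.eq_one_iff]
  exact h2

def FRS (Γ : Type) [Group Γ] : Prop := ∀ (L : Subgroup Γ) (X : Type) [Group X] (f : L →* X), Function.Surjective f →
  (∀ a b : X, a * b = b * a) → RBm X

lemma step_up {Γ : Type} [Group Γ] (hfr : FRS Γ) (q : Γ) (K U : Subgroup Γ) (hK : K.Normal) (hU : U.Normal) (hUK : U ≤ K) (h : Tf K U hU) :
    Step q K U (up K U hU) where
  nS := hU
  nS' := up_normal K U hK hU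
  le := by
    intro x hx
    exact ⟨hUK hx, fun y hy => mul_mem (hU.conj_mem _ hx y) (inv_mem hx)⟩
  leK := fun x hx => hx.1
  comm := fun k hk s hs => hs.2 k hk
  alg := by
    haveI := hU
    have hn := up_normal K U hK hU
    let X := (up K U hU).map (QuotientGroup.mk' U)
    haveI : X.Normal := Subgroup.Normal.map hn _ (QuotientGroup.mk'_surjective U)
    let g : up K U hU →* X := ((QuotientGroup.mk' U).comp (up K U hU).subtype).codRestrict X (fun x => ⟨x, x.2, rfl⟩)
    have hg : Function.Surjective g := by
      rintro ⟨_, x, hx, rfl⟩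
      exact ⟨⟨x, hx⟩, rfl⟩
    have hc : ∀ a b : X, a * b = b * a := by
      intro a b
      obtain ⟨a, rfl⟩ := hg a
      obtain ⟨b, rfl⟩ := hg b
      apply Subtype.ext
      have h3 := b.2.2 a a.2.1
      rw [← QuotientGroup.eq_one_iff] at h3
      simp only [QuotientGroup.mk_mul, QuotientGroup.mk_inv] at h3
      rw [mul_inv_eq_one, mul_inv_eq_iff_eq_mul] at h3
      exact h3
    have htf : ∀ (x : X) (n : ℕ), n ≠ 0 → x ^ n = 1 → x = 1 := by
      intro x n hn0 hx
      obtain ⟨x, rfl⟩ := hg x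
      have h1 : ((x : Γ) ^ n) ∈ U := by
        rw [← QuotientGroup.eq_one_iff]
        exact congrArg Subtype.val hx
      apply Subtype.ext
      exact (QuotientGroup.eq_one_iff _).2 (h x x.2 n hn0 h1)
    let c : X →* X := (MulAut.conjNormal (q : Γ ⧸ U) : MulAut X).toMonoidHom
    obtain ⟨f, hf, hW⟩ := RFm hc htf (hfr _ X g hg hc) c
    refine ⟨f, hf, fun z hz => ?_⟩
    have e3 : ∀ i : ℕ, X.subtype (c^[i] (g ⟨z, hz⟩)) = QuotientGroup.mk' U (q^i * z * (q^i)⁻¹) := by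
      intro i
      induction i with
      | zero =>
        rw [pow_zero, one_mul, inv_one, mul_one]; rfl
      | succ i ih =>
        rw [Function.iterate_succ_apply']
        have e : X.subtype (c (c^[i] (g ⟨z, hz⟩))) = (q : Γ ⧸ U) * X.subtype (c^[i] (g ⟨z, hz⟩)) * (q : Γ ⧸ U)⁻¹ := MulAut.conjNormal_apply _ _
        rw [e, ih]
        change ((q * (q^i * z * (q^i)⁻¹) * q⁻¹ : Γ) : Γ ⧸ U) = ((q^(i+1) * z * (q^(i+1))⁻¹ : Γ) : Γ ⧸ U)
        congr 1
        rw [pow_succ']; group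
    have e1 := W_map X.subtype (fun i => c^[i] (g ⟨z, hz⟩)) f
    have e2 := W_map (QuotientGroup.mk' U) (fun i => q^i * z * (q^i)⁻¹) f
    rw [hW] at e1
    rw [← QuotientGroup.eq_one_iff]
    refine e2.trans ?_
    rw [← funext e3, ← e1]
    rfl

lemma U_chain {Γ : Type} [Group Γ] (hfr : FRS Γ) (q : Γ) (K : Subgroup Γ) (hK : K.Normal) (L : ℕ → Subgroup Γ)
    (hL0 : L 0 = K) (hL : ∀ i, ∀ x ∈ L i, ∀ y ∈ K, y * x * y⁻¹ * x⁻¹ ∈ L (i+1)) (j : ℕ) : ∀ (U : Subgroup Γ) (hU : U.Normal),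
    U ≤ K → Tf K U hU → (∀ i, L i ≤ K) → L j ≤ U → Relation.ReflTransGen (Step q K) U K := by
  induction j with
  | zero =>
    intro U hU hUK h _ hj
    rw [hL0] at hj
    rw [le_antisymm hUK hj]
  | succ j ih =>
    intro U hU hUK h hLK hj
    refine Relation.ReflTransGen.head (step_up hfr q K U hK hU hUK h) ?_
    refine ih _ (up_normal K U hK hU) (fun x hx => hx.1) (Tf_up K U hK hU h) hLK ?_
    intro x hx
    exact ⟨hLK j hx, fun y hy => hj (hL j x hx y hy)⟩

end CC
end

noncomputable section
namespace CC
open Polynomial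

lemma FRS_of {G : Type} [Group G] (h : ∀ (H : Subgroup G) (K : Subgroup H) (_ : K.Normal),
      (∀ x y : H ⧸ K, x * y = y * x) → FiniteRankGroup (H ⧸ K)) (L : Subgroup G) (X : Type) [Group X] (f : L →* X)
      (hf : Function.Surjective f) (hc : ∀ a b : X, a * b = b * a) : FiniteRankGroup X := by
  let e : L ⧸ f.ker ≃* X := QuotientGroup.quotientKerEquivOfSurjective f hf
  have h1 := h L f.ker inferInstance (fun x y => e.injective (by rw [map_mul, map_mul, hc]))
  obtain ⟨⟨n, hn⟩, h2⟩ := h1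
  refine ⟨⟨n, fun k ⟨g, hg⟩ => hn k ⟨e.symm.toMonoidHom.comp g, e.symm.injective.comp hg⟩⟩, fun p hp => ?_⟩
  refine Set.Finite.subset ((h2 p hp).image e) ?_
  intro x hx
  refine ⟨e.symm x, ?_, e.apply_symm_apply x⟩
  change (e.symm x)^p = 1
  rw [← map_pow]
  change e.symm (x^p) = 1
  rw [show x^p = 1 from hx, map_one]

lemma FRS_sub {G : Type} [Group G] (h : SolvableOfFiniteRank G) (G0 : Subgroup G) : FRS G0 := by
  intro L X _ f hf hc
  let L' := L.map G0.subtype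
  let e : L ≃* L' := L.equivMapOfInjective G0.subtype G0.subtype_injective
  exact (FRS_of h.2 L' X (f.comp e.symm.toMonoidHom) (hf.comp e.symm.surjective) hc).1

lemma SecFin_of {G : Type} [Group G] (h : SolvableOfFiniteRank G) (p : ℕ) (hp : p.Prime) : SecFin p G := by
  intro L X _ f hf
  exact (FRS_of h.2 L X f hf mul_comm).2 p hp

lemma T_step {G : Type} [Group G] (N : Subgroup G) (hN : N.Normal) (S S' : Subgroup G) (hle : S ≤ S')
    (hSn : ∀ (g t : G), t ∈ S → g * t * g⁻¹ ∈ S) (hSn' : ∀ (g t : G), t ∈ S' → g * t * g⁻¹ ∈ S')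
    (hcen : ∀ (n t : G), n ∈ N → t ∈ S' → n * t * n⁻¹ * t⁻¹ ∈ S) 
    (hm : S.relIndex S' = 0 → ∃ M : Rep.{0} ℤ (G ⧸ N), NiceRep (groupSpectrum G) M ∧
          ∃ φ : M → G,
            (∀ m : M, φ m ∈ S') ∧
            (∀ m m' : M, (φ (m + m'))⁻¹ * (φ m * φ m') ∈ S) ∧
            (∀ t : G, t ∈ S' → ∃ m : M, (φ m)⁻¹ * t ∈ S) ∧
            (∀ (g : G) (m : M),
              (φ (M.ρ (QuotientGroup.mk g) m))⁻¹ * (g * φ m * g⁻¹) ∈ S))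
    (q : G) : ∃ f : ℤ[X], f ≠ 0 ∧ ∀ z ∈ S', W (fun i => q^i * z * (q^i)⁻¹) f ∈ S := by
  haveI hS : S.Normal := ⟨fun n hn g => hSn g n hn⟩
  by_cases hr : S.relIndex S' = 0
  · obtain ⟨M, ⟨htf, hfr, -⟩, φ, h1, h2, h3, h4⟩ := hm hr
    let φ' : Multiplicative M →* G ⧸ S := MonoidHom.mk' (fun m => (φ m.toAdd : G ⧸ S)) (by
      intro a b
      exact (QuotientGroup.eq.2 (h2 _ _)))
    let β : AddMonoid.End M := (M.ρ (QuotientGroup.mk q)).toAddMonoidHom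
    obtain ⟨f, hf, h0⟩ := RF htf hfr.1 β
    refine ⟨f, hf, fun z hz => ?_⟩
    obtain ⟨m, hm⟩ := h3 z hz
    have e1 := W_eval φ' β m f
    rw [h0] at e1
    have e2 := W_map (QuotientGroup.mk' S) (fun i => q^i * z * (q^i)⁻¹) f
    have e3 : ∀ i : ℕ, QuotientGroup.mk' S (q^i * z * (q^i)⁻¹) = φ' (Multiplicative.ofAdd ((β^i) m)) := by
      intro i
      induction i with
      | zero =>
        rw [pow_zero, one_mul, inv_one, mul_one]
        exact (QuotientGroup.eq.2 hm).symm
      | succ i ih =>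
        have e : φ' (Multiplicative.ofAdd ((β^(i+1)) m)) = (q : G ⧸ S) * φ' (Multiplicative.ofAdd ((β^i) m)) * (q : G ⧸ S)⁻¹ := by
          rw [pow_succ']
          exact QuotientGroup.eq.2 (h4 q ((β^i) m))
        rw [e, ← ih]
        change ((q^(i+1) * z * (q^(i+1))⁻¹ : G) : G ⧸ S) = ((q * (q^i * z * (q^i)⁻¹) * q⁻¹ : G) : G ⧸ S)
        congr 1
        rw [pow_succ']; group
    rw [← QuotientGroup.eq_one_iff]
    refine e2.trans ?_
    rw [funext e3, e1]
    exact map_one φ'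
  · refine ⟨C (S.relIndex S' : ℤ), by simpa using hr, fun z hz => ?_⟩
    rw [W_C, pow_zero, one_mul, inv_one, mul_one, zpow_natCast]
    exact Subgroup.pow_relIndex_mem S hz

lemma full_chain {G : Type} [Group G] (hsf : SolvableOfFiniteRank G) (N : Subgroup G) (hN : N.Normal) (hnil : Group.IsNilpotent N)
    (r : ℕ) (T : Fin (r + 1) → Subgroup G) (hmono : Monotone T) (hT0 : T 0 = ⊥)
    (hTl : (T (Fin.last r) : Set G) = {g : G | g ∈ N ∧ IsOfFinOrder g})
    (hTn : ∀ (i : Fin (r + 1)) (g t : G), t ∈ T i → g * t * g⁻¹ ∈ T i)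
    (hTc : ∀ (i : Fin r) (n t : G), n ∈ N → t ∈ T i.succ → n * t * n⁻¹ * t⁻¹ ∈ T i.castSucc)
    (hTm : ∀ i : Fin r, (T i.castSucc).relIndex (T i.succ) = 0 →
        ∃ M : Rep.{0} ℤ (G ⧸ N), NiceRep (groupSpectrum G) M ∧
          ∃ φ : M → G,
            (∀ m : M, φ m ∈ T i.succ) ∧
            (∀ m m' : M, (φ (m + m'))⁻¹ * (φ m * φ m') ∈ T i.castSucc) ∧
            (∀ t : G, t ∈ T i.succ → ∃ m : M, (φ m)⁻¹ * t ∈ T i.castSucc) ∧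
            (∀ (g : G) (m : M),
              (φ (M.ρ (QuotientGroup.mk g) m))⁻¹ * (g * φ m * g⁻¹) ∈ T i.castSucc))
    (G0 : Subgroup G) (K : Subgroup G0) (hK : K.Normal) (hKN : ∀ x ∈ K, (x : G) ∈ N) (q : G0) :
    Relation.ReflTransGen (Step q K) ⊥ K := by
  let S : Fin (r+1) → Subgroup G0 := fun i => (T i).subgroupOf G0 ⊓ K
  have hSmem : ∀ i x, x ∈ S i ↔ (x : G) ∈ T i ∧ x ∈ K := by
    intro i x
    change x ∈ (T i).subgroupOf G0 ∧ _ ↔ _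
    rw [Subgroup.mem_subgroupOf]; rfl
  have hSn : ∀ i, (S i).Normal := by
    intro i
    constructor
    intro x hx g
    rw [hSmem] at hx ⊢
    exact ⟨hTn i g x hx.1, hK.conj_mem x hx.2 g⟩
  have hS0 : S 0 = ⊥ := by
    rw [eq_bot_iff]
    intro x hx
    rw [hSmem, hT0, Subgroup.mem_bot] at hx
    rw [Subgroup.mem_bot]
    exact Subtype.ext hx.1
  have h1 : ∀ i, Relation.ReflTransGen (Step q K) ⊥ (S i) := by
    intro i
    induction i using Fin.induction with
    | zero => rw [hS0]
    | succ i ih =>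
      refine ih.tail ⟨hSn _, hSn _, ?_, ?_, ?_, ?_⟩
      · intro x hx
        rw [hSmem] at hx ⊢
        exact ⟨hmono (Fin.castSucc_lt_succ).le hx.1, hx.2⟩
      · intro x hx
        exact ((hSmem _ _).1 hx).2
      · intro k hk s hs
        rw [hSmem] at hs ⊢
        exact ⟨hTc i k s (hKN k hk) hs.1, mul_mem (hK.conj_mem s hs.2 k) (inv_mem hs.2)⟩
      · obtain ⟨f, hf, h⟩ := T_step N hN (T i.castSucc) (T i.succ) (hmono (Fin.castSucc_lt_succ).le)
          (hTn _) (hTn _) (hTc i) (hTm i) (q : G)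
        refine ⟨f, hf, fun z hz => ?_⟩
        rw [hSmem] at hz ⊢
        constructor
        · have e := W_map G0.subtype (fun i => q^i * z * (q^i)⁻¹) f
          have h2 := h z hz.1
          have e2 : (fun i : ℕ => G0.subtype (q^i * z * (q^i)⁻¹)) = fun i : ℕ => (q:G)^i * (z:G) * ((q:G)^i)⁻¹ := by
            funext i; simp
          rw [e2] at e
          rw [← e] at h2
          exact h2
        · apply list_prod_mem
          intro x hx
          rw [List.mem_map] at hx
          obtain ⟨k, _, rfl⟩ := hx
          exact zpow_mem (hK.conj_mem z hz.2 _) _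
  refine (h1 (Fin.last r)).trans ?_
  have hlast : ∀ x, x ∈ S (Fin.last r) ↔ x ∈ K ∧ IsOfFinOrder x := by
    intro x
    rw [hSmem]
    have : (x : G) ∈ T (Fin.last r) ↔ (x : G) ∈ N ∧ IsOfFinOrder (x : G) := by
      rw [← SetLike.mem_coe, hTl]; rfl
    rw [this, show IsOfFinOrder (x : G) ↔ IsOfFinOrder x from Submonoid.isOfFinOrder_coe (H := G0.toSubmonoid)]
    constructor
    · rintro ⟨⟨_, h⟩, h'⟩; exact ⟨h', h⟩
    · rintro ⟨h, h'⟩; exact ⟨⟨hKN x h, h'⟩, h⟩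
  have hKnil : Group.IsNilpotent K := by
    let ι : K →* N := (G0.subtype.comp K.subtype).codRestrict N (fun x => hKN x x.2)
    have hι : Function.Injective ι := by
      intro a b hab
      have := congrArg Subtype.val hab
      exact Subtype.ext (Subtype.ext this)
    exact isNilpotent_of_ker_le_center ι (by rw [(MonoidHom.ker_eq_bot_iff ι).2 hι]; exact bot_le)
  obtain ⟨c, hc⟩ := (Subgroup.isNilpotent_iff_lowerCentralSeries K).1 hKnil
  refine U_chain (FRS_sub hsf G0) q K hK K.lowerCentralSeries rfl ?_ c _ (hSn _) ?_ ?_ ?_ ?_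
  · intro i x hx y hy
    have h2 := Subgroup.commutator_mem_commutator hx hy
    have h3 := inv_mem h2
    have e : y * x * y⁻¹ * x⁻¹ = (x * y * x⁻¹ * y⁻¹)⁻¹ := by group
    rw [e]
    exact h3
  · intro x hx; exact ((hlast x).1 hx).1
  · rintro x ⟨hx, -⟩ n hn hxn
    rw [hlast] at hxn ⊢
    exact ⟨hx, (isOfFinOrder_pow.1 hxn.2).resolve_right hn⟩
  · intro i; exact K.lowerCentralSeries_antitone (Nat.zero_le i)
  · rw [hc]; exact bot_le

end CC
end

noncomputable section
namespace CC
open Polynomial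

lemma cd_change {k k' G M : Type} [CommRing k] [CommRing k'] [Group G] [AddCommGroup M] [Module k M] [Module k' M]
    (ρ : Representation k G M) (ρ' : Representation k' G M) (h : ∀ g m, ρ g m = ρ' g m) (n : ℕ)
    (f : (Fin n → G) → M) : cd ρ n f = cd ρ' n f := by
  funext g
  rw [cd_apply, cd_apply, h]
  congr 1
  refine Finset.sum_congr rfl fun j _ => ?_
  rcases Nat.even_or_odd ((j:ℕ)+1) with e | e
  · rw [e.neg_one_pow, e.neg_one_pow, one_smul, one_smul]
  · rw [e.neg_one_pow, e.neg_one_pow, neg_smul, neg_smul, one_smul, one_smul]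

lemma Bd_change {k k' G M : Type} [CommRing k] [CommRing k'] [Group G] [AddCommGroup M] [Module k M] [Module k' M]
    (ρ : Representation k G M) (ρ' : Representation k' G M) (h : ∀ g m, ρ g m = ρ' g m) (n : ℕ)
    (f : (Fin n → G) → M) (hf : f ∈ Bd ρ n) : f ∈ Bd ρ' n := by
  cases n with
  | zero => exact Bd_zero.2 (Bd_zero.1 hf)
  | succ n =>
    obtain ⟨b, hb⟩ := Bd_succ.1 hf
    exact Bd_succ.2 ⟨b, by rw [← cd_change ρ ρ' h, hb]⟩

variable {p : ℕ} [Fact p.Prime] {A : Type} [AddCommGroup A] [Module ℤ_[p] A]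

lemma kill_comm {Γ : Type} [Group Γ] (ρ : Representation ℤ_[p] Γ A) (q : Γ) (K : Subgroup Γ)
    (hK : ∀ x y : Γ, x * y * x⁻¹ * y⁻¹ ∈ K) (hch : Relation.ReflTransGen (Step q K) ⊥ K)
    (hKρ : ∀ x ∈ K, ρ x = 1)
    (hq : ∀ h : ℤ[X], h ≠ 0 → ∃ (u : EE p A) (v : ℕ), u * aeval (ρ q) h = p ^ v • 1 ∧ ∀ x, u * ρ x = ρ x * u)
    (n : ℕ) : ∃ v : ℕ, ∀ x : H ρ n, p ^ v • x = 0 := by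
  have hcomm : ∀ x y, ρ x * ρ y = ρ y * ρ x := by
    intro x y
    have h := hKρ _ (hK x y)
    have : ρ (x * y * x⁻¹ * y⁻¹ * y * x) = ρ (y * x) := by
      rw [mul_assoc _ y x, map_mul, h, one_mul]
    rw [← map_mul, ← map_mul, ← this]; congr 1; group
  letI : Module ℤ[X] A := Module.compHom A (aeval (ρ q) : ℤ[X] →ₐ[ℤ] EE p A).toRingHom
  have hsm : ∀ (f : ℤ[X]) (a : A), f • a = aeval (ρ q) f a := fun _ _ => rfl
  have hcf : ∀ (f : ℤ[X]) x, ρ x * aeval (ρ q) f = aeval (ρ q) f * ρ x := by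
    intro f x
    have : Commute (ρ x) (ρ q) := hcomm x q
    induction f using Polynomial.induction_on with
    | C a => rw [aeval_C]; exact (Algebra.commutes a (ρ x)).symm
    | add f g hf hg => rw [map_add, mul_add, add_mul, hf, hg]
    | monomial n a _ =>
      rw [map_mul, aeval_C, map_pow, aeval_X]
      exact ((Algebra.commute_algebraMap_right a (ρ x)).mul_right (this.pow_right _)).eq
  let ρ0 : Representation ℤ[X] Γ A :=
    { toFun := fun x => { toFun := fun a => ρ x a, map_add' := fun a b => map_add _ a b
                          map_smul' := fun f a => by
                            rw [hsm, hsm]; exact LinearMap.congr_fun (hcf f x) a }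
      map_one' := by ext a; simp
      map_mul' := fun x y => by ext a; simp }
  have h0 : ∀ x a, ρ0 x a = ρ x a := fun _ _ => rfl
  obtain ⟨f, hf, hk⟩ := claim (k := ℤ[X]) (Polynomial.X) q K ⊥ hK hch Γ (MonoidHom.id Γ) Function.surjective_id MonoidHom.ker_id
     A ρ0 (fun x hx => by ext a; change ρ x a = a; rw [hKρ x hx]; rfl) (by
      have : (Polynomial.X : ℤ[X]) • ρ0 ((MonoidHom.id Γ) q⁻¹) = 1 := by
        ext a
        change (Polynomial.X : ℤ[X]) • (ρ q⁻¹ a) = a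
        rw [hsm, aeval_X, ← Module.End.mul_apply, ← map_mul, mul_inv_cancel, map_one]; rfl
      rw [this]; exact isAlgebraic_one) n
  have haX : ∀ I : Algebra ℤ ℤ[X], @aeval ℤ ℤ[X] _ _ I X f = f := by
    intro I
    rw [Subsingleton.elim I (Polynomial.algebraOfAlgebra)]
    exact aeval_X_left_apply f
  rw [haX] at hk
  obtain ⟨u, v, huv, huc⟩ := hq f hf
  refine ⟨v, fun x => ?_⟩
  obtain ⟨c, hc, rfl⟩ := Hmk_surj x
  have hc0 : cd ρ0 n c = 0 := by rw [cd_change ρ0 ρ h0]; exact hc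
  have h1 := hk (Hmk ρ0 n c hc0)
  rw [Hmk_smul, Hmk_eq_zero] at h1
  have h2 := Bd_change ρ0 ρ h0 n _ h1
  have h3 := cmap_Bd (PHom.ofLin (ρA := ρ) (ρB := ρ) u (fun x m => LinearMap.congr_fun (huc x) m)) h2
  have e : cmap (PHom.ofLin (ρA := ρ) (ρB := ρ) u (fun x m => LinearMap.congr_fun (huc x) m)) n (f • c) = ((p ^ v : ℕ) : ℤ_[p]) • c := by
    funext g
    rw [cmap_apply]
    change u (f • c g) = ((p ^ v : ℕ) : ℤ_[p]) • c g
    rw [hsm, ← Module.End.mul_apply, huv, Nat.cast_smul_eq_nsmul]; rfl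
  rw [e] at h3
  rw [← Nat.cast_smul_eq_nsmul ℤ_[p], Hmk_smul, Hmk_eq_zero]; exact h3

lemma kill_serre {k : Type} [CommRing k] : IsSerre (k := k) (fun X _ _ => ∃ e : ℕ, e ≠ 0 ∧ ∀ x : X, e • x = 0) := by
  constructor
  · intro X Y Z _ _ _ _ _ _ f g h ⟨a, ha, hX⟩ ⟨b, hb, hZ⟩
    refine ⟨a * b, mul_ne_zero ha hb, fun y => ?_⟩
    have : g (b • y) = 0 := by rw [map_nsmul, hZ]
    obtain ⟨x, hx⟩ := (h _).1 this
    rw [mul_smul, ← hx, ← map_nsmul, hX, map_zero]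
  · exact ⟨1, one_ne_zero, fun _ => rfl⟩

theorem kill {G : Type} [Group G] (hG : MemClassU G) (hA : PCtx p A) (ρ : Representation ℤ_[p] G A) (hi : Irr ρ)
    (g₀ : G) (htr : ¬ IsAlgebraic ℤ (ρ g₀)) (n : ℕ) : ∃ e : ℕ, e ≠ 0 ∧ ∀ x : H ρ n, e • x = 0 := by
  obtain ⟨hsf, N, hN, hnil, -, hva, r, T, hmono, hT0, hTl, hTn, hTc, hTm⟩ := hG
  obtain ⟨G0, hG0, hfi, -, hcN, hcomm⟩ := exists_G0 hA hi N hN hnil hva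
  obtain ⟨q, hq, hqs⟩ := exists_q hA hi G0 hG0 hfi hcomm g₀ htr
  let K : Subgroup G0 := N.subgroupOf G0 ⊓ (ρ.comp G0.subtype).ker
  have hKmem : ∀ x : G0, x ∈ K ↔ (x : G) ∈ N ∧ ρ x = 1 := by
    intro x
    change x ∈ N.subgroupOf G0 ∧ x ∈ (ρ.comp G0.subtype).ker ↔ _
    rw [Subgroup.mem_subgroupOf, MonoidHom.mem_ker]; rfl
  have hKn : K.Normal := by
    have : (N.subgroupOf G0).Normal := inferInstance
    exact Subgroup.normal_inf_normal _ _
  have hch := full_chain hsf N hN hnil r T hmono hT0 hTl hTn hTc hTm G0 K hKn (fun x hx => ((hKmem x).1 hx).1) ⟨q, hq⟩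
  have hk : ∀ j, ∃ v : ℕ, ∀ x : H (res G0 ρ) j, p ^ v • x = 0 := by
    intro j
    refine kill_comm (res G0 ρ) ⟨q, hq⟩ K (fun x y => (hKmem _).2 ⟨?_, ?_⟩) hch (fun x hx => ((hKmem x).1 hx).2) (fun h hh => ?_) j
    · have := hcN x x.2 y y.2
      rwa [commutatorElement_def] at this
    · have e : ρ ((x : G) * y * (x : G)⁻¹ * (y : G)⁻¹) = 1 := by
        rw [map_mul, map_mul, map_mul, hcomm x x.2 y y.2, mul_assoc (ρ y), ← map_mul ρ (x : G), mul_inv_cancel, map_one, mul_one, ← map_mul, mul_inv_cancel, map_one]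
      exact e
    · obtain ⟨u, v, h1, h2⟩ := hqs h hh
      exact ⟨u, v, h1, fun x => h2 x x.2⟩
  refine lhs (QuotientGroup.mk' G0) (QuotientGroup.mk'_surjective G0) kill_serre n ρ fun i j _ => ?_
  have hk' : ∀ L : Subgroup G, L = G0 → ∃ v : ℕ, ∀ x : H (res L ρ) j, p ^ v • x = 0 := by
    rintro L rfl; exact hk j
  obtain ⟨v, hv⟩ := hk' _ (QuotientGroup.ker_mk' G0)
  exact ⟨p ^ v, pow_ne_zero _ (Fact.out : p.Prime).ne_zero, fun x => H_killn _ _ hv i x⟩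

end CC
end

noncomputable section
namespace CC
open Polynomial

lemma rc_fin (m : ℕ) (hm : m ≠ 0) : {x : RatCircle | m • x = 0}.Finite := by
  have hm' : (m : ℚ) ≠ 0 := by exact_mod_cast hm
  let y : RatCircle := QuotientAddGroup.mk ((m : ℚ)⁻¹)
  have hy : m • y = 0 := by
    change (QuotientAddGroup.mk (m • (m : ℚ)⁻¹) : RatCircle) = 0
    rw [QuotientAddGroup.eq_zero_iff, nsmul_eq_mul, mul_inv_cancel₀ hm']
    exact AddSubgroup.mem_zmultiples _
  have hf : IsOfFinAddOrder y := isOfFinAddOrder_iff_nsmul_eq_zero.2 ⟨m, Nat.pos_of_ne_zero hm, hy⟩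
  have : Finite (AddSubgroup.zmultiples y) := finite_zmultiples.2 hf
  refine (Set.toFinite (AddSubgroup.zmultiples y : Set RatCircle)).subset ?_
  intro x hx
  obtain ⟨r, rfl⟩ := QuotientAddGroup.mk_surjective x
  have hx' : (QuotientAddGroup.mk (m • r) : RatCircle) = 0 := hx
  rw [QuotientAddGroup.eq_zero_iff] at hx'
  obtain ⟨z, hz⟩ := AddSubgroup.mem_zmultiples_iff.1 hx'
  refine AddSubgroup.mem_zmultiples_iff.2 ⟨z, ?_⟩
  change (QuotientAddGroup.mk (z • (m : ℚ)⁻¹) : RatCircle) = _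
  congr 1
  rw [zsmul_eq_mul, nsmul_eq_mul, mul_one] at hz
  rw [zsmul_eq_mul, hz]; field_simp

variable {A : Type} [AddCommGroup A]

lemma cern_fin (h : IsCernikov A) (m : ℕ) (hm : m ≠ 0) : {x : A | m • x = 0}.Finite := by
  obtain ⟨S, r, p, hS, -, ⟨e⟩⟩ := h
  have h1 : {s : S | m • s = 0}.Finite := by
    have h2 : (Set.univ.pi (fun _ : Fin r => {x : RatCircle | m • x = 0})).Finite :=
      Set.Finite.pi' (fun _ => rc_fin m hm) |>.subset (fun x hx i => hx i (Set.mem_univ i))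
    refine h2.preimage (f := fun s : S => fun i => ((e s i : pruferSubgroup (p i)) : RatCircle)) ?_ |>.subset ?_
    · intro a _ b _ hab
      apply e.injective
      funext i
      exact Subtype.ext (congrFun hab i)
    · intro s hs i _
      have : m • e s = 0 := by rw [← map_nsmul, hs, map_zero]
      have := congrFun this i
      exact congrArg Subtype.val this
  let B : AddSubgroup A := (nsmulAddMonoidHom (α := A) m).ker
  have hB : ∀ x, x ∈ B ↔ m • x = 0 := fun x => Iff.rfl
  have hfi : Finite (A ⧸ S) := by
    haveI : S.FiniteIndex := ⟨hS⟩
    exact AddSubgroup.finite_quotient_of_finiteIndex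
  let φ : B →+ A ⧸ S := (QuotientAddGroup.mk' S).comp B.subtype
  have hk : Finite φ.ker := by
    have : Finite {s : S | m • s = 0} := h1
    have hmem : ∀ x : φ.ker, ((x : B) : A) ∈ S := fun x => (QuotientAddGroup.eq_zero_iff _).1 x.2
    refine Finite.of_injective (β := {s : S | m • s = 0}) (fun x => ⟨⟨_, hmem x⟩, Subtype.ext ((hB _).1 x.1.2)⟩) ?_
    intro a b hab
    exact Subtype.ext (Subtype.ext (congrArg (fun z => ((z : S) : A)) (congrArg Subtype.val hab)))
  have hr : Finite φ.range := inferInstance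
  have : Finite (B ⧸ φ.ker) := Finite.of_equiv _ (QuotientAddGroup.quotientKerEquivRange φ).symm.toEquiv
  have : Finite B := Finite.of_equiv _ (AddSubgroup.addGroupEquivQuotientProdAddSubgroup (s := φ.ker)).symm
  exact Set.toFinite (B : Set A)

lemma div_of {G : Type} [Group G] (σ : G → A →+ A) (hc : IsCernikov A) (hinf : Infinite A)
    (hproper : ∀ S : AddSubgroup A, (∀ g, ∀ a ∈ S, σ g a ∈ S) → S ≠ ⊤ → (S : Set A).Finite)
    (m : ℕ) (hm : m ≠ 0) (a : A) : ∃ b, m • b = a := by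
  let f := nsmulAddMonoidHom (α := A) m
  by_contra hcon
  have hne : f.range ≠ ⊤ := by
    intro h
    have : a ∈ f.range := h ▸ AddSubgroup.mem_top a
    exact hcon this
  have h1 := hproper f.range (by
    rintro g _ ⟨b, rfl⟩
    exact ⟨σ g b, (map_nsmul (σ g) m b).symm⟩) hne
  have : Finite f.range := h1
  have : Finite f.ker := cern_fin hc m hm
  have : Finite (A ⧸ f.ker) := Finite.of_equiv _ (QuotientAddGroup.quotientKerEquivRange f).symm.toEquiv
  have : Finite A := Finite.of_equiv _ (AddSubgroup.addGroupEquivQuotientProdAddSubgroup (s := f.ker)).symm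
  exact not_finite A

lemma exists_p {G : Type} [Group G] (σ : G → A →+ A) (ω : Set ℕ) (hA : IsCernikovOmega ω A) (hinf : Infinite A)
    (hproper : ∀ S : AddSubgroup A, (∀ g, ∀ a ∈ S, σ g a ∈ S) → S ≠ ⊤ → (S : Set A).Finite) :
    ∃ p, p.Prime ∧ p ∈ ω ∧ PCtx p A := by
  have hd := div_of σ hA.1 hinf hproper
  obtain ⟨a, ha⟩ := exists_ne (0 : A)
  have ho : addOrderOf a ≠ 1 := fun h => ha (AddMonoid.addOrderOf_eq_one_iff.1 h)
  have hop : 0 < addOrderOf a := (hA.2 a).1.addOrderOf_pos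
  let p := (addOrderOf a).minFac
  have hp : p.Prime := Nat.minFac_prime ho
  haveI : Fact p.Prime := ⟨hp⟩
  have hpd : p ∣ addOrderOf a := Nat.minFac_dvd _
  obtain ⟨c, hc⟩ := hpd
  have hc0 : c ≠ 0 := by rintro rfl; omega
  let b := c • a
  have hb : p • b = 0 := by
    change p • c • a = 0
    rw [← mul_smul, ← hc, addOrderOf_nsmul_eq_zero]
  have hb0 : b ≠ 0 := by
    apply nsmul_ne_zero_of_lt_addOrderOf hc0
    rw [hc]
    have := hp.two_le
    nlinarith [Nat.pos_of_ne_zero hc0]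
  refine ⟨p, hp, (hA.2 a).2 p hp (by exact_mod_cast Nat.minFac_dvd _), ?_, hd p hp.ne_zero, cern_fin hA.1 p hp.ne_zero⟩
  let T : AddSubgroup A :=
    { carrier := {x | ∃ n, p ^ n • x = 0}
      zero_mem' := ⟨0, smul_zero _⟩
      add_mem' := by
        rintro a b ⟨m, hm⟩ ⟨n, hn⟩
        refine ⟨m + n, ?_⟩
        rw [smul_add, pow_kill_le (Nat.le_add_right m n) hm, pow_kill_le (Nat.le_add_left n m) hn, add_zero]
      neg_mem' := by
        rintro a ⟨m, hm⟩
        exact ⟨m, by rw [smul_neg, hm, neg_zero]⟩ }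
  have hT : T = ⊤ := by
    by_contra hne
    have hfin := hproper T (by
      rintro g x ⟨n, hn⟩
      exact ⟨n, by rw [← map_nsmul, hn, map_zero]⟩) hne
    have : Finite T := hfin
    have hker : ∀ x ∈ T, Nat.card T • x = 0 := by
      intro x hx
      have := card_nsmul_eq_zero' (x := (⟨x, hx⟩ : T))
      exact congrArg Subtype.val this
    obtain ⟨N, hN⟩ : ∃ N, ∀ x ∈ T, p ^ N • x = 0 := by
      choose! f hf using (fun x (hx : x ∈ T) => (hx : ∃ n, p ^ n • x = 0))
      obtain ⟨N, hN⟩ := (hfin.image f).bddAbove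
      exact ⟨N, fun x hx => pow_kill_le (hN ⟨x, hx, rfl⟩) (hf x hx)⟩
    obtain ⟨d, hd'⟩ := hd (p ^ N) (pow_ne_zero _ hp.ne_zero) b
    apply hb0
    rw [← hd']
    exact hN d ⟨N+1, by rw [pow_succ', mul_smul, hd', hb]⟩
  intro x
  have : x ∈ T := hT ▸ AddSubgroup.mem_top x
  exact this

end CC
end

noncomputable section
namespace CC
open Polynomial

theorem fin_H {p : ℕ} [hpf : Fact p.Prime] {A : Type} [AddCommGroup A] [Module ℤ_[p] A]
    {G : Type} [Group G] (hG : MemClassU G) (hA : PCtx p A) (ρ : Representation ℤ_[p] G A) (hi : Irr ρ)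
    (g₀ : G) (htr : ¬ IsAlgebraic ℤ (ρ g₀)) (n : ℕ) (hdiv : ∀ m : ℕ, m ≠ 0 → ∀ a : A, ∃ b, m • b = a)
    (hfin : ∀ m : ℕ, m ≠ 0 → {a : A | m • a = 0}.Finite) :
    Finite (H ρ n) ∧ ∃ m : ℕ, ∀ x : H ρ n, p ^ m • x = 0 := by
  obtain ⟨e, he, hk⟩ := kill hG hA ρ hi g₀ htr n
  let E : A →ₗ[ℤ_[p]] A := e • LinearMap.id
  have hE : ∀ a, E a = e • a := fun a => rfl
  let W := LinearMap.ker E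
  have hW : ∀ a, a ∈ W ↔ e • a = 0 := fun a => Iff.rfl
  have hinv : ∀ g, ∀ w ∈ W, ρ g w ∈ W := by
    intro g w hw
    rw [hW, ← map_nsmul, (hW w).1 hw, map_zero]
  have s : SES (subRep ρ W hinv) ρ ρ W.subtype E :=
    { hf := fun x m => rfl
      hg := fun x m => by rw [hE, hE, map_nsmul]
      inj := Subtype.val_injective
      surj := fun a => hdiv e he a
      exact := by
        intro a
        constructor
        · intro h; exact ⟨⟨a, h⟩, rfl⟩
        · rintro ⟨w, rfl⟩; exact w.2 }
  have hWfin : Finite W := hfin e he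
  obtain ⟨m, hm⟩ : ∃ m, ∀ x : W, p ^ m • x = 0 := by
    choose f hf using hA.prim
    obtain ⟨N, hN⟩ := (Set.finite_range (fun x : W => f x)).bddAbove
    exact ⟨N, fun x => Subtype.ext (pow_kill_le (hN ⟨x, rfl⟩) (hf x))⟩
  have hgood := Good.solvable ℤ_[p] p hpf.out G hG.1.1 (SecFin_of hG.1 p hpf.out)
  have h1 := hgood W m hm (subRep ρ W hinv) n
  have hsurj : Function.Surjective (Hmap s.F n) := by
    intro x
    apply (s.exact1 n x).1
    obtain ⟨c, hc, rfl⟩ := Hmk_surj x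
    have := hk (Hmk ρ n c hc)
    rw [← Nat.cast_smul_eq_nsmul ℤ_[p], Hmk_smul, Hmk_eq_zero] at this
    rw [Hmap_mk, Hmk_eq_zero]
    convert this using 1
    funext g
    change e • c g = (e : ℤ_[p]) • c g
    rw [Nat.cast_smul_eq_nsmul]
  refine ⟨Finite.of_surjective _ hsurj, m, fun x => ?_⟩
  obtain ⟨y, rfl⟩ := hsurj x
  rw [← map_nsmul, H_killn _ _ hm n y, map_zero]

/-- comparison with Mathlib's group cohomology -/
lemma compare {R k : Type} [CommRing R] [CommRing k] {G : Type} [Group G] (A : Rep.{0} R G) [Module k A]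
    (ρ : Representation k G A) (h : ∀ g (a : A), ρ g a = A.ρ g a) (n : ℕ) (hf : Finite (H ρ n)) (m : ℕ)
    (hm : ∀ x : H ρ n, m • x = 0) :
    Finite (groupCohomology A n) ∧ ∀ x : groupCohomology A n, m • x = 0 := by
  have hd : ∀ j (f : (Fin j → G) → A), cd ρ j f = (inhomogeneousCochains.d A j).hom f := by
    intro j f
    rw [cd_change ρ A.ρ h]
    exact cd_eq A.ρ j f
  let ii : ∀ j, groupCohomology.cocycles A j → ((Fin j → G) → A) := fun j z => (groupCohomology.iCocycles A j).hom z
  have hii : ∀ j, Function.Injective (ii j) := fun j =>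
    (ModuleCat.mono_iff_injective (groupCohomology.iCocycles A j)).1 inferInstance
  have hadd : ∀ j z z', ii j (z - z') = ii j z - ii j z' := fun j z z' => map_sub (groupCohomology.iCocycles A j).hom z z'
  have hsm : ∀ j z, ii j (m • z) = m • ii j z := fun j z => map_nsmul (groupCohomology.iCocycles A j).hom m z
  have hc : ∀ j z, cd ρ j (ii j z) = 0 := by
    intro j z
    rw [hd, ← groupCohomology.inhomogeneousCochains.d_def]
    have := (groupCohomology.inhomogeneousCochains A).iCycles_d j (j+1)
    exact LinearMap.congr_fun (congrArg ModuleCat.Hom.hom this) z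
  have hb : ∀ j z, ii j z ∈ Bd ρ j → (groupCohomology.π A j).hom z = 0 := by
    intro j z hz
    cases j with
    | zero =>
      have h0 : z = 0 := hii 0 ((Bd_zero.1 hz).trans (map_zero (groupCohomology.iCocycles A 0).hom).symm)
      rw [h0]; exact map_zero _
    | succ j =>
      obtain ⟨b, hb⟩ := Bd_succ.1 hz
      have h1 := LinearMap.congr_fun (congrArg ModuleCat.Hom.hom
        ((groupCohomology.inhomogeneousCochains A).toCycles_i j (j+1))) b
      have h2 := LinearMap.congr_fun (congrArg ModuleCat.Hom.hom
        ((groupCohomology.inhomogeneousCochains A).toCycles_comp_homologyπ j (j+1))) b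
      have h3 : z = ((groupCohomology.toCocycles A j (j+1)).hom b) := by
        apply hii
        rw [← hb, hd, ← groupCohomology.inhomogeneousCochains.d_def]
        exact h1.symm
      rw [h3]; exact h2
  have hsur : Function.Surjective (groupCohomology.π A n).hom := 
    fun x => groupCohomology_induction_on x (fun z => ⟨z, rfl⟩)
  constructor
  · refine Finite.of_injective (β := H ρ n) (fun x => Hmk ρ n (ii n (Function.surjInv hsur x)) (hc n _)) ?_
    intro x y hxy
    have h1 := Hmk_eq.1 hxy
    rw [← hadd] at h1
    have h2 := hb n _ h1
    rw [map_sub, Function.surjInv_eq hsur, Function.surjInv_eq hsur] at h2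
    exact sub_eq_zero.1 h2
  · intro x
    obtain ⟨z, rfl⟩ := hsur x
    rw [← map_nsmul]
    apply hb
    rw [hsm]
    have := hm (Hmk ρ n (ii n z) (hc n z))
    rw [← Nat.cast_smul_eq_nsmul k, Hmk_smul, Hmk_eq_zero] at this
    convert this using 1
    funext g
    change m • ii n z g = (m : k) • ii n z g
    rw [Nat.cast_smul_eq_nsmul]

end CC
end

noncomputable section
namespace CC
open Polynomial

lemma aeval_same {R S M : Type} [CommRing R] [CommRing S] [AddCommGroup M] [Module R M] [Module S M]
    [I : Algebra ℤ (Module.End R M)] [J : Algebra ℤ (Module.End S M)] 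
    (x : Module.End R M) (y : Module.End S M) (h : ∀ a, x a = y a) (f : ℤ[X]) (a : M) :
    aeval x f a = aeval y f a := by
  have hp : ∀ (n : ℕ) a, (x ^ n) a = (y ^ n) a := by
    intro n
    induction n with
    | zero => intro a; rfl
    | succ n ih => intro a; rw [pow_succ, pow_succ, Module.End.mul_apply, Module.End.mul_apply, h, ih]
  induction f using Polynomial.induction_on' with
  | add f g hf hg => rw [map_add, map_add, LinearMap.add_apply, LinearMap.add_apply, hf, hg]
  | monomial n z =>
    rw [aeval_monomial, aeval_monomial, eq_intCast, eq_intCast, ← zsmul_eq_mul, ← zsmul_eq_mul,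
      LinearMap.smul_apply, LinearMap.smul_apply, hp]

lemma aeval_natC {R M : Type} [CommRing R] [AddCommGroup M] [Module R M]
    [I : Algebra ℤ (Module.End R M)] (x : Module.End R M) (m : ℕ) (a : M) : aeval x (C (m : ℤ)) a = m • a := by
  rw [aeval_C, eq_intCast, Int.cast_natCast, ← nsmul_one]; rfl

lemma cern_of_finite (ω : Set ℕ) {X : Type} [AddCommGroup X] (hf : Finite X) (p m : ℕ) (hp : p.Prime) (hpω : p ∈ ω)
    (h : ∀ x : X, p ^ m • x = 0) : IsCernikovOmega ω X := by
  constructor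
  · refine ⟨⊥, 0, fun i => i.elim0, ?_, fun i => i.elim0, ⟨?_⟩⟩
    · rw [AddSubgroup.index_bot]; exact Nat.card_pos.ne'
    · exact
        { toFun := fun _ i => i.elim0
          invFun := fun _ => 0
          left_inv := fun x => Subsingleton.elim _ _
          right_inv := fun x => Subsingleton.elim _ _
          map_add' := fun _ _ => Subsingleton.elim _ _ }
  · intro x
    refine ⟨isOfFinAddOrder_iff_nsmul_eq_zero.2 ⟨_, pow_pos hp.pos m, h x⟩, fun l hl hd => ?_⟩
    have h1 : l ∣ addOrderOf x := by exact_mod_cast hd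
    have h2 : l ∣ p ^ m := h1.trans (addOrderOf_dvd_of_nsmul_eq_zero (h x))
    rw [(Nat.prime_dvd_prime_iff_eq hl hp).1 (hl.dvd_of_dvd_pow h2)]
    exact hpω

theorem main {R : Type} [CommRing R] (G : Type) [Group G]
    (hG : MemClassU G) (ω : Set ℕ) (A : Rep.{0} R G) (hA : IsCernikovOmega ω A)
    (hproper : ∀ S : AddSubgroup A, (∀ (g : G), ∀ a ∈ S, A.ρ g a ∈ S) → S ≠ ⊤ →
      (S : Set A).Finite) [I : Algebra ℤ (Module.End R A)]
    (htrans : ∃ g : G, ∀ P : ℤ[X], P ≠ 0 → aeval (A.ρ g) P ≠ 0)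
    (n : ℕ) :
    IsCernikovOmega ω (groupCohomology A n) := by
  obtain ⟨g₀, hg₀⟩ := htrans
  have hinf : Infinite A := by
    by_contra hcon
    rw [not_infinite_iff_finite] at hcon
    refine hg₀ (C ((Nat.card A : ℕ) : ℤ)) ?_ ?_
    · rw [Ne, C_eq_zero]; exact_mod_cast Nat.card_pos.ne'
    · ext a
      rw [aeval_natC]
      exact card_nsmul_eq_zero'
  let σ : G → A →+ A := fun g => (A.ρ g).toAddMonoidHom
  have hpr : ∀ S : AddSubgroup A, (∀ g, ∀ a ∈ S, σ g a ∈ S) → S ≠ ⊤ → (S : Set A).Finite := hproper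
  obtain ⟨p, hp, hpω, hP⟩ := exists_p σ ω hA hinf hpr
  haveI : Fact p.Prime := ⟨hp⟩
  letI : Module ℤ_[p] A := zpModule hP.prim
  let ρ : Representation ℤ_[p] G A :=
    { toFun := fun g => linOf hP (σ g)
      map_one' := by
        ext a; change A.ρ 1 a = a; rw [map_one]; rfl
      map_mul' := fun x y => by
        ext a; change A.ρ (x * y) a = A.ρ x (A.ρ y a); rw [map_mul]; rfl }
  have hρ : ∀ g (a : A), ρ g a = A.ρ g a := fun _ _ => rfl
  have htr : ¬ IsAlgebraic ℤ (ρ g₀) := by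
    rintro ⟨f, hf, h0⟩
    refine hg₀ f hf ?_
    ext a
    rw [← aeval_same (ρ g₀) (A.ρ g₀) (hρ g₀) f a, h0]; rfl
  obtain ⟨h1, m, h2⟩ := fin_H hG hP ρ hproper g₀ htr n (div_of σ hA.1 hinf hpr) (cern_fin hA.1)
  obtain ⟨h3, h4⟩ := compare A ρ hρ n h1 (p ^ m) h2
  exact cern_of_finite ω h3 p m hp hpω h4

end CC

end

/-- Let `G` be a group in the class `𝒰` with spectrum `π`, and let `ω` be a set
of primes.  Let `A` be a `ℤG`-module whose underlying additive group is a
Černikov `ω`-group and all of whose proper `ℤG`-submodules are finite.  If some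
`g : G` acts on `A` by an automorphism satisfying no nonzero polynomial with
integer coefficients, then `H^n(G, A)` is a Černikov `ω`-group for all `n ≥ 0`. -/
theorem cernikov_cohomology_of_transcendental_action (G : Type) [Group G]
    (hG : MemClassU G) (ω : Set ℕ) (A : Rep ℤ G) (hA : IsCernikovOmega ω A)
    (hproper : ∀ S : AddSubgroup A, (∀ (g : G), ∀ a ∈ S, A.ρ g a ∈ S) → S ≠ ⊤ →
      (S : Set A).Finite)
    (htrans : ∃ g : G, ∀ P : Polynomial ℤ, P ≠ 0 → Polynomial.aeval (A.ρ g) P ≠ 0)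
    (n : ℕ) :
    IsCernikovOmega ω (groupCohomology A n) := by
  exact CC.main G hG ω A hA hproper htrans n

end
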